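/- Let β, h ≥ 0 and C > 0, and for each N let E_N denote the event that W ~ GOE(N) is such that μ_{βW,h𝟏} satisfies exponential overlap concentration with constant C. Then for every k ∈ ℕ there exists a constant C_k (depending only on β, h, C, k) such that for all N: E[ (R(σ,𝟏) − q₁(β,h))^{2k} · 1_{E_N} ] ≤ C_k·N^{−k}, where the expectation is over W ~ GOE(N) and a Gibbs sample σ ~ μ_{βW,h𝟏}. -/

import Mathlib

open MeasureTheory ProbabilityTheory

noncomputable section

/-- Standard Gaussian measure on `ℝ`. -/
def stdGaussian : Measure ℝ := gaussianReal 0 1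

/-- The overlap constant `q_{β,h}`, the unique solution in `(0,1]` of the replica-symmetric
fixed point equation (set to `0` for `h = 0`). -/
def qOverlap (β h : ℝ) : ℝ :=
  if h = 0 then 0 else
    sSup {q : ℝ | q ∈ Set.Ioc (0 : ℝ) 1 ∧
      q = ∫ g, Real.tanh (β * g * Real.sqrt q + h) ^ 2 ∂stdGaussian}

/-- `q₁(β,h) = E tanh(β g √q_{β,h} + h)`. -/
def q1 (β h : ℝ) : ℝ :=
  ∫ g, Real.tanh (β * g * Real.sqrt (qOverlap β h) + h) ∂stdGaussian

/-- Hyperbolic secant. -/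
def sech (x : ℝ) : ℝ := 1 / Real.cosh x

/-- The Almeida–Thouless condition for `(β,h)`. -/
def ATCond (β h : ℝ) : Prop :=
  β ^ 2 * ∫ g, sech (β * g * Real.sqrt (qOverlap β h) + h) ^ 4 ∂stdGaussian < 1

/-- The AT condition with gap at least `g0`. -/
def ATgap (β h g0 : ℝ) : Prop :=
  β ^ 2 * ∫ g, sech (β * g * Real.sqrt (qOverlap β h) + h) ^ 4 ∂stdGaussian ≤ 1 - g0

/-- The one-dimensional RGD/AMP update map `f_{β,λ}`. -/
def fbl (β lam z : ℝ) : ℝ :=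
  ∫ g, Real.tanh (β * g * Real.sqrt (qOverlap β (β * lam * z)) + β * lam * z) ∂stdGaussian

/-- `h_* = inf{h ≥ 0 : (β,h) satisfies AT}`. -/
def hStar (β : ℝ) : ℝ := sInf {h : ℝ | 0 ≤ h ∧ ATCond β h}

/-- The spin value of a Boolean. -/
def spin (b : Bool) : ℝ := if b then 1 else -1

/-- Normalized correlation `R(σ,ρ) = ⟨σ,ρ⟩/N`. -/
def overlap {N : ℕ} (σ ρ : Fin N → Bool) : ℝ := (∑ i, spin (σ i) * spin (ρ i)) / N

/-- The all-ones configuration `𝟏`. -/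
def onesConf (N : ℕ) : Fin N → Bool := fun _ => true

/-- Unnormalized SK Gibbs weight with interaction `β W` and external field `h 𝟏`. -/
def skWeight {N : ℕ} (W : Matrix (Fin N) (Fin N) ℝ) (β h : ℝ) (σ : Fin N → Bool) : ℝ :=
  Real.exp (β / 2 * (∑ i, ∑ j, W i j * spin (σ i) * spin (σ j)) + h * ∑ i, spin (σ i))

/-- SK partition function. -/
def skZ {N : ℕ} (W : Matrix (Fin N) (Fin N) ℝ) (β h : ℝ) : ℝ :=
  ∑ σ : Fin N → Bool, skWeight W β h σ

/-- Normalized SK Gibbs density. -/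
def skDensity {N : ℕ} (W : Matrix (Fin N) (Fin N) ℝ) (β h : ℝ) (σ : Fin N → Bool) : ℝ :=
  skWeight W β h σ / skZ W β h

/-- The SK Gibbs measure `μ_{βW, h𝟏}` on `{±1}^N`. -/
def skGibbs {N : ℕ} (W : Matrix (Fin N) (Fin N) ℝ) (β h : ℝ) : Measure (Fin N → Bool) :=
  ∑ σ : Fin N → Bool, ENNReal.ofReal (skDensity W β h σ) • Measure.dirac σ

instance matrixMeasurableSpace {N : ℕ} : MeasurableSpace (Matrix (Fin N) (Fin N) ℝ) :=
  (inferInstance : MeasurableSpace (Fin N → Fin N → ℝ))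

/-- The GOE(N) random matrix ensemble. -/
def GOE (N : ℕ) : Measure (Matrix (Fin N) (Fin N) ℝ) :=
  (Measure.pi fun p : Fin N × Fin N =>
      if p.1 = p.2 then gaussianReal 0 (2 / N) else gaussianReal 0 (1 / N)).map
    (fun W => Matrix.of fun i j => if i ≤ j then W (i, j) else W (j, i))

/-- Exponential overlap concentration with constant `C`. -/
def overlapConc {N : ℕ} (W : Matrix (Fin N) (Fin N) ℝ) (β h C : ℝ) : Prop :=
  (∫ σ1, ∫ σ2, Real.exp ((N : ℝ) * (overlap σ1 σ2 - qOverlap β h) ^ 2 / C)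
      ∂skGibbs W β h ∂skGibbs W β h) ≤ 2

section
/-- One-dimensional Gaussian integration by parts. -/
lemma gauss_ibp (τ : NNReal) (f f' : ℝ → ℝ) (hf : ∀ x, HasDerivAt f (f' x) x)
    (hf'c : Continuous f') (K : ℝ) (hK : ∀ x, |f x| ≤ K) (hK' : ∀ x, |f' x| ≤ K) :
    ∫ x, x * f x ∂gaussianReal 0 τ = τ * ∫ x, f' x ∂gaussianReal 0 τ := by
  by_cases hτ : τ = 0
  · subst hτ; simp [gaussianReal_zero_var]
  have hτ' : (τ : ℝ) ≠ 0 := by exact_mod_cast hτ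
  have hfc : Continuous f := continuous_iff_continuousAt.2 fun x => (hf x).continuousAt
  have hpd : ∀ x, HasDerivAt (gaussianPDFReal 0 τ) (-(x / τ) * gaussianPDFReal 0 τ x) x := by
    intro x
    rw [gaussianPDFReal_def]
    have h1 : HasDerivAt (fun x : ℝ => -(x - 0) ^ 2 / (2 * (τ : ℝ))) (-(x / τ)) x := by
      have := (((hasDerivAt_id' x).sub_const 0).fun_pow 2).fun_neg.div_const (2 * (τ : ℝ))
      refine this.congr_deriv ?_
      field_simp; norm_num; ring
    have := (h1.exp).const_mul ((Real.sqrt (2 * Real.pi * τ))⁻¹)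
    refine this.congr_deriv ?_
    ring
  have hIntg : Integrable (fun x => x * gaussianPDFReal 0 τ x) := by
    have h := (memLp_id_gaussianReal (μ := 0) (v := τ) 1).integrable (by simp)
    rw [gaussianReal_of_var_ne_zero _ hτ] at h
    rw [integrable_withDensity_iff (measurable_gaussianPDF _ _) (by simp [gaussianPDF])] at h
    simpa [toReal_gaussianPDF] using h
  have hp := integrable_gaussianPDFReal 0 τ
  have key := integral_mul_deriv_eq_deriv_mul_of_integrable (u := f) (v := gaussianPDFReal 0 τ)
    (u' := f') (v' := fun x => -(x / τ) * gaussianPDFReal 0 τ x)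
    (fun x _ => hf x) (fun x _ => hpd x) ?_ ?_ ?_
  · rw [integral_gaussianReal_eq_integral_smul hτ, integral_gaussianReal_eq_integral_smul hτ]
    have e1 : ∫ x, f x * (-(x / τ) * gaussianPDFReal 0 τ x)
        = -(τ:ℝ)⁻¹ * ∫ x, gaussianPDFReal 0 τ x • (x * f x) := by
      rw [← integral_const_mul]; congr 1; ext x; simp; field_simp
    have e2 : ∫ x, f' x * gaussianPDFReal 0 τ x = ∫ x, gaussianPDFReal 0 τ x • (f' x) := by
      congr 1; ext x; simp [mul_comm]
    rw [e1, e2] at key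
    field_simp at key
    linarith
  · have : (f * fun x => -(x / τ) * gaussianPDFReal 0 τ x)
        = fun x => f x * ((-(τ:ℝ)⁻¹) * (x * gaussianPDFReal 0 τ x)) := by
      ext x; simp only [Pi.mul_apply]; field_simp
    rw [this]
    exact (hIntg.const_mul _).bdd_mul (c := K) hfc.aestronglyMeasurable (by simpa using Filter.Eventually.of_forall hK)
  · exact hp.bdd_mul (c := K) hf'c.aestronglyMeasurable (by simpa using Filter.Eventually.of_forall hK')
  · exact hp.bdd_mul (c := K) hfc.aestronglyMeasurable (by simpa using Filter.Eventually.of_forall hK)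

/-- Resampling one coordinate preserves a product probability measure. -/
lemma mp_update {P : Type*} [Fintype P] [DecidableEq P] (γ : P → Measure ℝ)
    [∀ p, IsProbabilityMeasure (γ p)] (p : P) :
    MeasurePreserving (fun z : (P → ℝ) × ℝ => Function.update z.1 p z.2)
      ((Measure.pi γ).prod (γ p)) (Measure.pi γ) := by
  have hm : Measurable (fun z : (P → ℝ) × ℝ => Function.update z.1 p z.2) := by
    rw [measurable_pi_iff]
    intro j
    by_cases hj : j = p
    · subst hj; simpa using measurable_snd
    · simp only [Function.update_of_ne hj]; exact (measurable_pi_apply j).comp measurable_fst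
  refine ⟨hm, ?_⟩
  symm
  apply Measure.pi_eq
  intro s hs
  rw [Measure.map_apply hm (MeasurableSet.univ_pi hs)]
  have : (fun z : (P → ℝ) × ℝ => Function.update z.1 p z.2) ⁻¹' (Set.univ.pi s)
      = (Set.univ.pi (Function.update s p Set.univ)) ×ˢ (s p) := by
    ext z
    simp only [Set.mem_preimage, Set.mem_univ_pi, Set.mem_prod]
    constructor
    · intro h
      refine ⟨fun j => ?_, by simpa using h p⟩
      by_cases hj : j = p
      · subst hj; simp
      · simpa [hj] using h j
    · rintro ⟨h1, h2⟩ j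
      by_cases hj : j = p
      · subst hj; simpa using h2
      · simpa [hj] using h1 j
  rw [this, Measure.prod_prod, Measure.pi_pi, ← Finset.mul_prod_erase _ _ (Finset.mem_univ p),
    ← Finset.mul_prod_erase _ (fun i => γ i (s i)) (Finset.mem_univ p)]
  simp only [Function.update_self, measure_univ, one_mul]
  rw [mul_comm]
  congr 1
  apply Finset.prod_congr rfl
  intro j hj
  rw [Function.update_of_ne (Finset.ne_of_mem_erase hj)]

lemma integral_update {P : Type*} [Fintype P] [DecidableEq P] (γ : P → Measure ℝ)
    [∀ p, IsProbabilityMeasure (γ p)] (p : P) (F : (P → ℝ) → ℝ) (hF : Integrable F (Measure.pi γ)) :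
    ∫ x, F x ∂Measure.pi γ = ∫ x, ∫ r, F (Function.update x p r) ∂γ p ∂Measure.pi γ := by
  have h := mp_update γ p
  rw [← h.map_eq] at hF
  have e : ∫ x, F x ∂Measure.pi γ
      = ∫ x, F x ∂(((Measure.pi γ).prod (γ p)).map fun z : (P → ℝ) × ℝ => Function.update z.1 p z.2) := by
    rw [h.map_eq]
  rw [e, integral_map h.measurable.aemeasurable hF.aestronglyMeasurable,
    integral_prod (fun z : (P → ℝ) × ℝ => F (Function.update z.1 p z.2))
      (hF.comp_measurable h.measurable)]

lemma integrable_coord {P : Type*} [Fintype P] (τ : P → NNReal) (p : P) :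
    Integrable (fun x : P → ℝ => x p) (Measure.pi fun p => gaussianReal 0 (τ p)) := by
  have h := (memLp_id_gaussianReal (μ := 0) (v := τ p) 1).integrable (by simp)
  exact (measurePreserving_eval (fun p => gaussianReal 0 (τ p)) p).integrable_comp_of_integrable h

/-- Gaussian integration by parts in one coordinate of a product. -/
lemma gauss_ibp_pi {P : Type*} [Fintype P] [DecidableEq P] (τ : P → NNReal) (p : P)
    (F F' : (P → ℝ) → ℝ)
    (hF : ∀ x r, HasDerivAt (fun r => F (Function.update x p r)) (F' (Function.update x p r)) r)
    (hFc : Continuous F) (hF'c : Continuous F') (K : ℝ) (hK : ∀ x, |F x| ≤ K) (hK' : ∀ x, |F' x| ≤ K) :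
    ∫ x, x p * F x ∂(Measure.pi fun p => gaussianReal 0 (τ p))
      = τ p * ∫ x, F' x ∂(Measure.pi fun p => gaussianReal 0 (τ p)) := by
  rw [integral_update _ p, integral_update _ p F', ← integral_const_mul]
  · congr 1; ext x
    simp only [Function.update_self]
    apply gauss_ibp (τ p) (fun r => F (Function.update x p r)) (fun r => F' (Function.update x p r))
      (hF x) (hF'c.comp (by fun_prop)) K (fun r => hK _) (fun r => hK' _)
  · exact Integrable.of_bound hF'c.aestronglyMeasurable K (by simpa using Filter.Eventually.of_forall hK')
  · exact (integrable_coord τ p).mul_bdd (c := K) hFc.aestronglyMeasurable (by simpa using Filter.Eventually.of_forall hK)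
end

section
/-- Gibbs average with Hamiltonian `L`. -/
def gav {Ω : Type*} [Fintype Ω] (L F : Ω → ℝ) : ℝ :=
  (∑ ω, F ω * Real.exp (L ω)) / ∑ ω, Real.exp (L ω)

set_option linter.unusedSectionVars false

section gavs
variable {Ω : Type*} [Fintype Ω] [Nonempty Ω] (L : Ω → ℝ)

lemma gav_Z_pos : 0 < ∑ ω, Real.exp (L ω) :=
  Finset.sum_pos (fun _ _ => Real.exp_pos _) Finset.univ_nonempty

@[simp] lemma gav_const (c : ℝ) : gav L (fun _ => c) = c := by
  rw [gav, ← Finset.mul_sum, mul_div_assoc, div_self (gav_Z_pos L).ne', mul_one]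

lemma gav_add (F G : Ω → ℝ) : gav L (fun ω => F ω + G ω) = gav L F + gav L G := by
  simp only [gav, add_mul, Finset.sum_add_distrib, add_div]

lemma gav_neg (F : Ω → ℝ) : gav L (fun ω => - F ω) = - gav L F := by
  simp only [gav, neg_mul, Finset.sum_neg_distrib, neg_div]

lemma gav_sub (F G : Ω → ℝ) : gav L (fun ω => F ω - G ω) = gav L F - gav L G := by
  simp only [gav, sub_mul, Finset.sum_sub_distrib, sub_div]

lemma gav_mul_left (c : ℝ) (F : Ω → ℝ) : gav L (fun ω => c * F ω) = c * gav L F := by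
  simp only [gav, mul_assoc, ← Finset.mul_sum, mul_div_assoc]

lemma gav_mul_right (c : ℝ) (F : Ω → ℝ) : gav L (fun ω => F ω * c) = gav L F * c := by
  rw [mul_comm, ← gav_mul_left]; simp only [mul_comm]

lemma gav_sum {ι : Type*} (s : Finset ι) (F : ι → Ω → ℝ) :
    gav L (fun ω => ∑ i ∈ s, F i ω) = ∑ i ∈ s, gav L (F i) := by
  simp only [gav, Finset.sum_mul]
  rw [Finset.sum_comm, Finset.sum_div]

lemma gav_mono {F G : Ω → ℝ} (h : ∀ ω, F ω ≤ G ω) : gav L F ≤ gav L G := by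
  unfold gav
  have := gav_Z_pos L
  gcongr with ω _
  exact h ω

lemma gav_nonneg {F : Ω → ℝ} (h : ∀ ω, 0 ≤ F ω) : 0 ≤ gav L F := by
  simpa using gav_mono L (F := fun _ => 0) h

lemma abs_gav_le {F : Ω → ℝ} : |gav L F| ≤ gav L (fun ω => |F ω|) := by
  rw [abs_le]
  constructor
  · rw [← gav_neg]; exact gav_mono L (fun ω => neg_abs_le _)
  · exact gav_mono L (fun ω => le_abs_self _)

lemma abs_gav_le_of {F G : Ω → ℝ} (h : ∀ ω, |F ω| ≤ G ω) : |gav L F| ≤ gav L G :=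
  (abs_gav_le L).trans (gav_mono L h)

lemma abs_gav_le_const {F : Ω → ℝ} {K : ℝ} (h : ∀ ω, |F ω| ≤ K) : |gav L F| ≤ K := by
  simpa using abs_gav_le_of L (G := fun _ => K) h

lemma gav_comm {Ω' : Type*} [Fintype Ω'] (L' : Ω' → ℝ) (F : Ω → Ω' → ℝ) :
    gav L (fun a => gav L' (fun b => F a b)) = gav L' (fun b => gav L (fun a => F a b)) := by
  simp only [gav, Finset.sum_div, Finset.sum_mul]
  rw [Finset.sum_comm]
  refine Finset.sum_congr rfl fun b _ => Finset.sum_congr rfl fun a _ => ?_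
  ring

lemma gav_prod {Ω' : Type*} [Fintype Ω'] (L' : Ω' → ℝ) (F : Ω × Ω' → ℝ) :
    gav (fun p : Ω × Ω' => L p.1 + L' p.2) F = gav L (fun a => gav L' (fun b => F (a, b))) := by
  simp only [gav]
  rw [Fintype.sum_prod_type, Fintype.sum_prod_type]
  simp only [Real.exp_add, ← Finset.mul_sum, ← Finset.sum_mul]
  rw [mul_comm (∑ ω, Real.exp (L ω)), ← div_div]
  congr 1
  rw [Finset.sum_div]
  refine Finset.sum_congr rfl fun a _ => ?_
  rw [div_mul_eq_mul_div, Finset.sum_mul]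
  congr 1
  refine Finset.sum_congr rfl fun b _ => ?_
  ring

/-- Tilting. -/
lemma gav_tilt (y F : Ω → ℝ) :
    gav (fun ω => L ω + y ω) F = gav L (fun ω => Real.exp (y ω) * F ω) / gav L (fun ω => Real.exp (y ω)) := by
  have := gav_Z_pos L
  simp only [gav, Real.exp_add]
  rw [div_div_div_cancel_right₀ this.ne']
  congr 1
  · refine Finset.sum_congr rfl fun b _ => ?_
    ring
  · refine Finset.sum_congr rfl fun b _ => ?_
    ring

lemma continuous_gav {X : Type*} [TopologicalSpace X] {L F : X → Ω → ℝ}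
    (hL : ∀ ω, Continuous fun x => L x ω) (hF : ∀ ω, Continuous fun x => F x ω) :
    Continuous fun x => gav (L x) (F x) := by
  unfold gav
  refine Continuous.div ?_ ?_ (fun x => (gav_Z_pos (L x)).ne')
  · exact continuous_finsetSum _ fun ω _ => (hF ω).mul (Real.continuous_exp.comp (hL ω))
  · exact continuous_finsetSum _ fun ω _ => (Real.continuous_exp.comp (hL ω))

lemma hasDerivAt_gav {L A : ℝ → Ω → ℝ} {L' A' : Ω → ℝ} {t : ℝ}
    (hL : ∀ ω, HasDerivAt (fun t => L t ω) (L' ω) t) (hA : ∀ ω, HasDerivAt (fun t => A t ω) (A' ω) t) :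
    HasDerivAt (fun t => gav (L t) (A t))
      (gav (L t) A' + gav (L t) (fun ω => A t ω * L' ω) - gav (L t) (A t) * gav (L t) L') t := by
  have hZ := gav_Z_pos (L t)
  have h1 : HasDerivAt (fun t => ∑ ω, A t ω * Real.exp (L t ω))
      (∑ ω, (A' ω * Real.exp (L t ω) + A t ω * (Real.exp (L t ω) * L' ω))) t :=
    HasDerivAt.fun_sum fun ω _ => (hA ω).mul (hL ω).exp
  have h2 : HasDerivAt (fun t => ∑ ω, Real.exp (L t ω))
      (∑ ω, (Real.exp (L t ω) * L' ω)) t :=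
    HasDerivAt.fun_sum fun ω _ => (hL ω).exp
  refine (h1.fun_div h2 hZ.ne').congr_deriv ?_
  have e1 : ∑ ω, (A' ω * Real.exp (L t ω) + A t ω * (Real.exp (L t ω) * L' ω))
    = gav (L t) A' * (∑ ω, Real.exp (L t ω)) + gav (L t) (fun ω => A t ω * L' ω) * (∑ ω, Real.exp (L t ω)) := by
    simp only [gav]
    rw [div_mul_cancel₀ _ hZ.ne', div_mul_cancel₀ _ hZ.ne', ← Finset.sum_add_distrib]
    refine Finset.sum_congr rfl fun b _ => ?_
    ring
  have e2 : ∑ ω, (Real.exp (L t ω) * L' ω) = gav (L t) L' * (∑ ω, Real.exp (L t ω)) := by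
    simp only [gav]
    rw [div_mul_cancel₀ _ hZ.ne']
    refine Finset.sum_congr rfl fun b _ => ?_
    ring
  have e3 : ∑ ω, A t ω * Real.exp (L t ω) = gav (L t) (A t) * (∑ ω, Real.exp (L t ω)) := by
    simp only [gav]
    rw [div_mul_cancel₀ _ hZ.ne']
  rw [e1, e2, e3]
  field_simp
end gavs

/-- The second-order Gaussian interpolation functional. -/
def kap {Ω : Type*} [Fintype Ω] (L A a : Ω → ℝ) : ℝ :=
  gav L (fun ω => A ω * a ω ^ 2) - 2 * gav L (fun ω => A ω * a ω) * gav L a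
    - gav L A * gav L (fun ω => a ω ^ 2) + 2 * gav L A * gav L a ^ 2

/-- Affine Gaussian Hamiltonian. -/
def aff {Ω P : Type*} [Fintype P] (F0 : Ω → ℝ) (c : P → ℝ) (a : P → Ω → ℝ) (x : P → ℝ) (ω : Ω) : ℝ :=
  F0 ω + ∑ p, c p * a p ω * x p

lemma continuous_aff {Ω P : Type*} [Fintype P] (F0 : Ω → ℝ) (c : P → ℝ) (a : P → Ω → ℝ) (ω : Ω) :
    Continuous fun x => aff F0 c a x ω := by
  unfold aff; fun_prop

lemma hasDerivAt_aff_update {Ω P : Type*} [Fintype P] [DecidableEq P] (F0 : Ω → ℝ) (c : P → ℝ) (a : P → Ω → ℝ)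
    (x : P → ℝ) (p : P) (r : ℝ) (ω : Ω) :
    HasDerivAt (fun r => aff F0 c a (Function.update x p r) ω) (c p * a p ω) r := by
  unfold aff
  have : ∀ q, HasDerivAt (fun r => c q * a q ω * Function.update x p r q)
      (if q = p then c q * a q ω else 0) r := by
    intro q
    by_cases hq : q = p
    · subst hq; simpa using (hasDerivAt_id' r).const_mul (c q * a q ω)
    · simpa [hq] using hasDerivAt_const r (c q * a q ω * x q)
  have h := (HasDerivAt.fun_sum (u := Finset.univ) fun q _ => this q).const_add (F0 ω)
  simpa using h

section GI
variable {Ω P : Type*} [Fintype Ω] [Nonempty Ω] [Fintype P] [DecidableEq P] (τ : P → NNReal)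

lemma ibp_cov (F0 A : Ω → ℝ) (c : P → ℝ) (a : P → Ω → ℝ) (p : P) :
    ∫ x, x p * (gav (aff F0 c a x) (fun ω => A ω * a p ω) - gav (aff F0 c a x) A * gav (aff F0 c a x) (a p))
      ∂(Measure.pi fun p => gaussianReal 0 (τ p))
    = τ p * ∫ x, c p * kap (aff F0 c a x) A (a p) ∂(Measure.pi fun p => gaussianReal 0 (τ p)) := by
  have cL := continuous_aff F0 c a
  have cg : ∀ F : Ω → ℝ, Continuous fun x => gav (aff F0 c a x) F :=
    fun F => continuous_gav cL (fun _ => continuous_const)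
  obtain ⟨K, hK⟩ : ∃ K : ℝ, ∀ ω, |A ω| ≤ K := by
    obtain ⟨K, hK⟩ := (Set.finite_range fun ω => |A ω|).bddAbove
    exact ⟨K, fun ω => hK ⟨ω, rfl⟩⟩
  obtain ⟨M, hM⟩ : ∃ K : ℝ, ∀ ω, |a p ω| ≤ K := by
    obtain ⟨K, hK⟩ := (Set.finite_range fun ω => |a p ω|).bddAbove
    exact ⟨K, fun ω => hK ⟨ω, rfl⟩⟩
  have hK0 : 0 ≤ K := (abs_nonneg _).trans (hK (Classical.arbitrary Ω))
  have hM0 : 0 ≤ M := (abs_nonneg _).trans (hM (Classical.arbitrary Ω))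
  have g1 : ∀ L : Ω → ℝ, |gav L (fun ω => A ω * a p ω)| ≤ K * M := fun L =>
    abs_gav_le_const L fun ω => by rw [abs_mul]; exact mul_le_mul (hK ω) (hM ω) (abs_nonneg _) hK0
  have g2 : ∀ L : Ω → ℝ, |gav L A| ≤ K := fun L => abs_gav_le_const L hK
  have g3 : ∀ L : Ω → ℝ, |gav L (a p)| ≤ M := fun L => abs_gav_le_const L hM
  have g4 : ∀ L : Ω → ℝ, |gav L (fun ω => A ω * a p ω ^ 2)| ≤ K * M ^ 2 := fun L =>
    abs_gav_le_const L fun ω => by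
      rw [abs_mul, abs_pow]; exact mul_le_mul (hK ω) (pow_le_pow_left₀ (abs_nonneg _) (hM ω) 2) (by positivity) hK0
  have g5 : ∀ L : Ω → ℝ, |gav L (fun ω => a p ω ^ 2)| ≤ M ^ 2 := fun L =>
    abs_gav_le_const L fun ω => by
      rw [abs_pow]; exact (pow_le_pow_left₀ (abs_nonneg _) (hM ω) 2)
  refine gauss_ibp_pi τ p _ _ ?_ ?_ ?_ (max (2 * (K * M)) (|c p| * (6 * (K * M ^ 2)))) ?_ ?_
  · intro x r
    have hL := hasDerivAt_aff_update F0 c a x p r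
    have hd : ∀ F : Ω → ℝ, _ := fun F => hasDerivAt_gav hL (fun ω => hasDerivAt_const r (F ω))
    refine ((hd fun ω => A ω * a p ω).sub ((hd A).mul (hd (a p)))).congr_deriv ?_
    simp only [gav_const]
    have e1 : ∀ (M : Ω → ℝ) , gav M (fun ω => A ω * a p ω * (c p * a p ω)) = c p * gav M (fun ω => A ω * a p ω ^ 2) := by
      intro M; rw [← gav_mul_left]; congr 1; ext; ring
    have e2 : ∀ (M : Ω → ℝ) , gav M (fun ω => A ω * (c p * a p ω)) = c p * gav M (fun ω => A ω * a p ω) := by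
      intro M; rw [← gav_mul_left]; congr 1; ext; ring
    have e3 : ∀ (M : Ω → ℝ) , gav M (fun ω => a p ω * (c p * a p ω)) = c p * gav M (fun ω => a p ω ^ 2) := by
      intro M; rw [← gav_mul_left]; congr 1; ext; ring
    rw [e1, e2, e3, gav_mul_left, kap]
    ring
  · exact (cg _).sub ((cg _).mul (cg _))
  · simp only [kap]
    have := cg (fun ω => A ω * a p ω ^ 2)
    have := cg (fun ω => A ω * a p ω)
    have := cg (fun ω => a p ω ^ 2)
    have := cg A
    have := cg (a p)
    fun_prop
  · intro x
    refine le_trans ?_ (le_max_left _ _)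
    refine (abs_sub _ _).trans ?_
    rw [abs_mul]
    have := mul_le_mul (g2 (aff F0 c a x)) (g3 (aff F0 c a x)) (abs_nonneg _) hK0
    linarith [g1 (aff F0 c a x)]
  · intro x
    refine le_trans ?_ (le_max_right _ _)
    rw [abs_mul]
    gcongr
    simp only [kap]
    set L := aff F0 c a x
    have t2 : |2 * gav L (fun ω => A ω * a p ω) * gav L (a p)| ≤ 2 * (K * M) * M := by
      rw [abs_mul, abs_mul, abs_two]
      exact mul_le_mul (mul_le_mul_of_nonneg_left (g1 L) (by norm_num)) (g3 L) (abs_nonneg _) (by positivity)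
    have t3 : |gav L A * gav L (fun ω => a p ω ^ 2)| ≤ K * M ^ 2 := by
      rw [abs_mul]
      exact mul_le_mul (g2 L) (g5 L) (abs_nonneg _) (by positivity)
    have t4 : |2 * gav L A * gav L (a p) ^ 2| ≤ 2 * K * M ^ 2 := by
      rw [abs_mul, abs_mul, abs_two, abs_pow]
      exact mul_le_mul (mul_le_mul_of_nonneg_left (g2 L) (by norm_num)) (pow_le_pow_left₀ (abs_nonneg _) (g3 L) 2) (by positivity) (by positivity)
    have t1 := g4 L
    rw [abs_le] at *
    constructor <;> nlinarith

/-- Gaussian interpolation formula. -/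
lemma gauss_interp (F0 F0' A A' : ℝ → Ω → ℝ) (c c' : P → ℝ → ℝ) (a : P → Ω → ℝ) (K : ℝ)
    (hF0 : ∀ ω θ, HasDerivAt (fun θ => F0 θ ω) (F0' θ ω) θ)
    (hA : ∀ ω θ, HasDerivAt (fun θ => A θ ω) (A' θ ω) θ)
    (hc : ∀ p θ, HasDerivAt (c p) (c' p θ) θ)
    (bF0 : ∀ θ ω, |F0' θ ω| ≤ K) (bA : ∀ θ ω, |A θ ω| ≤ K) (bA' : ∀ θ ω, |A' θ ω| ≤ K)
    (bc' : ∀ p θ, |c' p θ| ≤ K) (ba : ∀ p ω, |a p ω| ≤ K) (θ : ℝ) :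
    HasDerivAt (fun θ => ∫ x, gav (aff (F0 θ) (fun p => c p θ) a x) (A θ)
        ∂(Measure.pi fun p => gaussianReal 0 (τ p)))
      (∫ x, (gav (aff (F0 θ) (fun p => c p θ) a x) (A' θ)
          + gav (aff (F0 θ) (fun p => c p θ) a x) (fun ω => A θ ω * F0' θ ω)
          - gav (aff (F0 θ) (fun p => c p θ) a x) (A θ) * gav (aff (F0 θ) (fun p => c p θ) a x) (F0' θ)
          + ∑ p, τ p * (c p θ * c' p θ) * kap (aff (F0 θ) (fun p => c p θ) a x) (A θ) (a p))
        ∂(Measure.pi fun p => gaussianReal 0 (τ p))) θ := by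
  set π := Measure.pi fun p => gaussianReal 0 (τ p) with hπ
  set L : ℝ → (P → ℝ) → Ω → ℝ := fun θ x => aff (F0 θ) (fun p => c p θ) a x with hLdef
  have hK0 : 0 ≤ K := (abs_nonneg _).trans (bA 0 (Classical.arbitrary Ω))
  have cL : ∀ θ ω, Continuous fun x => L θ x ω := fun θ ω => continuous_aff _ _ _ _
  have cg : ∀ θ (F : Ω → ℝ), Continuous fun x => gav (L θ x) F :=
    fun θ F => continuous_gav (cL θ) (fun _ => continuous_const)
  have bg : ∀ θ x {F : Ω → ℝ} {M : ℝ}, (∀ ω, |F ω| ≤ M) → |gav (L θ x) F| ≤ M :=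
    fun θ x F M h => abs_gav_le_const _ h
  have ig : ∀ θ (F : Ω → ℝ), Integrable (fun x => gav (L θ x) F) π := by
    intro θ F
    obtain ⟨M, hM⟩ := (Set.finite_range fun ω => |F ω|).bddAbove
    exact Integrable.of_bound (cg θ F).aestronglyMeasurable M
      (Filter.Eventually.of_forall fun x => bg θ x fun ω => hM ⟨ω, rfl⟩)
  have bsub : ∀ u v w z B : ℝ, |u| ≤ B → |v| ≤ K → |w| ≤ K → |z| ≤ B → |v * z - u| ≤ K * B + B := by
    intro u v w z B hu hv hw hz
    refine (abs_sub _ _).trans ?_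
    rw [abs_mul]
    exact add_le_add (mul_le_mul hv hz (abs_nonneg _) hK0) hu
  set D : ℝ → (P → ℝ) → ℝ := fun θ x => gav (L θ x) (A' θ) + gav (L θ x) (fun ω => A θ ω * F0' θ ω)
      - gav (L θ x) (A θ) * gav (L θ x) (F0' θ) with hD
  set Cv : P → ℝ → (P → ℝ) → ℝ := fun p θ x => gav (L θ x) (fun ω => A θ ω * a p ω)
      - gav (L θ x) (A θ) * gav (L θ x) (a p) with hCv
  have bD : ∀ θ x, |D θ x| ≤ K + 2 * (K * K) := by
    intro θ x
    have h1 := bg θ x (bA' θ)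
    have h2 : |gav (L θ x) (fun ω => A θ ω * F0' θ ω)| ≤ K * K := bg θ x fun ω => by
      rw [abs_mul]; exact mul_le_mul (bA θ ω) (bF0 θ ω) (abs_nonneg _) hK0
    have h3 : |gav (L θ x) (A θ) * gav (L θ x) (F0' θ)| ≤ K * K := by
      rw [abs_mul]; exact mul_le_mul (bg θ x (bA θ)) (bg θ x (bF0 θ)) (abs_nonneg _) hK0
    simp only [hD]
    rw [abs_le] at *
    constructor <;> linarith
  have bC : ∀ p θ x, |Cv p θ x| ≤ 2 * (K * K) := by
    intro p θ x
    have h2 : |gav (L θ x) (fun ω => A θ ω * a p ω)| ≤ K * K := bg θ x fun ω => by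
      rw [abs_mul]; exact mul_le_mul (bA θ ω) (ba p ω) (abs_nonneg _) hK0
    have h3 : |gav (L θ x) (A θ) * gav (L θ x) (a p)| ≤ K * K := by
      rw [abs_mul]; exact mul_le_mul (bg θ x (bA θ)) (bg θ x (ba p)) (abs_nonneg _) hK0
    simp only [hCv]
    rw [abs_le] at *
    constructor <;> linarith
  have cD : Continuous (D θ) := ((cg _ _).add (cg _ _)).sub ((cg _ _).mul (cg _ _))
  have cC : ∀ p, Continuous (Cv p θ) := fun p => (cg _ _).sub ((cg _ _).mul (cg _ _))
  have iD : Integrable (D θ) π := Integrable.of_bound cD.aestronglyMeasurable _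
    (Filter.Eventually.of_forall fun x => bD θ x)
  have iC : ∀ p, Integrable (fun x => c' p θ * (x p * Cv p θ x)) π := fun p =>
    ((integrable_coord τ p).mul_bdd (c := 2 * (K * K)) (cC p).aestronglyMeasurable
      (Filter.Eventually.of_forall fun x => bC p θ x)).const_mul _
  have key := hasDerivAt_integral_of_dominated_loc_of_deriv_le (μ := π)
    (F := fun θ x => gav (L θ x) (A θ)) (x₀ := θ)
    (F' := fun θ x => D θ x + ∑ p, c' p θ * (x p * Cv p θ x)) (s := Set.univ)
    (bound := fun x => (K + 2 * (K * K)) + ∑ p, K * (|x p| * (2 * (K * K)))) Filter.univ_mem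
    (Filter.Eventually.of_forall fun θ => (cg θ (A θ)).aestronglyMeasurable) (ig θ (A θ))
    (iD.add (integrable_finsetSum _ fun p _ => iC p)).aestronglyMeasurable
    (Filter.Eventually.of_forall fun x θ _ => ?_) ?_ (Filter.Eventually.of_forall fun x θ _ => ?_)
  · refine key.2.congr_deriv ?_
    rw [integral_add iD (integrable_finsetSum _ fun p _ => iC p), integral_finsetSum _ fun p _ => iC p]
    have ik : ∀ p, Integrable (fun x => τ p * (c p θ * c' p θ) * kap (L θ x) (A θ) (a p)) π := by
      intro p
      refine Integrable.const_mul ?_ _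
      obtain ⟨M, hM⟩ : ∃ M : ℝ, ∀ x, |kap (L θ x) (A θ) (a p)| ≤ M := by
        have hbb : ∀ F : Ω → ℝ, ∃ M, 0 ≤ M ∧ ∀ x, |gav (L θ x) F| ≤ M := by
          intro F
          obtain ⟨M, hM⟩ := (Set.finite_range fun ω => |F ω|).bddAbove
          exact ⟨M, (abs_nonneg _).trans (hM ⟨Classical.arbitrary Ω, rfl⟩), fun x => bg θ x fun ω => hM ⟨ω, rfl⟩⟩
        obtain ⟨M1, p1, h1⟩ := hbb (fun ω => A θ ω * a p ω ^ 2)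
        obtain ⟨M2, p2, h2⟩ := hbb (fun ω => A θ ω * a p ω)
        obtain ⟨M3, p3, h3⟩ := hbb (a p)
        obtain ⟨M4, p4, h4⟩ := hbb (A θ)
        obtain ⟨M5, p5, h5⟩ := hbb (fun ω => a p ω ^ 2)
        refine ⟨M1 + 2 * M2 * M3 + M4 * M5 + 2 * M4 * M3 ^ 2, fun x => ?_⟩
        unfold kap
        refine (abs_add_le _ _).trans (add_le_add ((abs_sub _ _).trans (add_le_add ((abs_sub _ _).trans (add_le_add (h1 x) ?_)) ?_)) ?_)
        · rw [abs_mul, abs_mul, abs_two]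
          exact mul_le_mul (mul_le_mul_of_nonneg_left (h2 x) (by norm_num)) (h3 x) (abs_nonneg _) (by positivity)
        · rw [abs_mul]
          exact mul_le_mul (h4 x) (h5 x) (abs_nonneg _) (by positivity)
        · rw [abs_mul, abs_mul, abs_two, abs_pow]
          exact mul_le_mul (mul_le_mul_of_nonneg_left (h4 x) (by norm_num)) (pow_le_pow_left₀ (abs_nonneg _) (h3 x) 2) (by positivity) (by positivity)
      refine Integrable.of_bound (Continuous.aestronglyMeasurable ?_) M (Filter.Eventually.of_forall hM)
      simp only [kap]
      exact (((cg _ _).sub ((continuous_const.mul (cg _ _)).mul (cg _ _))).sub ((cg _ _).mul (cg _ _))).add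
        ((continuous_const.mul (cg _ _)).mul ((cg _ _).pow 2))
    rw [integral_add iD (integrable_finsetSum _ fun p _ => ik p), integral_finsetSum _ fun p _ => ik p]
    congr 1
    refine Finset.sum_congr rfl fun p _ => ?_
    rw [integral_const_mul, integral_const_mul]
    have := ibp_cov τ (F0 θ) (A θ) (fun p => c p θ) a p
    simp only [hCv, hLdef]
    rw [this, integral_const_mul]
    ring
  · simp only [D, Cv]
    refine (abs_add_le _ _).trans (add_le_add (bD θ x) ((Finset.abs_sum_le_sum_abs _ _).trans
      (Finset.sum_le_sum fun p _ => ?_)))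
    rw [abs_mul, abs_mul]
    exact mul_le_mul (bc' p θ) (mul_le_mul_of_nonneg_left (bC p θ x) (abs_nonneg _)) (by positivity) hK0
  · exact (integrable_const _).add (integrable_finsetSum _ fun p _ =>
      (((integrable_coord τ p).abs).mul_const _).const_mul _)
  · have hL' : ∀ ω, HasDerivAt (fun θ => L θ x ω) (F0' θ ω + ∑ p, c' p θ * a p ω * x p) θ := by
      intro ω
      simp only [hLdef, aff]
      exact (hF0 ω θ).add (HasDerivAt.fun_sum fun p _ => ((hc p θ).mul_const _).mul_const _)
    refine (hasDerivAt_gav hL' (fun ω => hA ω θ)).congr_deriv ?_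
    simp only [hD, hCv]
    have e1 : gav (L θ x) (fun ω => A θ ω * (F0' θ ω + ∑ p, c' p θ * a p ω * x p))
        = gav (L θ x) (fun ω => A θ ω * F0' θ ω)
          + ∑ p, c' p θ * (x p * gav (L θ x) (fun ω => A θ ω * a p ω)) := by
      simp only [← gav_mul_left, ← gav_sum, ← gav_add]
      congr 1; ext ω
      rw [mul_add, Finset.mul_sum]
      congr 1
      exact Finset.sum_congr rfl fun p _ => by ring
    have e2 : gav (L θ x) (fun ω => F0' θ ω + ∑ p, c' p θ * a p ω * x p)
        = gav (L θ x) (F0' θ) + ∑ p, c' p θ * (x p * gav (L θ x) (a p)) := by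
      simp only [← gav_mul_left, ← gav_sum, ← gav_add]
      congr 1; ext ω
      congr 1
      exact Finset.sum_congr rfl fun p _ => by ring
    rw [e1, e2]
    have e3 : ∑ p, c' p θ * (x p * (gav (L θ x) (fun ω => A θ ω * a p ω) - gav (L θ x) (A θ) * gav (L θ x) (a p)))
        = ∑ p, c' p θ * (x p * gav (L θ x) (fun ω => A θ ω * a p ω))
          - gav (L θ x) (A θ) * ∑ p, c' p θ * (x p * gav (L θ x) (a p)) := by
      rw [Finset.mul_sum, ← Finset.sum_sub_distrib]
      exact Finset.sum_congr rfl fun p _ => by ring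
    rw [e3]; ring
end GI
end

section
lemma young1 {n : ℕ} (hn : 2 ≤ n) {a w ε : ℝ} (ha : 0 ≤ a) (hw : 0 ≤ w) (hε : 0 < ε) :
    a ^ (n - 1) * w ≤ ε * a ^ n + (ε⁻¹) ^ (n - 1) * w ^ n := by
  obtain ⟨m, rfl⟩ : ∃ m, n = m + 1 := ⟨n - 1, by omega⟩
  simp only [Nat.add_sub_cancel]
  have h1 : 0 ≤ ε * a ^ (m + 1) := by positivity
  have h2 : 0 ≤ (ε⁻¹) ^ m * w ^ (m + 1) := by positivity
  rcases le_total w (ε * a) with h | h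
  · have : a ^ m * w ≤ a ^ m * (ε * a) := by gcongr
    have e : a ^ m * (ε * a) = ε * a ^ (m + 1) := by ring
    linarith
  · have h' : a ≤ ε⁻¹ * w := by rw [le_inv_mul_iff₀ hε]; exact h
    have : a ^ m * w ≤ (ε⁻¹ * w) ^ m * w := by gcongr
    have e : (ε⁻¹ * w) ^ m * w = (ε⁻¹) ^ m * w ^ (m + 1) := by ring
    linarith

lemma young2 {n : ℕ} (hn : 2 ≤ n) {a w ε : ℝ} (ha : 0 ≤ a) (hw : 0 ≤ w) (hε : 0 < ε) (hε1 : ε ≤ 1) :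
    a ^ (n - 2) * w ^ 2 ≤ ε * a ^ n + (ε⁻¹) ^ (n - 1) * w ^ n := by
  obtain ⟨m, rfl⟩ : ∃ m, n = m + 2 := ⟨n - 2, by omega⟩
  simp only [Nat.add_sub_cancel, show m + 2 - 1 = m + 1 by omega]
  have h1 : 0 ≤ ε * a ^ (m + 2) := by positivity
  have h2 : 0 ≤ (ε⁻¹) ^ (m + 1) * w ^ (m + 2) := by positivity
  have hi : 1 ≤ ε⁻¹ := (one_le_inv₀ hε).2 hε1
  rcases le_total w (ε * a) with h | h
  · have : a ^ m * w ^ 2 ≤ a ^ m * (ε * a) ^ 2 := by gcongr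
    have e : a ^ m * (ε * a) ^ 2 = ε * (ε * a ^ (m + 2)) := by ring
    have : ε * (ε * a ^ (m + 2)) ≤ 1 * (ε * a ^ (m + 2)) := by gcongr
    linarith
  · have h' : a ≤ ε⁻¹ * w := by rw [le_inv_mul_iff₀ hε]; exact h
    have : a ^ m * w ^ 2 ≤ (ε⁻¹ * w) ^ m * w ^ 2 := by gcongr
    have e : (ε⁻¹ * w) ^ m * w ^ 2 = (ε⁻¹) ^ m * w ^ (m + 2) := by ring
    have : (ε⁻¹) ^ m * w ^ (m + 2) ≤ (ε⁻¹) ^ (m + 1) * w ^ (m + 2) := by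
      gcongr
      omega
    linarith

/-- Entropy-type Young inequality. -/
lemma young_exp (Y b : ℝ) : Real.exp Y * b ≤ Real.exp Y * Y + Real.exp b := by
  have h := Real.add_one_le_exp (b - Y)
  have e : Real.exp b = Real.exp Y * Real.exp (b - Y) := by rw [← Real.exp_add]; congr 1; ring
  have hp := Real.exp_pos Y
  rw [e]
  nlinarith

/-- The pointwise key estimate. -/
lemma key_pointwise {n : ℕ} (hn : 2 ≤ n) {a ε M dd y y' y'' : ℝ} (ha : 0 ≤ a) (hε : 0 < ε)
    (hM : 0 < M) (hy' : 0 ≤ y') (hy'' : 0 ≤ y'') :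
    Real.exp (-y) * (a ^ (n - 1) * |dd|) ≤
      n * ((ε * a ^ n + (ε⁻¹) ^ (n - 1) * (M⁻¹) ^ n) * Real.exp (-y)) * (1 + y' + y'')
      + n * ε * (a ^ n * Real.exp (-y)) * Real.exp (-y') * Real.exp (-y'')
      + n * ((ε⁻¹) ^ (n - 1) * (M⁻¹) ^ n) *
        (Real.exp (M ^ 2 * dd ^ 2) * Real.exp (-y) * Real.exp (-y') * Real.exp (-y'')) := by
  set u := M ^ 2 * dd ^ 2 with hu
  have hu0 : 0 ≤ u := by positivity
  have hn0 : (2 : ℝ) ≤ n := by exact_mod_cast hn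
  have hnpos : (0 : ℝ) < n := by linarith
  set c := (ε⁻¹) ^ (n - 1) with hc
  have hc0 : 0 ≤ c := by positivity
  have hd : |dd| ≤ M⁻¹ * (1 + u) := by
    have : M * |dd| ≤ 1 + u := by
      have : u = (M * |dd|) ^ 2 := by rw [hu, mul_pow, sq_abs]
      nlinarith [sq_nonneg (M * |dd| - 1)]
    rw [le_inv_mul_iff₀ hM]; exact this
  have y1 := young1 hn ha (inv_nonneg.2 hM.le) hε
  have y2 := young1 hn ha (w := M⁻¹ * Real.exp (u / n)) (by positivity) hε
  have e2 : (M⁻¹ * Real.exp (u / n)) ^ n = (M⁻¹) ^ n * Real.exp u := by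
    rw [mul_pow, ← Real.exp_nat_mul]; congr 2; field_simp
  rw [e2] at y2
  rw [← hc] at y1 y2
  have y3 := young_exp (y' + y'') (u / n)
  set X := Real.exp (y' + y'') with hX
  have hX0 : 0 < X := Real.exp_pos _
  have hXi : Real.exp (-y') * Real.exp (-y'') * X = 1 := by
    rw [← Real.exp_add, hX, ← Real.exp_add]; rw [← Real.exp_zero]; congr 1; ring
  -- main
  have main : X * (a ^ (n - 1) * |dd|) ≤
      n * (ε * a ^ n + c * (M⁻¹) ^ n) * (1 + y' + y'') * X
      + n * (ε * a ^ n + c * ((M⁻¹) ^ n * Real.exp u)) := by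
    have hp : 0 ≤ a ^ (n - 1) * M⁻¹ := by positivity
    have s1 : X * (a ^ (n - 1) * |dd|) ≤ a ^ (n - 1) * M⁻¹ * (X * (1 + u)) := by
      have : X * a ^ (n - 1) * |dd| ≤ X * a ^ (n - 1) * (M⁻¹ * (1 + u)) := by gcongr
      linarith
    have s2 : X * (1 + u) ≤ n * (X * (1 + y' + y'')) + n * Real.exp (u / n) := by
      have : X * u = n * (X * (u / n)) := by field_simp
      have : X ≤ n * X := by nlinarith
      nlinarith
    have s3 : a ^ (n - 1) * M⁻¹ * (X * (1 + u)) ≤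
        a ^ (n - 1) * M⁻¹ * (n * (X * (1 + y' + y'')) + n * Real.exp (u / n)) := by gcongr
    have s4 : a ^ (n - 1) * M⁻¹ * (n * (X * (1 + y' + y''))) ≤
        (ε * a ^ n + c * (M⁻¹) ^ n) * (n * (X * (1 + y' + y''))) := by gcongr
    have s5 : n * (a ^ (n - 1) * (M⁻¹ * Real.exp (u / n))) ≤ n * (ε * a ^ n + c * ((M⁻¹) ^ n * Real.exp u)) := by
      gcongr
    linarith
  have hf : 0 ≤ Real.exp (-y) * Real.exp (-y') * Real.exp (-y'') := by positivity
  have := mul_le_mul_of_nonneg_left main hf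
  have l1 : Real.exp (-y) * Real.exp (-y') * Real.exp (-y'') * (X * (a ^ (n - 1) * |dd|))
      = Real.exp (-y) * (a ^ (n - 1) * |dd|) * (Real.exp (-y') * Real.exp (-y'') * X) := by ring
  have l2 : Real.exp (-y) * Real.exp (-y') * Real.exp (-y'') * (n * (ε * a ^ n + c * (M⁻¹) ^ n) * (1 + y' + y'') * X
      + n * (ε * a ^ n + c * ((M⁻¹) ^ n * Real.exp u)))
      = n * ((ε * a ^ n + c * (M⁻¹) ^ n) * Real.exp (-y)) * (1 + y' + y'') * (Real.exp (-y') * Real.exp (-y'') * X)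
      + n * ε * (a ^ n * Real.exp (-y)) * Real.exp (-y') * Real.exp (-y'')
      + n * (c * (M⁻¹) ^ n) * (Real.exp u * Real.exp (-y) * Real.exp (-y') * Real.exp (-y'')) := by ring
  rw [l1, l2, hXi] at this
  linarith

section replicas
variable {S : Type*} [Fintype S] [Nonempty S]

/-- Tilted two-replica Hamiltonian. -/
def tl (ℓ : S → ℝ) (y : S → S → ℝ) (ω : S × S) : ℝ := ℓ ω.1 + ℓ ω.2 + y ω.1 ω.2

/-- Partition function of tilt. -/
def VV (ℓ : S → ℝ) (y : S → S → ℝ) : ℝ := gav ℓ fun s => gav ℓ fun t => Real.exp (y s t)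

variable (ℓ : S → ℝ) (y : S → S → ℝ)

lemma gav_tl (F : S × S → ℝ) :
    gav (tl ℓ y) F = (gav ℓ fun s => gav ℓ fun t => Real.exp (y s t) * F (s, t)) / VV ℓ y := by
  have := gav_tilt (fun ω : S × S => ℓ ω.1 + ℓ ω.2) (fun ω => y ω.1 ω.2) F
  rw [gav_prod, gav_prod] at this
  exact this

lemma one_le_VV (hy : ∀ s t, 0 ≤ y s t) : 1 ≤ VV ℓ y := by
  have : gav ℓ (fun _ => gav ℓ fun _ => (1:ℝ)) ≤ VV ℓ y :=
    gav_mono _ fun s => gav_mono _ fun t => Real.one_le_exp (hy s t)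
  simpa using this

lemma VV_pos : 0 < VV ℓ y := by
  unfold VV gav
  have := gav_Z_pos ℓ
  refine div_pos (Finset.sum_pos (fun s _ => mul_pos (div_pos (Finset.sum_pos (fun t _ => ?_) Finset.univ_nonempty) this) (Real.exp_pos _)) Finset.univ_nonempty) this
  positivity

lemma gav_tl_exp (f : S → ℝ) : gav (tl ℓ y) (fun ω => f ω.1 * Real.exp (-y ω.1 ω.2)) = gav ℓ f / VV ℓ y := by
  rw [gav_tl]
  congr 2; ext s
  have : ∀ t, Real.exp (y s t) * (f s * Real.exp (-y s t)) = f s := by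
    intro t; rw [mul_left_comm, ← Real.exp_add]; simp
  simp [this]

lemma gav_tl_exp1 : gav (tl ℓ y) (fun ω => Real.exp (-y ω.1 ω.2)) = 1 / VV ℓ y := by
  simpa using gav_tl_exp ℓ y (fun _ => 1)

/-- triple tilted average -/
def U3 (F : S × S → S × S → S × S → ℝ) : ℝ :=
  gav (tl ℓ y) fun a => gav (tl ℓ y) fun b => gav (tl ℓ y) fun c => F a b c

lemma U3_mono {F G : S × S → S × S → S × S → ℝ} (h : ∀ a b c, F a b c ≤ G a b c) : U3 ℓ y F ≤ U3 ℓ y G :=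
  gav_mono _ fun a => gav_mono _ fun b => gav_mono _ fun c => h a b c

lemma abs_U3 {F G : S × S → S × S → S × S → ℝ} (h : ∀ a b c, |F a b c| ≤ G a b c) : |U3 ℓ y F| ≤ U3 ℓ y G :=
  abs_gav_le_of _ fun a => abs_gav_le_of _ fun b => abs_gav_le_of _ fun c => h a b c

lemma U3_add (F G : S × S → S × S → S × S → ℝ) : U3 ℓ y (fun a b c => F a b c + G a b c) = U3 ℓ y F + U3 ℓ y G := by
  simp only [U3, gav_add]

lemma U3_mul (r : ℝ) (F : S × S → S × S → S × S → ℝ) : U3 ℓ y (fun a b c => r * F a b c) = r * U3 ℓ y F := by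
  simp only [U3, gav_mul_left]

lemma U3_exp (u : S × S → S × S → S × S → ℝ) :
    U3 ℓ y (fun a b c => u a b c * Real.exp (-y a.1 a.2) * Real.exp (-y b.1 b.2) * Real.exp (-y c.1 c.2))
     = (gav ℓ fun s1 => gav ℓ fun s2 => gav ℓ fun s3 => gav ℓ fun s4 => gav ℓ fun s5 => gav ℓ fun s6 =>
        u (s1, s2) (s3, s4) (s5, s6)) / VV ℓ y ^ 3 := by
  simp only [U3, gav_tl, div_eq_mul_inv, ← gav_mul_left, ← gav_mul_right]
  congr 1; ext s1; congr 1; ext s2; congr 1; ext s3; congr 1; ext s4; congr 1; ext s5; congr 1; ext s6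
  have e : ∀ z, Real.exp (-z) = (Real.exp z)⁻¹ := Real.exp_neg
  simp only [e]
  have := VV_pos ℓ y
  field_simp

/-- The Φ functional. -/
def Ph : ℝ := (1 / VV ℓ y) * (1 + gav (tl ℓ y) fun ω => y ω.1 ω.2)

lemma inv_le_Ph (hy : ∀ s t, 0 ≤ y s t) : 1 / VV ℓ y ≤ Ph ℓ y := by
  have := VV_pos ℓ y
  unfold Ph
  have h : 0 ≤ gav (tl ℓ y) fun ω => y ω.1 ω.2 := gav_nonneg _ fun ω => hy _ _
  have h' : 0 ≤ 1 / VV ℓ y := by positivity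
  nlinarith

lemma Ph_nonneg (hy : ∀ s t, 0 ≤ y s t) : 0 ≤ Ph ℓ y :=
  le_trans (by have := VV_pos ℓ y; positivity) (inv_le_Ph ℓ y hy)

variable (g : S → ℝ) (hg : ∀ s, 0 ≤ g s)

/-- Term bound. -/
lemma term_bound {n : ℕ} (hn : 2 ≤ n) {ε M : ℝ} (hε : 0 < ε) (hM : 0 < M) (hy : ∀ s t, 0 ≤ y s t)
    (hg : ∀ s, 0 ≤ g s) (dd : S × S → S × S → S × S → ℝ)
    (hdd : (gav ℓ fun s1 => gav ℓ fun s2 => gav ℓ fun s3 => gav ℓ fun s4 => gav ℓ fun s5 => gav ℓ fun s6 =>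
        Real.exp (M ^ 2 * (dd (s1, s2) (s3, s4) (s5, s6)) ^ 2)) = VV ℓ y) :
    U3 ℓ y (fun a b c => Real.exp (-y a.1 a.2) * (g a.1 ^ (n - 1) * |dd a b c|)) ≤
      2 * n * (ε * gav ℓ (fun s => g s ^ n) + (ε⁻¹) ^ (n - 1) * (M⁻¹) ^ n) * Ph ℓ y := by
  refine (U3_mono ℓ y fun a b c => key_pointwise (y := y a.1 a.2) (y' := y b.1 b.2) (y'' := y c.1 c.2) hn (hg a.1) hε hM (hy _ _) (hy _ _)).trans ?_
  set c0 := (ε⁻¹) ^ (n - 1) * (M⁻¹) ^ n with hc0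
  have hc0' : 0 ≤ c0 := by positivity
  have hV1 := one_le_VV ℓ y hy
  have hV := VV_pos ℓ y
  rw [U3_add, U3_add, U3_mul, U3_exp, hdd]
  have hT : 0 ≤ gav ℓ (fun s => g s ^ n) := gav_nonneg _ fun s => by have := hg s; positivity
  set T := gav ℓ (fun s => g s ^ n) with hTd
  have hY : 0 ≤ gav (tl ℓ y) fun ω => y ω.1 ω.2 := gav_nonneg _ fun ω => hy _ _
  set Y := gav (tl ℓ y) fun ω => y ω.1 ω.2 with hYd
  have e0 : ∀ c : ℝ, gav (tl ℓ y) (fun a => (ε * g a.1 ^ n + c) * Real.exp (-y a.1 a.2)) = (ε * T + c) / VV ℓ y := by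
    intro c
    rw [gav_tl_exp ℓ y (fun s => ε * g s ^ n + c), gav_add, gav_mul_left, gav_const]
  have e1 : U3 ℓ y (fun a b c => n * ((ε * g a.1 ^ n + c0) * Real.exp (-y a.1 a.2)) * (1 + y b.1 b.2 + y c.1 c.2))
      = n * ((ε * T + c0) / VV ℓ y) * (1 + Y + Y) := by
    simp only [U3, gav_mul_left, gav_mul_right, gav_add, gav_const, e0, ← hYd]
  have e2 : U3 ℓ y (fun a b c => n * ε * (g a.1 ^ n * Real.exp (-y a.1 a.2)) * Real.exp (-y b.1 b.2) * Real.exp (-y c.1 c.2))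
      = n * ε * (T / VV ℓ y) * (1 / VV ℓ y) * (1 / VV ℓ y) := by
    simp only [U3, gav_mul_left, gav_mul_right, gav_tl_exp1, gav_tl_exp ℓ y (fun s => g s ^ n), ← hTd]
  rw [e1, e2]
  have hi1 : 1 / VV ℓ y ≤ 1 := by rw [div_le_one hV]; exact hV1
  have hi0 : 0 ≤ 1 / VV ℓ y := by positivity
  have e3 : VV ℓ y / VV ℓ y ^ 3 = (1 / VV ℓ y) * (1 / VV ℓ y) := by field_simp
  rw [e3, Ph, ← hYd]
  have e4 : ∀ z, z / VV ℓ y = z * (1 / VV ℓ y) := fun z => by ring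
  rw [e4 (ε * T + c0), e4 T]
  set i := 1 / VV ℓ y
  have b1 : i * i ≤ i := by nlinarith
  have b2 : i * i * i ≤ i := by nlinarith
  have p1 : n * ε * T * (i * i * i) ≤ n * ε * T * i := by gcongr
  have p2 : n * c0 * (i * i) ≤ n * c0 * i := by gcongr
  nlinarith

/-- Generic sum of `kap` as triple average. -/
lemma sum_kap {Ω P : Type*} [Fintype Ω] [Nonempty Ω] [Fintype P] (L A : Ω → ℝ) (a : P → Ω → ℝ) (w : P → ℝ) :
    ∑ p, w p * kap L A (a p) = gav L fun u => gav L fun v => gav L fun z =>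
      A u * ((∑ p, w p * (a p u * a p u)) - 2 * (∑ p, w p * (a p u * a p v))
        - (∑ p, w p * (a p v * a p v)) + 2 * (∑ p, w p * (a p v * a p z))) := by
  have h1 : ∀ p, w p * kap L A (a p) = gav L fun u => gav L fun v => gav L fun z =>
      w p * (A u * a p u ^ 2 - 2 * (A u * a p u) * a p v - A u * a p v ^ 2 + 2 * A u * a p v * a p z) := by
    intro p
    simp only [gav_mul_left, gav_mul_right, gav_add, gav_sub, gav_const, kap]
    ring
  simp only [h1, ← gav_sum]
  congr 1; ext u; congr 1; ext v; congr 1; ext z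
  simp only [Finset.mul_sum, ← Finset.sum_sub_distrib, ← Finset.sum_add_distrib]
  refine Finset.sum_congr rfl fun p _ => ?_
  ring

end replicas
end

section
section replicas2
variable {S : Type*} [Fintype S] [Nonempty S]

/-- two-replica covariance -/
def bb (D : S → S → ℝ) (a b : S × S) : ℝ := D a.1 b.1 + D a.1 b.2 + D a.2 b.1 + D a.2 b.2

/-- The bracket. -/
def brk (D : S → S → ℝ) (a b c : S × S) : ℝ := bb D a a - 2 * bb D a b - bb D b b + 2 * bb D b c

lemma brk_le (D : S → S → ℝ) (D0 : ℝ) (hD0 : ∀ s, D s s = D0) (hDs : ∀ s t, D s t = D t s)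
    (E : S → S → ℝ) (hE : ∀ s t, |D s t| ≤ E s t) (a b c : S × S) :
    |brk D a b c| ≤ 2 * (E a.1 a.2 + (E a.1 b.1 + E a.1 b.2 + E a.2 b.1 + E a.2 b.2) + E b.1 b.2
      + (E b.1 c.1 + E b.1 c.2 + E b.2 c.1 + E b.2 c.2)) := by
  have e : brk D a b c = 2 * (D a.1 a.2 - (D a.1 b.1 + D a.1 b.2 + D a.2 b.1 + D a.2 b.2) - D b.1 b.2
      + (D b.1 c.1 + D b.1 c.2 + D b.2 c.1 + D b.2 c.2)) := by
    simp only [brk, bb, hD0, hDs a.2 a.1, hDs b.2 b.1]; ring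
  rw [e, abs_mul, abs_two]
  have h := fun s t => abs_le.1 (hE s t)
  refine mul_le_mul_of_nonneg_left ?_ (by norm_num)
  rw [abs_le]
  constructor
  · linarith [(h a.1 a.2).1, (h a.1 b.1).2, (h a.1 b.2).2, (h a.2 b.1).2, (h a.2 b.2).2, (h b.1 b.2).2,
      (h b.1 c.1).1, (h b.1 c.2).1, (h b.2 c.1).1, (h b.2 c.2).1]
  · linarith [(h a.1 a.2).2, (h a.1 b.1).1, (h a.1 b.2).1, (h a.2 b.1).1, (h a.2 b.2).1, (h b.1 b.2).1,
      (h b.1 c.1).2, (h b.1 c.2).2, (h b.2 c.1).2, (h b.2 c.2).2]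

/-- Integrand of the derivative along the path. -/
def dInt (ℓ : S → ℝ) (y : S → S → ℝ) (D : S → S → ℝ) (f f' : S → ℝ) (z : S → S → ℝ) (σ : ℝ) : ℝ :=
  gav ℓ f' / VV ℓ y - gav ℓ f / VV ℓ y * gav (tl ℓ y) (fun ω => z ω.1 ω.2)
    + σ * U3 ℓ y (fun a b c => f a.1 * Real.exp (-y a.1 a.2) * brk D a b c)

lemma dInt_bound (ℓ : S → ℝ) (d D : S → S → ℝ) (f f' g : S → ℝ) (z : S → S → ℝ) (σ M ε κ D0 η : ℝ)
    {n : ℕ} (hn : 2 ≤ n) (hε : 0 < ε) (hε1 : ε ≤ 1) (hM : 0 < M) (hκ : 0 ≤ κ) (hη : 0 ≤ η) (hηM : η ≤ M⁻¹)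
    (hσ : |σ| ≤ 1) (hg : ∀ s, 0 ≤ g s)
    (hf : ∀ s, |f s| ≤ 2 * g s ^ (n - 1)) (hf' : ∀ s, |f' s| ≤ 4 * n * (g s ^ (n - 2) * (M⁻¹) ^ 2))
    (hz : ∀ s t, |z s t| ≤ 2 * |d s t|) (hD0 : ∀ s, D s s = D0) (hDs : ∀ s t, D s t = D t s)
    (hD : ∀ s t, |D s t| ≤ κ * (|d s t| + η)) :
    |dInt ℓ (fun s t => M ^ 2 * d s t ^ 2) D f f' z σ| ≤
      (12 * n + κ * (80 * n + 40)) * (ε * gav ℓ (fun s => g s ^ n) + (ε⁻¹) ^ (n - 1) * (M⁻¹) ^ n)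
        * Ph ℓ (fun s t => M ^ 2 * d s t ^ 2) := by
  set y : S → S → ℝ := fun s t => M ^ 2 * d s t ^ 2 with hydef
  have hy : ∀ s t, 0 ≤ y s t := fun s t => by simp only [y]; positivity
  have hV := VV_pos ℓ y
  have hV1 := one_le_VV ℓ y hy
  have hT : 0 ≤ gav ℓ (fun s => g s ^ n) := gav_nonneg _ fun s => by have := hg s; positivity
  set T := gav ℓ (fun s => g s ^ n) with hTd
  have hP := Ph_nonneg ℓ y hy
  have hPi := inv_le_Ph ℓ y hy
  have tb := fun dd => term_bound ℓ y g hn hε hM hy hg dd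
  have hQg : ∀ F : S → ℝ, (∀ s, F s ≤ ε * g s ^ n + (ε⁻¹) ^ (n - 1) * (M⁻¹) ^ n) →
      gav ℓ F / VV ℓ y ≤ (ε * T + (ε⁻¹) ^ (n - 1) * (M⁻¹) ^ n) * Ph ℓ y := by
    intro F hF
    have h1 := gav_mono ℓ hF
    rw [gav_add, gav_mul_left, gav_const, ← hTd] at h1
    rw [div_eq_mul_one_div]
    have h2 : 0 ≤ 1 / VV ℓ y := by positivity
    have h3 : 0 ≤ ε * T + (ε⁻¹) ^ (n - 1) * (M⁻¹) ^ n := by positivity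
    exact mul_le_mul h1 hPi h2 h3
  set Q := ε * T + (ε⁻¹) ^ (n - 1) * (M⁻¹) ^ n with hQ
  have hQ0 : 0 ≤ Q := by positivity
  set Q' := 2 * n * Q * Ph ℓ y with hQ'
  -- first term
  have t1 : |gav ℓ f' / VV ℓ y| ≤ 4 * n * (Q * Ph ℓ y) := by
    rw [abs_div, abs_of_pos hV]
    have h1 : |gav ℓ f'| ≤ gav ℓ fun s => 4 * n * (g s ^ (n - 2) * (M⁻¹) ^ 2) := abs_gav_le_of ℓ hf'
    rw [gav_mul_left] at h1
    have h2 := hQg (fun s => g s ^ (n - 2) * (M⁻¹) ^ 2) fun s => young2 hn (hg s) (by positivity) hε hε1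
    calc |gav ℓ f'| / VV ℓ y ≤ (4 * n * gav ℓ fun s => (g s ^ (n - 2) * (M⁻¹) ^ 2)) / VV ℓ y := by gcongr
      _ = 4 * n * ((gav ℓ fun s => (g s ^ (n - 2) * (M⁻¹) ^ 2)) / VV ℓ y) := by ring
      _ ≤ _ := by gcongr
  have t2 : |gav ℓ f / VV ℓ y * gav (tl ℓ y) (fun ω => z ω.1 ω.2)| ≤ 4 * Q' := by
    have e : gav ℓ f / VV ℓ y * gav (tl ℓ y) (fun ω => z ω.1 ω.2)
        = U3 ℓ y (fun a b _ => f a.1 * Real.exp (-y a.1 a.2) * z b.1 b.2) := by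
      simp only [U3, gav_const, gav_mul_left, gav_mul_right, gav_tl_exp]
    rw [e]
    refine (abs_U3 ℓ y (G := fun a b c => 4 * (Real.exp (-y a.1 a.2) * (g a.1 ^ (n - 1) * |d b.1 b.2|))) ?_).trans ?_
    · intro a b c
      rw [abs_mul, abs_mul, Real.abs_exp]
      calc |f a.1| * Real.exp (-y a.1 a.2) * |z b.1 b.2|
          ≤ (2 * g a.1 ^ (n - 1)) * Real.exp (-y a.1 a.2) * (2 * |d b.1 b.2|) := by
            have := hg a.1
            gcongr
            · exact hf a.1
            · exact hz _ _
        _ = _ := by ring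
    · rw [U3_mul]
      have := tb (fun a b c => d b.1 b.2) (by simp only [gav_const]; rfl)
      gcongr
  have t3 : |σ * U3 ℓ y (fun a b c => f a.1 * Real.exp (-y a.1 a.2) * brk D a b c)|
      ≤ 4 * κ * (10 * Q' + 10 * (Q * Ph ℓ y)) := by
    rw [abs_mul]
    refine (mul_le_of_le_one_left (abs_nonneg _) hσ).trans ?_
    set t : (S × S → S × S → S × S → ℝ) → S × S → S × S → S × S → ℝ := fun dd a b c =>
      Real.exp (-y a.1 a.2) * (g a.1 ^ (n - 1) * |dd a b c|) with ht
    refine (abs_U3 ℓ y (G := fun a b c => 4 * κ * (t (fun a b c => d a.1 a.2) a b c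
      + t (fun a b c => d a.1 b.1) a b c + t (fun a b c => d a.1 b.2) a b c
      + t (fun a b c => d a.2 b.1) a b c + t (fun a b c => d a.2 b.2) a b c
      + t (fun a b c => d b.1 b.2) a b c
      + t (fun a b c => d b.1 c.1) a b c + t (fun a b c => d b.1 c.2) a b c
      + t (fun a b c => d b.2 c.1) a b c + t (fun a b c => d b.2 c.2) a b c
      + 10 * (g a.1 ^ (n - 1) * η * Real.exp (-y a.1 a.2)))) ?_).trans ?_
    · intro a b c
      rw [abs_mul, abs_mul, Real.abs_exp]
      have hb := brk_le D D0 hD0 hDs _ hD a b c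
      refine (mul_le_mul (mul_le_mul_of_nonneg_right (hf a.1) (Real.exp_pos _).le) hb (abs_nonneg _) ?_).trans (le_of_eq ?_)
      · have := hg a.1
        positivity
      · simp only [ht]; ring
    · simp only [U3_mul, U3_add]
      have hs : U3 ℓ y (fun a b c => g a.1 ^ (n - 1) * η * Real.exp (-y a.1 a.2)) ≤ Q * Ph ℓ y := by
        have e : U3 ℓ y (fun a b c => g a.1 ^ (n - 1) * η * Real.exp (-y a.1 a.2))
          = gav ℓ (fun s => g s ^ (n - 1) * η) / VV ℓ y := by
          simp only [U3, gav_const, gav_tl_exp ℓ y (fun s => g s ^ (n - 1) * η)]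
        rw [e]
        refine hQg _ fun s => ?_
        refine le_trans ?_ (young1 hn (hg s) (inv_nonneg.2 hM.le) hε)
        have := hg s
        gcongr
      have b1 := tb (fun a b c => d a.1 a.2) (by simp only [gav_const]; rfl)
      have b2 := tb (fun a b c => d a.1 b.1) (by simp only [gav_const]; rfl)
      have b3 := tb (fun a b c => d a.1 b.2) (by simp only [gav_const]; rfl)
      have b4 := tb (fun a b c => d a.2 b.1) (by simp only [gav_const]; rfl)
      have b5 := tb (fun a b c => d a.2 b.2) (by simp only [gav_const]; rfl)
      have b6 := tb (fun a b c => d b.1 b.2) (by simp only [gav_const]; rfl)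
      have b7 := tb (fun a b c => d b.1 c.1) (by simp only [gav_const]; rfl)
      have b8 := tb (fun a b c => d b.1 c.2) (by simp only [gav_const]; rfl)
      have b9 := tb (fun a b c => d b.2 c.1) (by simp only [gav_const]; rfl)
      have b10 := tb (fun a b c => d b.2 c.2) (by simp only [gav_const]; rfl)
      refine mul_le_mul_of_nonneg_left ?_ (by positivity)
      simp only [ht]
      linarith
  unfold dInt
  refine (abs_add_le _ _).trans ((add_le_add ((abs_sub _ _).trans (add_le_add t1 t2)) t3).trans (le_of_eq ?_))
  rw [hQ']; ring

/-- Crude bound. -/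
lemma dInt_crude (ℓ : S → ℝ) (y D : S → S → ℝ) (f f' F F' : S → ℝ) (z : S → S → ℝ) (σ κ : ℝ) (hκ : 0 ≤ κ)
    (hy : ∀ s t, 0 ≤ y s t)
    (hσ : |σ| ≤ 1) (hf : ∀ s, |f s| ≤ F s) (hf' : ∀ s, |f' s| ≤ F' s)
    (hz : ∀ s t, |z s t| ≤ κ) (hD : ∀ s t, |D s t| ≤ κ) :
    |dInt ℓ y D f f' z σ| ≤ (gav ℓ F' + 25 * κ * gav ℓ F) * (1 / VV ℓ y) := by
  have hV := VV_pos ℓ y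
  have hF : 0 ≤ gav ℓ F := gav_nonneg _ fun s => (abs_nonneg _).trans (hf s)
  have t1 : |gav ℓ f' / VV ℓ y| ≤ gav ℓ F' / VV ℓ y := by
    rw [abs_div, abs_of_pos hV]
    have h1 : |gav ℓ f'| ≤ gav ℓ F' := abs_gav_le_of ℓ hf'
    gcongr
  have t2 : |gav ℓ f / VV ℓ y * gav (tl ℓ y) (fun ω => z ω.1 ω.2)| ≤ gav ℓ F / VV ℓ y * κ := by
    rw [abs_mul, abs_div, abs_of_pos hV]
    have h1 : |gav ℓ f| ≤ gav ℓ F := abs_gav_le_of ℓ hf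
    have h2 : |gav (tl ℓ y) (fun ω => z ω.1 ω.2)| ≤ κ := abs_gav_le_const _ fun ω => hz _ _
    gcongr
  have hbb : ∀ a b, |bb D a b| ≤ 4 * κ := by
    intro a b
    have h := fun s t => abs_le.1 (hD s t)
    rw [abs_le]; unfold bb
    constructor
    · linarith [(h a.1 b.1).1, (h a.1 b.2).1, (h a.2 b.1).1, (h a.2 b.2).1]
    · linarith [(h a.1 b.1).2, (h a.1 b.2).2, (h a.2 b.1).2, (h a.2 b.2).2]
  have hbr : ∀ a b c, |brk D a b c| ≤ 24 * κ := by
    intro a b c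
    have h := fun a b => abs_le.1 (hbb a b)
    unfold brk
    rw [abs_le]
    constructor
    · linarith [(h a a).1, (h a b).2, (h b b).2, (h b c).1]
    · linarith [(h a a).2, (h a b).1, (h b b).1, (h b c).2]
  have t3 : |σ * U3 ℓ y (fun a b c => f a.1 * Real.exp (-y a.1 a.2) * brk D a b c)|
      ≤ gav ℓ F / VV ℓ y * (24 * κ) := by
    rw [abs_mul]
    refine (mul_le_of_le_one_left (abs_nonneg _) hσ).trans ?_
    refine (abs_U3 ℓ y (G := fun a b c => F a.1 * Real.exp (-y a.1 a.2) * (24 * κ)) ?_).trans (le_of_eq ?_)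
    · intro a b c
      rw [abs_mul, abs_mul, Real.abs_exp]
      exact mul_le_mul (mul_le_mul_of_nonneg_right (hf a.1) (Real.exp_pos _).le) (hbr a b c) (abs_nonneg _)
        (mul_nonneg ((abs_nonneg _).trans (hf _)) (Real.exp_pos _).le)
    · simp only [U3, gav_const, gav_mul_right, gav_tl_exp]
  unfold dInt
  refine (abs_add_le _ _).trans ((add_le_add ((abs_sub _ _).trans (add_le_add t1 t2)) t3).trans (le_of_eq ?_))
  ring

end replicas2
end

section
section replicas3
variable {S : Type*} [Fintype S] [Nonempty S]

lemma VV_eq (ℓ : S → ℝ) (y : S → S → ℝ) :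
    VV ℓ y = gav (fun ω : S × S => ℓ ω.1 + ℓ ω.2) (fun ω => Real.exp (y ω.1 ω.2)) := by
  rw [gav_prod]; rfl

lemma continuous_VV {X : Type*} [TopologicalSpace X] {ℓ : X → S → ℝ} {y : X → S → S → ℝ}
    (hl : ∀ s, Continuous fun x => ℓ x s) (hy : ∀ s t, Continuous fun x => y x s t) :
    Continuous fun x => VV (ℓ x) (y x) :=
  continuous_gav hl fun s => continuous_gav hl fun t => Real.continuous_exp.comp (hy s t)

lemma continuous_tl {X : Type*} [TopologicalSpace X] {ℓ : X → S → ℝ} {y : X → S → S → ℝ}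
    (hl : ∀ s, Continuous fun x => ℓ x s) (hy : ∀ s t, Continuous fun x => y x s t) (ω : S × S) :
    Continuous fun x => tl (ℓ x) (y x) ω :=
  ((hl _).add (hl _)).add (hy _ _)

lemma continuous_Ph {X : Type*} [TopologicalSpace X] {ℓ : X → S → ℝ} {y : X → S → S → ℝ}
    (hl : ∀ s, Continuous fun x => ℓ x s) (hy : ∀ s t, Continuous fun x => y x s t) :
    Continuous fun x => Ph (ℓ x) (y x) := by
  unfold Ph
  refine (Continuous.div continuous_const (continuous_VV hl hy) fun x => (VV_pos _ _).ne').mul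
    (continuous_const.add (continuous_gav (continuous_tl hl hy) fun ω => hy _ _))

lemma continuous_dInt {X : Type*} [TopologicalSpace X] {ℓ : X → S → ℝ} {y z : X → S → S → ℝ}
    {f f' : X → S → ℝ} (D : S → S → ℝ) (σ : ℝ)
    (hl : ∀ s, Continuous fun x => ℓ x s) (hy : ∀ s t, Continuous fun x => y x s t)
    (hz : ∀ s t, Continuous fun x => z x s t) (hf : ∀ s, Continuous fun x => f x s)
    (hf' : ∀ s, Continuous fun x => f' x s) :
    Continuous fun x => dInt (ℓ x) (y x) D (f x) (f' x) (z x) σ := by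
  unfold dInt U3
  have hV := continuous_VV hl hy
  have ht := continuous_tl hl hy
  refine (((continuous_gav hl hf').div hV fun x => (VV_pos _ _).ne').sub
    (((continuous_gav hl hf).div hV fun x => (VV_pos _ _).ne').mul (continuous_gav ht fun ω => hz _ _))).add
    (continuous_const.mul (continuous_gav ht fun a => continuous_gav ht fun b => continuous_gav ht fun c => ?_))
  exact ((hf _).mul (Real.continuous_exp.comp (hy _ _).neg)).mul continuous_const

lemma by_parts (ℓ : S → ℝ) (d : S → S → ℝ) (r v0 : ℝ) (hv0 : 0 ≤ v0) (m : ℕ) :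
    ∫ v in (0:ℝ)..v0, v ^ m * Ph ℓ (fun s t => (r * v) ^ 2 * d s t ^ 2) ≤
      (1 + (m + 1) / 2) * ∫ v in (0:ℝ)..v0, v ^ m * (1 / VV ℓ (fun s t => (r * v) ^ 2 * d s t ^ 2)) := by
  set V : ℝ → ℝ := fun v => VV ℓ (fun s t => (r * v) ^ 2 * d s t ^ 2) with hV
  have hVp : ∀ v, 0 < V v := fun v => VV_pos _ _
  have cy : ∀ s t, Continuous fun v : ℝ => (r * v) ^ 2 * d s t ^ 2 := fun s t => by fun_prop
  have cV : Continuous V := continuous_VV (fun s => continuous_const) cy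
  set Y : ℝ → ℝ := fun v => gav (tl ℓ (fun s t => (r * v) ^ 2 * d s t ^ 2)) (fun ω => (r * v) ^ 2 * d ω.1 ω.2 ^ 2) with hY
  have cY : Continuous Y := continuous_gav (continuous_tl (fun s => continuous_const) cy) fun ω => cy _ _
  have hP : ∀ v, Ph ℓ (fun s t => (r * v) ^ 2 * d s t ^ 2) = (1 / V v) * (1 + Y v) := fun v => rfl
  have dV : ∀ v, v ≠ 0 → HasDerivAt V (2 * V v * Y v / v) v := by
    intro v hv
    have hA : ∀ ω : S × S, HasDerivAt (fun v => Real.exp ((r * v) ^ 2 * d ω.1 ω.2 ^ 2))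
        (Real.exp ((r * v) ^ 2 * d ω.1 ω.2 ^ 2) * (2 / v * ((r * v) ^ 2 * d ω.1 ω.2 ^ 2))) v := by
      intro ω
      have := ((((hasDerivAt_id' v).const_mul r).fun_pow 2).mul_const (d ω.1 ω.2 ^ 2)).exp
      refine this.congr_deriv ?_
      field_simp
      norm_num
      try ring
    have hg := hasDerivAt_gav (L := fun _ (ω : S × S) => ℓ ω.1 + ℓ ω.2) (t := v)
      (fun ω => hasDerivAt_const v _) hA
    have hV' : V = fun v => gav (fun ω : S × S => ℓ ω.1 + ℓ ω.2) (fun ω => Real.exp ((r * v) ^ 2 * d ω.1 ω.2 ^ 2)) := by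
      ext v; exact VV_eq _ _
    have hVY : V v * Y v = gav (fun ω : S × S => ℓ ω.1 + ℓ ω.2)
        (fun ω => Real.exp ((r * v) ^ 2 * d ω.1 ω.2 ^ 2) * ((r * v) ^ 2 * d ω.1 ω.2 ^ 2)) := by
      simp only [hY, gav_tl]
      rw [gav_prod]
      exact mul_div_cancel₀ _ (hVp v).ne'
    rw [mul_assoc, hVY, hV']
    refine hg.congr_deriv ?_
    simp only [gav_const, mul_zero, add_zero, sub_zero]
    rw [mul_div_right_comm, ← gav_mul_left]
    congr 1; ext ω
    ring
  have dG : ∀ v ∈ Set.Ioo 0 v0, HasDerivAt (fun v => v ^ (m + 1) / V v)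
      ((m + 1) * (v ^ m * (1 / V v)) - 2 * (v ^ m * (1 / V v * Y v))) v := by
    intro v hv
    have hv' : v ≠ 0 := hv.1.ne'
    refine ((hasDerivAt_pow (m + 1) v).fun_div (dV v hv') (hVp v).ne').congr_deriv ?_
    have := (hVp v).ne'
    push_cast
    field_simp
    try ring
  have c1 : Continuous fun v => v ^ m * (1 / V v) :=
    (continuous_pow m).mul (continuous_const.div cV fun v => (hVp v).ne')
  have c2 : Continuous fun v => v ^ m * (1 / V v * Y v) :=
    (continuous_pow m).mul ((continuous_const.div cV fun v => (hVp v).ne').mul cY)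
  have cG : Continuous fun v => v ^ (m + 1) / V v :=
    (continuous_pow (m + 1)).div cV fun v => (hVp v).ne'
  have ftc := intervalIntegral.integral_eq_sub_of_hasDerivAt_of_le hv0 cG.continuousOn dG
    (((continuous_const.mul c1).sub (continuous_const.mul c2)).intervalIntegrable 0 v0)
  have i1 : IntervalIntegrable (fun v => ((m:ℝ) + 1) * (v ^ m * (1 / V v))) volume 0 v0 :=
    (continuous_const.mul c1).intervalIntegrable _ _
  have i2 : IntervalIntegrable (fun v => 2 * (v ^ m * (1 / V v * Y v))) volume 0 v0 :=
    (continuous_const.mul c2).intervalIntegrable _ _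
  rw [intervalIntegral.integral_sub i1 i2, intervalIntegral.integral_const_mul,
    intervalIntegral.integral_const_mul] at ftc
  have h0 : (0:ℝ) ^ (m + 1) / V 0 = 0 := by simp
  have h1 : 0 ≤ v0 ^ (m + 1) / V v0 := div_nonneg (by positivity) (hVp _).le
  have e : ∫ v in (0:ℝ)..v0, v ^ m * Ph ℓ (fun s t => (r * v) ^ 2 * d s t ^ 2)
      = (∫ v in (0:ℝ)..v0, v ^ m * (1 / V v)) + ∫ v in (0:ℝ)..v0, v ^ m * (1 / V v * Y v) := by
    rw [← intervalIntegral.integral_add (c1.intervalIntegrable _ _) (c2.intervalIntegrable _ _)]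
    congr 1; ext v
    rw [hP]; ring
  rw [e]
  rw [h0, sub_zero] at ftc
  linarith

/-- Derivative along a Gaussian path of a ratio observable. -/
lemma path_deriv {P : Type*} [Fintype P] [DecidableEq P] (τ : P → NNReal) (H0 : S → ℝ) (c c' : P → ℝ → ℝ)
    (a : P → S → ℝ) (y z : ℝ → S → S → ℝ) (f f' : ℝ → S → ℝ) (D : S → S → ℝ) (σ : ℝ → ℝ) (K : ℝ)
    (hy0 : ∀ θ s t, 0 ≤ y θ s t)
    (hyd : ∀ s t θ, HasDerivAt (fun θ => y θ s t) (z θ s t) θ)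
    (hfd : ∀ s θ, HasDerivAt (fun θ => f θ s) (f' θ s) θ)
    (hc : ∀ p θ, HasDerivAt (c p) (c' p θ) θ)
    (bz : ∀ θ s t, |z θ s t| ≤ K) (bf : ∀ θ s, |f θ s| ≤ K) (bf' : ∀ θ s, |f' θ s| ≤ K)
    (bc' : ∀ p θ, |c' p θ| ≤ K) (ba : ∀ p s, |a p s| ≤ K)
    (hcov : ∀ θ s t, ∑ p, τ p * (c p θ * c' p θ) * (a p s * a p t) = σ θ * D s t) (θ : ℝ) :
    HasDerivAt (fun θ => ∫ x, gav (aff H0 (fun p => c p θ) a x) (f θ) / VV (aff H0 (fun p => c p θ) a x) (y θ)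
        ∂(Measure.pi fun p => gaussianReal 0 (τ p)))
      (∫ x, dInt (aff H0 (fun p => c p θ) a x) (y θ) D (f θ) (f' θ) (z θ) (σ θ)
        ∂(Measure.pi fun p => gaussianReal 0 (τ p))) θ := by
  have hK0 : 0 ≤ K := (abs_nonneg _).trans (bf 0 (Classical.arbitrary S))
  have e1 : ∀ s t θ, Real.exp (-y θ s t) ≤ 1 := fun s t θ => Real.exp_le_one_iff.2 (by linarith [hy0 θ s t])
  have key := gauss_interp (Ω := S × S) τ (fun θ ω => H0 ω.1 + H0 ω.2 + y θ ω.1 ω.2) (fun θ ω => z θ ω.1 ω.2)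
    (fun θ ω => f θ ω.1 * Real.exp (-y θ ω.1 ω.2))
    (fun θ ω => f' θ ω.1 * Real.exp (-y θ ω.1 ω.2) - f θ ω.1 * Real.exp (-y θ ω.1 ω.2) * z θ ω.1 ω.2)
    c c' (fun p ω => a p ω.1 + a p ω.2) (2 * K + K * K)
    (fun ω θ => (hyd _ _ θ).const_add _)
    (fun ω θ => ((hfd ω.1 θ).mul (hyd ω.1 ω.2 θ).fun_neg.exp).congr_deriv (by ring)) hc
    (fun θ ω => (bz _ _ _).trans (by nlinarith)) ?_ ?_ (fun p θ => (bc' p θ).trans (by nlinarith)) ?_ θ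
  · have hL : ∀ θ x, aff (fun ω : S × S => H0 ω.1 + H0 ω.2 + y θ ω.1 ω.2) (fun p => c p θ)
        (fun p ω => a p ω.1 + a p ω.2) x = tl (aff H0 (fun p => c p θ) a x) (y θ) := by
      intro θ x
      ext ω
      simp only [aff, tl, mul_add, add_mul, Finset.sum_add_distrib]
      ring
    simp only [hL] at key
    convert key using 1
    · ext θ'; congr 1; ext x
      rw [gav_tl_exp]
    · congr 1; ext x
      set ℓ := aff H0 (fun p => c p θ) a x
      rw [gav_sub, gav_tl_exp, sum_kap, dInt, gav_tl_exp]
      have : ∀ u v : S × S, ∑ p, τ p * (c p θ * c' p θ) * ((a p u.1 + a p u.2) * (a p v.1 + a p v.2))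
          = σ θ * bb D u v := by
        intro u v
        simp only [bb, mul_add, ← hcov, ← Finset.sum_add_distrib]
        refine Finset.sum_congr rfl fun p _ => ?_
        ring
      simp only [this]
      rw [U3, ← gav_mul_left]
      simp only [← gav_mul_left]
      simp only [brk]
      have e : ∀ u v w : S × S, f θ u.1 * Real.exp (-y θ u.1 u.2) *
          (σ θ * bb D u u - 2 * (σ θ * bb D u v) - σ θ * bb D v v + 2 * (σ θ * bb D v w))
          = σ θ * (f θ u.1 * Real.exp (-y θ u.1 u.2) * (bb D u u - 2 * bb D u v - bb D v v + 2 * bb D v w)) := by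
        intros; ring
      simp only [e]
      ring
  · intro θ ω
    rw [abs_mul, Real.abs_exp]
    nlinarith [bf θ ω.1, e1 ω.1 ω.2 θ, abs_nonneg (f θ ω.1), Real.exp_pos (-y θ ω.1 ω.2)]
  · intro θ ω
    have hE := e1 ω.1 ω.2 θ
    have hE0 := Real.exp_pos (-y θ ω.1 ω.2)
    refine (abs_sub _ _).trans ?_
    rw [abs_mul, abs_mul, abs_mul, Real.abs_exp]
    have t1 : |f' θ ω.1| * Real.exp (-y θ ω.1 ω.2) ≤ K * 1 :=
      mul_le_mul (bf' _ _) hE hE0.le hK0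
    have t2 : |f θ ω.1| * Real.exp (-y θ ω.1 ω.2) * |z θ ω.1 ω.2| ≤ K * 1 * K :=
      mul_le_mul (mul_le_mul (bf _ _) hE hE0.le hK0) (bz _ _ _) (abs_nonneg _) (by linarith)
    linarith
  · intro p ω
    refine (abs_add_le _ _).trans ?_
    nlinarith [ba p ω.1, ba p ω.2]

end replicas3
end

section
lemma vx_integrable {P : Type} [Fintype P] (π : Measure (P → ℝ)) [IsProbabilityMeasure π]
    {G : ℝ → (P → ℝ) → ℝ} (hG : Continuous (Function.uncurry G)) {v0 B : ℝ} (hv0 : 0 ≤ v0)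
    (hB : ∀ v x, 0 ≤ v → v ≤ v0 → |G v x| ≤ B) :
     Integrable (Function.uncurry G) ((volume.restrict (Set.uIoc 0 v0)).prod π) := by
  have e : (volume.restrict (Set.uIoc 0 v0)).prod π
      = (volume.prod π).restrict ((Set.uIoc 0 v0) ×ˢ Set.univ) := by
    rw [← Measure.prod_restrict, Measure.restrict_univ]
  have : IsFiniteMeasure ((volume : Measure ℝ).restrict (Set.uIoc 0 v0)) := by
    rw [Set.uIoc_of_le hv0]; infer_instance
  refine Integrable.of_bound hG.aestronglyMeasurable B ?_
  rw [e]
  refine ae_restrict_of_forall_mem (measurableSet_uIoc.prod MeasurableSet.univ) ?_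
  rintro ⟨v, x⟩ hv
  rw [Set.uIoc_of_le hv0] at hv
  exact hB v x hv.1.1.le hv.1.2

lemma vx_swap {P : Type} [Fintype P] (π : Measure (P → ℝ)) [IsProbabilityMeasure π]
    {G : ℝ → (P → ℝ) → ℝ} (hG : Continuous (Function.uncurry G)) {v0 B : ℝ} (hv0 : 0 ≤ v0)
    (hB : ∀ v x, 0 ≤ v → v ≤ v0 → |G v x| ≤ B) :
     ∫ v in (0:ℝ)..v0, ∫ x, G v x ∂π = ∫ x, (∫ v in (0:ℝ)..v0, G v x) ∂π :=
  intervalIntegral_integral_swap (vx_integrable π hG hv0 hB)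

lemma vx_int_v {P : Type} [Fintype P] (π : Measure (P → ℝ)) [IsProbabilityMeasure π]
    {G : ℝ → (P → ℝ) → ℝ} (hG : Continuous (Function.uncurry G)) {v0 B : ℝ} (hv0 : 0 ≤ v0)
    (hB : ∀ v x, 0 ≤ v → v ≤ v0 → |G v x| ≤ B) :
     IntervalIntegrable (fun v => ∫ x, G v x ∂π) volume 0 v0 := by
  rw [intervalIntegrable_iff]
  exact (vx_integrable π hG hv0 hB).integral_prod_left

lemma vx_int_x {P : Type} [Fintype P] (π : Measure (P → ℝ)) [IsProbabilityMeasure π]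
    {G : ℝ → (P → ℝ) → ℝ} (hG : Continuous (Function.uncurry G)) {v0 B : ℝ} (hv0 : 0 ≤ v0)
    (hB : ∀ v x, 0 ≤ v → v ≤ v0 → |G v x| ≤ B) :
     Integrable (fun x => ∫ v in (0:ℝ)..v0, G v x) π := by
  simp only [intervalIntegral.integral_of_le hv0]
  have := (vx_integrable π hG hv0 hB).integral_prod_right
  rw [Set.uIoc_of_le hv0] at this
  exact this

lemma vx_int_G {P : Type} [Fintype P] (π : Measure (P → ℝ)) [IsProbabilityMeasure π]
    {G : ℝ → (P → ℝ) → ℝ} (hG : Continuous (Function.uncurry G)) {v0 B : ℝ}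
    (hB : ∀ v x, 0 ≤ v → v ≤ v0 → |G v x| ≤ B) {v : ℝ} (h0 : 0 ≤ v) (h1 : v ≤ v0) : Integrable (G v) π :=
  Integrable.of_bound (hG.comp (Continuous.prodMk continuous_const continuous_id)).aestronglyMeasurable B
    (Filter.Eventually.of_forall fun x => hB v x h0 h1)


/-- Interpolation path data. -/
structure PathData (S P : Type) [Fintype S] [Nonempty S] [Fintype P] [DecidableEq P] where
  τ : P → NNReal
  H0 : S → ℝ
  a : P → S → ℝ
  c : P → ℝ → ℝ
  c' : P → ℝ → ℝ
  d : ℝ → S → S → ℝ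
  d' : ℝ → S → S → ℝ
  D : S → S → ℝ
  σ : ℝ → ℝ
  r : ℝ
  κ : ℝ
  D0 : ℝ
  K : ℝ
  hr : 1 ≤ r
  hκ : 0 ≤ κ
  hc : ∀ p θ, HasDerivAt (c p) (c' p θ) θ
  hd : ∀ s t θ, HasDerivAt (fun θ => d θ s t) (d' θ s t) θ
  bc' : ∀ p θ, |c' p θ| ≤ K
  ba : ∀ p s, |a p s| ≤ K
  bd : ∀ θ s t, |d θ s t| ≤ 2
  bd' : ∀ θ s t, |d' θ s t| ≤ (r ^ 2)⁻¹
  hσ : ∀ θ, |σ θ| ≤ 1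
  hcov : ∀ θ s t, ∑ p, τ p * (c p θ * c' p θ) * (a p s * a p t) = σ θ * D s t
  hD0 : ∀ s, D s s = D0
  hDs : ∀ s t, D s t = D t s
  hD : ∀ θ s t, |D s t| ≤ κ * (|d θ s t| + (r ^ 2)⁻¹)

namespace PathData
variable {S P : Type} [Fintype S] [Nonempty S] [Fintype P] [DecidableEq P] (X : PathData S P)

/-- Hamiltonian. -/
def ell (θ : ℝ) (x : P → ℝ) : S → ℝ := aff X.H0 (fun p => X.c p θ) X.a x
/-- tilt -/
def yv (θ v : ℝ) (s t : S) : ℝ := (X.r * v) ^ 2 * X.d θ s t ^ 2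
/-- derivative of the tilt -/
def zv (θ v : ℝ) (s t : S) : ℝ := (X.r * v) ^ 2 * (2 * X.d θ s t * X.d' θ s t)
/-- Gaussian measure -/
def π : Measure (P → ℝ) := Measure.pi fun p => gaussianReal 0 (X.τ p)

instance : IsProbabilityMeasure X.π := by unfold π; infer_instance

/-- ratio observable -/
def rat (f : ℝ → S → ℝ) (θ v : ℝ) (x : P → ℝ) : ℝ :=
  gav (X.ell θ x) (f θ) / VV (X.ell θ x) (X.yv θ v)

/-- derivative integrand -/
def drat (f f' : ℝ → S → ℝ) (θ v : ℝ) (x : P → ℝ) : ℝ :=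
  dInt (X.ell θ x) (X.yv θ v) X.D (f θ) (f' θ) (X.zv θ v) (X.σ θ)

/-- integrated observable -/
def J (n : ℕ) (v0 : ℝ) (f : ℝ → S → ℝ) (θ : ℝ) : ℝ :=
  ∫ v in (0:ℝ)..v0, ∫ x, v ^ n * X.rat f θ v x ∂X.π

/-- its derivative -/
def J' (n : ℕ) (v0 : ℝ) (f f' : ℝ → S → ℝ) (θ : ℝ) : ℝ :=
  ∫ v in (0:ℝ)..v0, ∫ x, v ^ n * X.drat f f' θ v x ∂X.π

lemma yv_nonneg (θ v : ℝ) (s t : S) : 0 ≤ X.yv θ v s t := by unfold yv; positivity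

lemma cont_ell (θ : ℝ) (s : S) : Continuous fun w : ℝ × (P → ℝ) => X.ell θ w.2 s :=
  (continuous_aff X.H0 (fun p => X.c p θ) X.a s).comp continuous_snd

lemma cont_yv (θ : ℝ) (s t : S) : Continuous fun w : ℝ × (P → ℝ) => X.yv θ w.1 s t := by
  unfold yv; fun_prop

lemma cont_zv (θ : ℝ) (s t : S) : Continuous fun w : ℝ × (P → ℝ) => X.zv θ w.1 s t := by
  unfold zv; fun_prop

lemma cont_rat (f : ℝ → S → ℝ) (θ : ℝ) (n : ℕ) :
    Continuous (Function.uncurry fun v x => v ^ n * X.rat f θ v x) := by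
  unfold rat Function.uncurry
  have h1 : Continuous fun w : ℝ × (P → ℝ) => gav (X.ell θ w.2) (f θ) :=
    continuous_gav (X.cont_ell θ) fun s => continuous_const
  exact (continuous_fst.pow n).mul (h1.div
    (continuous_VV (X.cont_ell θ) (X.cont_yv θ)) fun w => (VV_pos _ _).ne')

lemma cont_drat (f f' : ℝ → S → ℝ) (θ : ℝ) (n : ℕ) :
    Continuous (Function.uncurry fun v x => v ^ n * X.drat f f' θ v x) := by
  unfold drat Function.uncurry
  exact (continuous_fst.pow n).mul (continuous_dInt _ _ (X.cont_ell θ) (X.cont_yv θ) (X.cont_zv θ)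
    (fun s => continuous_const) (fun s => continuous_const))

lemma zv_le {θ v : ℝ} (hv : 0 ≤ v) (hv1 : v ≤ 1) (s t : S) : |X.zv θ v s t| ≤ 2 * |X.d θ s t| := by
  unfold zv
  have hr := X.hr
  rw [abs_mul, abs_mul, abs_mul, abs_two, abs_of_nonneg (by positivity : 0 ≤ (X.r * v) ^ 2), mul_pow]
  have h1 : v ^ 2 ≤ 1 := pow_le_one₀ hv hv1
  have h2 := X.bd' θ s t
  have h3 : X.r ^ 2 * |X.d' θ s t| ≤ 1 := by
    have : X.r ^ 2 * |X.d' θ s t| ≤ X.r ^ 2 * (X.r ^ 2)⁻¹ := by gcongr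
    rwa [mul_inv_cancel₀ (by positivity)] at this
  have h4 : v ^ 2 * (X.r ^ 2 * |X.d' θ s t|) ≤ 1 := by
    have := mul_le_mul h1 h3 (by positivity) (by norm_num)
    linarith
  calc X.r ^ 2 * v ^ 2 * (2 * |X.d θ s t| * |X.d' θ s t|)
      = 2 * |X.d θ s t| * (v ^ 2 * (X.r ^ 2 * |X.d' θ s t|)) := by ring
    _ ≤ 2 * |X.d θ s t| * 1 := by gcongr
    _ = _ := by ring

lemma hr2 : (X.r ^ 2)⁻¹ ≤ 1 := inv_le_one_of_one_le₀ (one_le_pow₀ X.hr)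

lemma zv_le' {θ v : ℝ} (hv : 0 ≤ v) (hv1 : v ≤ 1) (s t : S) : |X.zv θ v s t| ≤ 4 + 3 * X.κ := by
  have := X.zv_le hv hv1 (θ := θ) s t
  have := X.bd θ s t
  have := X.hκ
  linarith

lemma D_le' (s t : S) : |X.D s t| ≤ 4 + 3 * X.κ := by
  have := X.hD 0 s t
  have h1 := X.bd 0 s t
  have h2 := X.hκ
  have h3 := X.hr2
  nlinarith

lemma invV_le (θ v : ℝ) (x : P → ℝ) : 1 / VV (X.ell θ x) (X.yv θ v) ≤ 1 := by
  rw [div_le_one (VV_pos _ _)]; exact one_le_VV _ _ (X.yv_nonneg θ v)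

lemma invV_nonneg (θ v : ℝ) (x : P → ℝ) : 0 ≤ 1 / VV (X.ell θ x) (X.yv θ v) := by
  have := VV_pos (X.ell θ x) (X.yv θ v); positivity

lemma rat_bd {f : ℝ → S → ℝ} {Kf : ℝ} (bf : ∀ θ s, |f θ s| ≤ Kf) (θ v : ℝ) (x : P → ℝ) : |X.rat f θ v x| ≤ Kf := by
  unfold rat
  rw [div_eq_mul_one_div, abs_mul, abs_of_nonneg (X.invV_nonneg θ v x)]
  exact (mul_le_of_le_one_right (abs_nonneg _) (X.invV_le θ v x)).trans (abs_gav_le_const _ (bf θ))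

lemma drat_crude {f f' : ℝ → S → ℝ} {F F' : S → ℝ} {θ : ℝ} (bf : ∀ s, |f θ s| ≤ F s) (bf' : ∀ s, |f' θ s| ≤ F' s)
    {v : ℝ} (hv : 0 ≤ v) (hv1 : v ≤ 1) (x : P → ℝ) :
    |X.drat f f' θ v x| ≤ (gav (X.ell θ x) F' + 25 * (4 + 3 * X.κ) * gav (X.ell θ x) F) *
      (1 / VV (X.ell θ x) (X.yv θ v)) :=
  dInt_crude _ _ _ _ _ F F' _ _ (4 + 3 * X.κ) (by have := X.hκ; positivity) (X.yv_nonneg θ v) (X.hσ θ) bf bf'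
    (X.zv_le' hv hv1) X.D_le'

lemma drat_bd {f f' : ℝ → S → ℝ} {Kf : ℝ} (bf : ∀ θ s, |f θ s| ≤ Kf) (bf' : ∀ θ s, |f' θ s| ≤ Kf)
    {v : ℝ} (hv : 0 ≤ v) (hv1 : v ≤ 1) (θ : ℝ) (x : P → ℝ) :
    |X.drat f f' θ v x| ≤ Kf + 25 * (4 + 3 * X.κ) * Kf := by
  have h := X.drat_crude (F := fun _ => Kf) (F' := fun _ => Kf) (bf θ) (bf' θ) hv hv1 x
  simp only [gav_const] at h
  have hK0 : 0 ≤ Kf := (abs_nonneg _).trans (bf 0 (Classical.arbitrary S))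
  have := X.hκ
  exact h.trans (mul_le_of_le_one_right (by positivity) (X.invV_le θ v x))

lemma abs_pow_mul_le {v b B : ℝ} (n : ℕ) (hv : 0 ≤ v) (hv1 : v ≤ 1) (h : |b| ≤ B) : |v ^ n * b| ≤ B := by
  rw [abs_mul, abs_of_nonneg (by positivity)]
  exact (mul_le_of_le_one_left (abs_nonneg _) (pow_le_one₀ hv hv1)).trans h

lemma J_deriv (n : ℕ) {v0 : ℝ} (hv0 : 0 ≤ v0) (hv1 : v0 ≤ 1) {f f' : ℝ → S → ℝ} {Kf : ℝ}
    (bf : ∀ θ s, |f θ s| ≤ Kf) (bf' : ∀ θ s, |f' θ s| ≤ Kf)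
    (hf : ∀ s θ, HasDerivAt (fun θ => f θ s) (f' θ s) θ) (θ : ℝ) :
    HasDerivAt (X.J n v0 f) (X.J' n v0 f f' θ) θ := by
  have br : ∀ θ v x, 0 ≤ v → v ≤ v0 → |v ^ n * X.rat f θ v x| ≤ Kf := fun θ v x h0 h1 =>
    abs_pow_mul_le n h0 (h1.trans hv1) (X.rat_bd bf θ v x)
  have bdr : ∀ θ v x, 0 ≤ v → v ≤ v0 → |v ^ n * X.drat f f' θ v x| ≤ Kf + 25 * (4 + 3 * X.κ) * Kf :=
    fun θ v x h0 h1 => abs_pow_mul_le n h0 (h1.trans hv1) (X.drat_bd bf bf' h0 (h1.trans hv1) θ x)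
  have iv := fun θ => vx_int_v X.π (X.cont_rat f θ n) hv0 (br θ)
  have idv := fun θ => vx_int_v X.π (X.cont_drat f f' θ n) hv0 (bdr θ)
  refine (intervalIntegral.hasDerivAt_integral_of_dominated_loc_of_deriv_le (μ := volume) (a := 0) (b := v0)
    (F := fun θ v => ∫ x, v ^ n * X.rat f θ v x ∂X.π) (F' := fun θ v => ∫ x, v ^ n * X.drat f f' θ v x ∂X.π)
    (x₀ := θ) (s := Set.univ) (bound := fun _ => Kf + 25 * (4 + 3 * X.κ) * Kf) Filter.univ_mem
    (Filter.Eventually.of_forall fun θ => (intervalIntegrable_iff.1 (iv θ)).aestronglyMeasurable) (iv θ)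
    (intervalIntegrable_iff.1 (idv θ)).aestronglyMeasurable
    (Filter.Eventually.of_forall fun v hv θ _ => ?_) intervalIntegrable_const
    (Filter.Eventually.of_forall fun v hv θ _ => ?_)).2
  · rw [Set.uIoc_of_le hv0] at hv
    refine (norm_integral_le_of_norm_le_const (C := Kf + 25 * (4 + 3 * X.κ) * Kf)
      (Filter.Eventually.of_forall fun x => bdr θ v x hv.1.le hv.2)).trans ?_
    simp
  · rw [Set.uIoc_of_le hv0] at hv
    simp only [integral_const_mul]
    refine HasDerivAt.const_mul _ ?_
    obtain ⟨K, hK⟩ : ∃ K, K = max (max (4 + 3 * X.κ) Kf) X.K := ⟨_, rfl⟩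
    have k1 : 4 + 3 * X.κ ≤ K := by rw [hK]; exact (le_max_left _ _).trans (le_max_left _ _)
    have k2 : Kf ≤ K := by rw [hK]; exact (le_max_right _ _).trans (le_max_left _ _)
    have k3 : X.K ≤ K := by rw [hK]; exact le_max_right _ _
    refine path_deriv X.τ X.H0 X.c X.c' X.a (fun θ => X.yv θ v) (fun θ => X.zv θ v) f f' X.D X.σ K
      (fun θ => X.yv_nonneg θ v) ?_ hf X.hc (fun θ s t => (X.zv_le' hv.1.le (hv.2.trans hv1) s t).trans k1)
      (fun θ s => (bf θ s).trans k2) (fun θ s => (bf' θ s).trans k2) (fun p θ => (X.bc' p θ).trans k3)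
      (fun p s => (X.ba p s).trans k3) X.hcov θ
    intro s t θ
    refine (((X.hd s t θ).fun_pow 2).const_mul _).congr_deriv ?_
    simp [zv]

/-- the improved bound for derivative -/
lemma J'_bound {n : ℕ} (hn : 2 ≤ n) {v0 : ℝ} (hv0 : 0 ≤ v0) (hv1 : v0 ≤ 1) {f f' g : ℝ → S → ℝ} {Kf Kg : ℝ}
    (bf : ∀ θ s, |f θ s| ≤ Kf) (bf' : ∀ θ s, |f' θ s| ≤ Kf) (bg : ∀ θ s, |g θ s ^ n| ≤ Kg)
    (hg : ∀ θ s, 0 ≤ g θ s)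
    (hf : ∀ θ s, |f θ s| ≤ 2 * g θ s ^ (n - 1))
    (hf' : ∀ θ s, |f' θ s| ≤ 4 * n * (g θ s ^ (n - 2) * (X.r ^ 2)⁻¹)) {ε : ℝ} (hε : 0 < ε) (hε1 : ε ≤ 1) (θ : ℝ) :
    |X.J' n v0 f f' θ| ≤ (12 * n + X.κ * (80 * n + 40)) * (1 + (n + 1) / 2) *
      (ε * X.J n v0 (fun θ s => g θ s ^ n) θ + (ε⁻¹) ^ (n - 1) * (X.r⁻¹) ^ n) := by
  have hr := X.hr
  have hκ := X.hκ
  set K0 : ℝ := 12 * n + X.κ * (80 * n + 40) with hK0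
  have hK0' : 0 ≤ K0 := by positivity
  set c0 := (ε⁻¹) ^ (n - 1) with hc0
  have hc0' : 0 ≤ c0 := by positivity
  set T : (P → ℝ) → ℝ := fun x => gav (X.ell θ x) (fun s => g θ s ^ n) with hT
  have hT0 : ∀ x, 0 ≤ T x := fun x => gav_nonneg _ fun s => by have := hg θ s; positivity
  have hTb : ∀ x, T x ≤ Kg := fun x => (le_abs_self _).trans (abs_gav_le_const _ (bg θ))
  have hKg : 0 ≤ Kg := (abs_nonneg _).trans (bg 0 (Classical.arbitrary S))
  set φ : ℝ → (P → ℝ) → ℝ := fun v x => Ph (X.ell θ x) (X.yv θ v) with hφ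
  have hφ0 : ∀ v x, 0 ≤ φ v x := fun v x => Ph_nonneg _ _ (X.yv_nonneg θ v)
  have hφb : ∀ v x, 0 ≤ v → v ≤ v0 → φ v x ≤ 1 + 4 * X.r ^ 2 := by
    intro v x h0 h1
    have hv2 : v ^ 2 ≤ 1 := pow_le_one₀ h0 (h1.trans hv1)
    simp only [hφ, Ph]
    have : gav (tl (X.ell θ x) (X.yv θ v)) (fun ω => X.yv θ v ω.1 ω.2) ≤ 4 * X.r ^ 2 := by
      refine (le_abs_self _).trans (abs_gav_le_const _ fun ω => ?_)
      rw [abs_of_nonneg (X.yv_nonneg θ v _ _)]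
      unfold yv
      have h2 : X.d θ ω.1 ω.2 ^ 2 ≤ 4 := by
        have := X.bd θ ω.1 ω.2
        nlinarith [abs_le.1 this]
      have h3 : (X.r * v) ^ 2 ≤ X.r ^ 2 := by
        rw [mul_pow]; exact mul_le_of_le_one_right (by positivity) hv2
      calc (X.r * v) ^ 2 * X.d θ ω.1 ω.2 ^ 2 ≤ X.r ^ 2 * 4 := by gcongr
        _ = _ := by ring
    have h0' : 0 ≤ gav (tl (X.ell θ x) (X.yv θ v)) (fun ω => X.yv θ v ω.1 ω.2) :=
      gav_nonneg _ fun ω => X.yv_nonneg _ _ _ _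
    calc _ ≤ 1 * (1 + gav (tl (X.ell θ x) (X.yv θ v)) (fun ω => X.yv θ v ω.1 ω.2)) := by
          have := X.invV_le θ v x
          gcongr
      _ ≤ _ := by linarith
  have cφ : Continuous (Function.uncurry φ) := continuous_Ph (X.cont_ell θ) (X.cont_yv θ)
  have cT : Continuous fun w : ℝ × (P → ℝ) => T w.2 := continuous_gav (X.cont_ell θ) fun s => continuous_const
  -- dominating function
  set G : ℝ → (P → ℝ) → ℝ := fun v x => K0 * (ε * T x * (v ^ n * φ v x) + c0 * (X.r⁻¹) ^ n * (v ^ 0 * φ v x)) with hG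
  have cG : Continuous (Function.uncurry G) := by
    have h1 : Continuous fun w : ℝ × (P → ℝ) => φ w.1 w.2 := cφ
    have : Continuous fun w : ℝ × (P → ℝ) =>
      K0 * (ε * T w.2 * (w.1 ^ n * φ w.1 w.2) + c0 * (X.r⁻¹) ^ n * (w.1 ^ 0 * φ w.1 w.2)) :=
      continuous_const.mul (((continuous_const.mul cT).mul ((continuous_fst.pow n).mul h1)).add
        (continuous_const.mul ((continuous_fst.pow 0).mul h1)))
    exact this
  have bG : ∀ v x, 0 ≤ v → v ≤ v0 → |G v x| ≤ K0 * (ε * Kg * (1 * (1 + 4 * X.r ^ 2)) + c0 * (X.r⁻¹) ^ n * (1 * (1 + 4 * X.r ^ 2))) := by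
    intro v x h0 h1
    have hh := hφ0 v x
    have hh' := hφb v x h0 h1
    have ht := hT0 x
    have ht' := hTb x
    have hvn : v ^ n ≤ 1 := pow_le_one₀ h0 (h1.trans hv1)
    rw [abs_of_nonneg (by simp only [hG]; positivity)]
    simp only [hG, pow_zero]
    gcongr
  have hbd : ∀ v ∈ Set.Ioo 0 v0, ‖∫ x, v ^ n * X.drat f f' θ v x ∂X.π‖ ≤ ∫ x, G v x ∂X.π := by
    intro v hv
    have hvp := hv.1
    have hM : 0 < X.r * v := by positivity
    refine norm_integral_le_of_norm_le (vx_int_G X.π cG bG hv.1.le hv.2.le) (Filter.Eventually.of_forall fun x => ?_)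
    have hMr : X.r * v ≤ X.r := mul_le_of_le_one_right (by linarith) (hv.2.le.trans hv1)
    have hi : X.r⁻¹ ≤ (X.r * v)⁻¹ := inv_anti₀ hM hMr
    have hi2 : (X.r ^ 2)⁻¹ ≤ ((X.r * v)⁻¹) ^ 2 := by
      rw [← inv_pow]; gcongr
    have hi1 : (X.r ^ 2)⁻¹ ≤ (X.r * v)⁻¹ := by
      refine le_trans ?_ hi
      apply inv_anti₀ (by linarith); nlinarith
    have key := dInt_bound (X.ell θ x) (X.d θ) X.D (f θ) (f' θ) (g θ) (X.zv θ v) (X.σ θ) (X.r * v) ε X.κ X.D0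
      (X.r ^ 2)⁻¹ hn hε hε1 hM X.hκ (by positivity) hi1 (X.hσ θ) (hg θ) (hf θ)
      (fun s => (hf' θ s).trans (by have := hg θ s; gcongr)) (X.zv_le hv.1.le (hv.2.le.trans hv1)) X.hD0 X.hDs (X.hD θ)
    rw [Real.norm_eq_abs, abs_mul, abs_of_nonneg (by positivity : 0 ≤ v ^ n)]
    refine (mul_le_mul_of_nonneg_left key (by positivity)).trans (le_of_eq ?_)
    simp only [hG, hφ, hT, ← hK0, ← hc0]
    have e : (X.r⁻¹) ^ n = v ^ n * ((X.r * v)⁻¹) ^ n := by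
      rw [← mul_pow]; congr 1; field_simp
    rw [e]
    unfold yv
    ring
  have s1 : |X.J' n v0 f f' θ| ≤ ∫ v in (0:ℝ)..v0, ∫ x, G v x ∂X.π := by
    unfold J'
    rw [← Real.norm_eq_abs]
    refine (intervalIntegral.norm_integral_le_integral_norm hv0).trans ?_
    have idv := vx_int_v X.π (X.cont_drat f f' θ n) hv0 (B := Kf + 25 * (4 + 3 * X.κ) * Kf)
      (fun v x h0 h1 => abs_pow_mul_le n h0 (h1.trans hv1) (X.drat_bd bf bf' h0 (h1.trans hv1) θ x))
    exact intervalIntegral.integral_mono_on_of_le_Ioo hv0 idv.norm (vx_int_v X.π cG hv0 bG) hbd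
  rw [vx_swap X.π cG hv0 bG] at s1
  refine s1.trans ?_
  have iR := vx_int_x X.π (X.cont_rat (fun θ s => g θ s ^ n) θ n) hv0
    (fun v x h0 h1 => abs_pow_mul_le n h0 (h1.trans hv1) (X.rat_bd bg θ v x))
  have e2 : X.J n v0 (fun θ s => g θ s ^ n) θ = ∫ x, (∫ v in (0:ℝ)..v0, v ^ n * X.rat (fun θ s => g θ s ^ n) θ v x) ∂X.π :=
    vx_swap X.π (X.cont_rat (fun θ s => g θ s ^ n) θ n) hv0
      (fun v x h0 h1 => abs_pow_mul_le n h0 (h1.trans hv1) (X.rat_bd bg θ v x))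
  have e3 : K0 * (1 + (n + 1) / 2) * (ε * X.J n v0 (fun θ s => g θ s ^ n) θ + c0 * (X.r⁻¹) ^ n)
      = ∫ x, K0 * (1 + (n + 1) / 2) * (ε * (∫ v in (0:ℝ)..v0, v ^ n * X.rat (fun θ s => g θ s ^ n) θ v x) + c0 * (X.r⁻¹) ^ n) ∂X.π := by
    rw [integral_const_mul, integral_add (iR.const_mul _) (integrable_const _), integral_const_mul, ← e2]
    simp
  rw [e3]
  refine integral_mono (vx_int_x X.π cG hv0 bG) (((iR.const_mul _).add (integrable_const _)).const_mul _) fun x => ?_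
  have cy : ∀ s t, Continuous fun v : ℝ => X.yv θ v s t := fun s t => by unfold yv; fun_prop
  have cφx : Continuous fun v => φ v x := continuous_Ph (fun s => continuous_const) cy
  have cVx : Continuous fun v => 1 / VV (X.ell θ x) (X.yv θ v) :=
    continuous_const.div (continuous_VV (fun s => continuous_const) cy) fun v => (VV_pos _ _).ne'
  have g1 : ∫ v in (0:ℝ)..v0, G v x = K0 * (ε * T x * (∫ v in (0:ℝ)..v0, v ^ n * φ v x)
      + c0 * (X.r⁻¹) ^ n * ∫ v in (0:ℝ)..v0, v ^ 0 * φ v x) := by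
    simp only [hG]
    have i1 : IntervalIntegrable (fun v => ε * T x * (v ^ n * φ v x)) volume 0 v0 :=
      Continuous.intervalIntegrable (by fun_prop) _ _
    have i2 : IntervalIntegrable (fun v => c0 * (X.r⁻¹) ^ n * (v ^ 0 * φ v x)) volume 0 v0 :=
      Continuous.intervalIntegrable (by fun_prop) _ _
    rw [intervalIntegral.integral_const_mul, intervalIntegral.integral_add i1 i2,
      intervalIntegral.integral_const_mul, intervalIntegral.integral_const_mul]
  have p1 := by_parts (X.ell θ x) (X.d θ) X.r v0 hv0 n
  have p0 := by_parts (X.ell θ x) (X.d θ) X.r v0 hv0 0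
  have q0 : ∫ v in (0:ℝ)..v0, v ^ 0 * (1 / VV (X.ell θ x) (X.yv θ v)) ≤ 1 := by
    have : ∫ v in (0:ℝ)..v0, v ^ 0 * (1 / VV (X.ell θ x) (X.yv θ v)) ≤ ∫ v in (0:ℝ)..v0, (1:ℝ) := by
      refine intervalIntegral.integral_mono hv0 (Continuous.intervalIntegrable (by fun_prop) _ _)
        intervalIntegrable_const fun v => ?_
      simpa using X.invV_le θ v x
    refine this.trans ?_
    simpa using hv1
  have p1' : ∫ v in (0:ℝ)..v0, v ^ n * φ v x ≤ (1 + ((n:ℝ) + 1) / 2) * ∫ v in (0:ℝ)..v0, v ^ n * (1 / VV (X.ell θ x) (X.yv θ v)) := p1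
  have p0' : ∫ v in (0:ℝ)..v0, v ^ 0 * φ v x ≤ (1 + (((0:ℕ):ℝ) + 1) / 2) * ∫ v in (0:ℝ)..v0, v ^ 0 * (1 / VV (X.ell θ x) (X.yv θ v)) := p0
  have p0'' : ∫ v in (0:ℝ)..v0, v ^ 0 * φ v x ≤ 1 + ((n:ℝ) + 1) / 2 := by
    have : (0:ℝ) ≤ n := by positivity
    push_cast at p0'
    linarith
  have r1 : ∫ v in (0:ℝ)..v0, v ^ n * X.rat (fun θ s => g θ s ^ n) θ v x
      = T x * ∫ v in (0:ℝ)..v0, v ^ n * (1 / VV (X.ell θ x) (X.yv θ v)) := by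
    rw [← intervalIntegral.integral_const_mul]
    congr 1; ext v
    unfold rat
    simp only [hT]; ring
  rw [g1]
  simp only []
  rw [r1]
  have ht := hT0 x
  calc _ ≤ K0 * (ε * T x * ((1 + ((n:ℝ) + 1) / 2) * ∫ v in (0:ℝ)..v0, v ^ n * (1 / VV (X.ell θ x) (X.yv θ v)))
      + c0 * (X.r⁻¹) ^ n * (1 + ((n:ℝ) + 1) / 2)) := by gcongr
    _ = _ := by ring

end PathData
end

section
namespace PathData
variable {S P : Type} [Fintype S] [Nonempty S] [Fintype P] [DecidableEq P] (X : PathData S P)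

/-- Gronwall constant -/
def Kc (κ : ℝ) (n : ℕ) : ℝ := 2 * n + 25 * (4 + 3 * κ)

lemma rat_nonneg {f : ℝ → S → ℝ} {θ : ℝ} (hf : ∀ s, 0 ≤ f θ s) (v : ℝ) (x : P → ℝ) : 0 ≤ X.rat f θ v x :=
  div_nonneg (gav_nonneg _ hf) (VV_pos _ _).le

lemma J_nonneg (n : ℕ) {v0 : ℝ} (hv0 : 0 ≤ v0) {f : ℝ → S → ℝ} {θ : ℝ} (hf : ∀ s, 0 ≤ f θ s) : 0 ≤ X.J n v0 f θ := by
  unfold J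
  refine intervalIntegral.integral_nonneg hv0 fun v hv => integral_nonneg fun x => ?_
  exact mul_nonneg (pow_nonneg hv.1 n) (X.rat_nonneg hf v x)

lemma B'_bound {n : ℕ} (hn : 2 ≤ n) {v0 : ℝ} (hv0 : 0 ≤ v0) (hv1 : v0 ≤ 1) {b b' g : ℝ → S → ℝ} {Kf : ℝ}
    (bb : ∀ θ s, |b θ s| ≤ Kf) (bb' : ∀ θ s, |b' θ s| ≤ Kf) (hb : ∀ θ s, b θ s = g θ s ^ n)
    (hg : ∀ θ s, 0 ≤ g θ s)
    (hb' : ∀ θ s, |b' θ s| ≤ 2 * n * (g θ s ^ (n - 1) * (X.r ^ 2)⁻¹)) (θ : ℝ) :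
    |X.J' n v0 b b' θ| ≤ Kc X.κ n * (X.J n v0 b θ + (X.r⁻¹) ^ n) := by
  have hr := X.hr
  have hκ := X.hκ
  have hKc : 0 ≤ Kc X.κ n := by unfold Kc; positivity
  have hrn : 0 ≤ (X.r⁻¹) ^ n := by positivity
  have hb0 : ∀ s, 0 ≤ b θ s := fun s => by rw [hb]; have := hg θ s; positivity
  have hF' : ∀ s, |b' θ s| ≤ 2 * n * (b θ s + (X.r⁻¹) ^ n) := by
    intro s
    refine (hb' θ s).trans ?_
    have y := young1 hn (hg θ s) (w := (X.r ^ 2)⁻¹) (by positivity) one_pos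
    have hw : ((X.r ^ 2)⁻¹) ^ n ≤ (X.r⁻¹) ^ n := by
      gcongr
      nlinarith
    rw [hb]
    simp only [inv_one, one_pow, one_mul] at y
    have : g θ s ^ (n - 1) * (X.r ^ 2)⁻¹ ≤ g θ s ^ n + (X.r⁻¹) ^ n := by linarith
    gcongr
  set G : ℝ → (P → ℝ) → ℝ := fun v x => Kc X.κ n * (v ^ n * X.rat b θ v x + (X.r⁻¹) ^ n) with hG
  have cG : Continuous (Function.uncurry G) :=
    continuous_const.mul ((X.cont_rat b θ n).add continuous_const)
  have bG0 : ∀ v x, 0 ≤ v → v ≤ v0 → |v ^ n * X.rat b θ v x| ≤ Kf := fun v x h0 h1 =>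
    abs_pow_mul_le n h0 (h1.trans hv1) (X.rat_bd bb θ v x)
  have bG : ∀ v x, 0 ≤ v → v ≤ v0 → |G v x| ≤ Kc X.κ n * (Kf + (X.r⁻¹) ^ n) := by
    intro v x h0 h1
    simp only [hG]
    rw [abs_mul, abs_of_nonneg hKc]
    gcongr
    refine (abs_add_le _ _).trans ?_
    rw [abs_of_nonneg hrn]
    have := bG0 v x h0 h1
    linarith
  have hbd : ∀ v ∈ Set.Icc 0 v0, ‖∫ x, v ^ n * X.drat b b' θ v x ∂X.π‖ ≤ ∫ x, G v x ∂X.π := by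
    intro v hv
    refine norm_integral_le_of_norm_le (vx_int_G X.π cG bG hv.1 hv.2) (Filter.Eventually.of_forall fun x => ?_)
    have h := X.drat_crude (f := b) (f' := b') (F := b θ) (F' := fun s => 2 * n * (b θ s + (X.r⁻¹) ^ n))
      (fun s => by rw [abs_of_nonneg (hb0 s)]) hF' hv.1 (hv.2.trans hv1) x
    rw [gav_mul_left, gav_add, gav_const] at h
    have hvn : v ^ n ≤ 1 := pow_le_one₀ hv.1 (hv.2.trans hv1)
    have hvn0 : 0 ≤ v ^ n := pow_nonneg hv.1 n
    rw [Real.norm_eq_abs, abs_mul, abs_of_nonneg hvn0]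
    have hV := X.invV_le θ v x
    have hV0 := X.invV_nonneg θ v x
    have hT : 0 ≤ gav (X.ell θ x) (b θ) := gav_nonneg _ hb0
    have er : X.rat b θ v x = gav (X.ell θ x) (b θ) * (1 / VV (X.ell θ x) (X.yv θ v)) := by
      unfold rat; ring
    simp only [hG]
    rw [er]
    set T := gav (X.ell θ x) (b θ)
    set w := 1 / VV (X.ell θ x) (X.yv θ v)
    have hvw : v ^ n * w ≤ 1 := by nlinarith
    calc v ^ n * |X.drat b b' θ v x| ≤ v ^ n * ((2 * n * (T + (X.r⁻¹) ^ n) + 25 * (4 + 3 * X.κ) * T) * w) := by gcongr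
      _ = Kc X.κ n * (v ^ n * (T * w)) + 2 * n * ((X.r⁻¹) ^ n * (v ^ n * w)) := by unfold Kc; ring
      _ ≤ Kc X.κ n * (v ^ n * (T * w)) + Kc X.κ n * ((X.r⁻¹) ^ n * 1) := by
          gcongr
          unfold Kc
          have : 0 ≤ 25 * (4 + 3 * X.κ) := by positivity
          linarith
      _ = _ := by ring
  unfold J'
  rw [← Real.norm_eq_abs]
  refine (intervalIntegral.norm_integral_le_integral_norm hv0).trans ?_
  have idv := vx_int_v X.π (X.cont_drat b b' θ n) hv0 (B := Kf + 25 * (4 + 3 * X.κ) * Kf)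
      (fun v x h0 h1 => abs_pow_mul_le n h0 (h1.trans hv1) (X.drat_bd bb bb' h0 (h1.trans hv1) θ x))
  refine (intervalIntegral.integral_mono_on hv0 idv.norm (vx_int_v X.π cG hv0 bG) hbd).trans ?_
  have ib := vx_int_v X.π (X.cont_rat b θ n) hv0 bG0
  have e : ∀ v ∈ Set.uIcc 0 v0, ∫ x, G v x ∂X.π = Kc X.κ n * ((∫ x, v ^ n * X.rat b θ v x ∂X.π) + (X.r⁻¹) ^ n) := by
    intro v hv
    rw [Set.uIcc_of_le hv0] at hv
    simp only [hG]
    rw [integral_const_mul, integral_add (vx_int_G X.π (X.cont_rat b θ n) bG0 hv.1 hv.2) (integrable_const _)]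
    simp
  rw [intervalIntegral.integral_congr e, intervalIntegral.integral_const_mul, intervalIntegral.integral_add ib
    intervalIntegrable_const]
  unfold J
  gcongr
  simp only [intervalIntegral.integral_const, sub_zero, smul_eq_mul]
  exact mul_le_of_le_one_left hrn hv1

lemma B_gron {n : ℕ} (hn : 2 ≤ n) {v0 : ℝ} (hv0 : 0 ≤ v0) (hv1 : v0 ≤ 1) {b b' g : ℝ → S → ℝ} {Kf : ℝ}
    (bb : ∀ θ s, |b θ s| ≤ Kf) (bb' : ∀ θ s, |b' θ s| ≤ Kf) (hb : ∀ θ s, b θ s = g θ s ^ n)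
    (hg : ∀ θ s, 0 ≤ g θ s)
    (hbd : ∀ s θ, HasDerivAt (fun θ => b θ s) (b' θ s) θ)
    (hb' : ∀ θ s, |b' θ s| ≤ 2 * n * (g θ s ^ (n - 1) * (X.r ^ 2)⁻¹)) {θ A : ℝ} (h0 : 0 ≤ θ) (h1 : θ ≤ A) :
    X.J n v0 b θ ≤ Real.exp (Kc X.κ n * A) * (X.J n v0 b A + (X.r⁻¹) ^ n) := by
  have hr := X.hr
  have hκ := X.hκ
  have hKc : 0 ≤ Kc X.κ n := by unfold Kc; positivity
  have hrn : 0 ≤ (X.r⁻¹) ^ n := by positivity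
  have hb0 : ∀ θ s, 0 ≤ b θ s := fun θ s => by rw [hb]; have := hg θ s; positivity
  have hm : Monotone fun θ => Real.exp (Kc X.κ n * θ) * (X.J n v0 b θ + (X.r⁻¹) ^ n) := by
    refine monotone_of_hasDerivAt_nonneg (f' := fun θ => Real.exp (Kc X.κ n * θ) * (Kc X.κ n * 1) * (X.J n v0 b θ + (X.r⁻¹) ^ n)
      + Real.exp (Kc X.κ n * θ) * X.J' n v0 b b' θ) ?_ ?_
    · intro θ
      exact (((hasDerivAt_id θ).const_mul _).exp).mul ((X.J_deriv n hv0 hv1 bb bb' hbd θ).add_const _)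
    · intro θ
      have := X.B'_bound hn hv0 hv1 bb bb' hb hg hb' θ
      have := (abs_le.1 this).1
      have e : Real.exp (Kc X.κ n * θ) * (Kc X.κ n * 1) * (X.J n v0 b θ + (X.r⁻¹) ^ n)
        + Real.exp (Kc X.κ n * θ) * X.J' n v0 b b' θ = Real.exp (Kc X.κ n * θ) * (Kc X.κ n * (X.J n v0 b θ + (X.r⁻¹) ^ n) + X.J' n v0 b b' θ) := by ring
      simp only [Pi.zero_apply]
      rw [e]
      exact mul_nonneg (Real.exp_pos _).le (by linarith)
  have h2 := hm h1
  simp only at h2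
  have h3 := X.J_nonneg n hv0 (hb0 θ)
  have h4 : 1 ≤ Real.exp (Kc X.κ n * θ) := Real.one_le_exp (by positivity)
  nlinarith

/-- improved constant -/
def K1 (κ : ℝ) (n : ℕ) : ℝ := (12 * n + κ * (80 * n + 40)) * (1 + (n + 1) / 2)

lemma path_main {n : ℕ} (hn : 2 ≤ n) {v0 : ℝ} (hv0 : 0 ≤ v0) (hv1 : v0 ≤ 1) {b b' f f' g : ℝ → S → ℝ} {Kf : ℝ}
    (bb : ∀ θ s, |b θ s| ≤ Kf) (bb' : ∀ θ s, |b' θ s| ≤ Kf) (hb : ∀ θ s, b θ s = g θ s ^ n)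
    (hg : ∀ θ s, 0 ≤ g θ s)
    (hbd : ∀ s θ, HasDerivAt (fun θ => b θ s) (b' θ s) θ)
    (hb' : ∀ θ s, |b' θ s| ≤ 2 * n * (g θ s ^ (n - 1) * (X.r ^ 2)⁻¹))
    (bf : ∀ θ s, |f θ s| ≤ Kf) (bf' : ∀ θ s, |f' θ s| ≤ Kf)
    (hfd : ∀ s θ, HasDerivAt (fun θ => f θ s) (f' θ s) θ)
    (hf : ∀ θ s, |f θ s| ≤ 2 * g θ s ^ (n - 1))
    (hf' : ∀ θ s, |f' θ s| ≤ 4 * n * (g θ s ^ (n - 2) * (X.r ^ 2)⁻¹)) {ε : ℝ} (hε : 0 < ε) (hε1 : ε ≤ 1)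
    {A : ℝ} (hA : 0 ≤ A) :
    |X.J n v0 f A - X.J n v0 f 0| ≤ K1 X.κ n *
      (ε * (Real.exp (Kc X.κ n * A) * (X.J n v0 b A + (X.r⁻¹) ^ n)) + (ε⁻¹) ^ (n - 1) * (X.r⁻¹) ^ n) * A := by
  have hκ := X.hκ
  have hK1 : 0 ≤ K1 X.κ n := by unfold K1; positivity
  have e : (fun θ s => g θ s ^ n) = b := by funext θ s; rw [hb]
  have h := norm_image_sub_le_of_norm_deriv_le_segment' (f := X.J n v0 f) (f' := X.J' n v0 f f') (a := 0) (b := A)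
    (C := K1 X.κ n *
      (ε * (Real.exp (Kc X.κ n * A) * (X.J n v0 b A + (X.r⁻¹) ^ n)) + (ε⁻¹) ^ (n - 1) * (X.r⁻¹) ^ n))
    (fun θ _ => (X.J_deriv n hv0 hv1 bf bf' hfd θ).hasDerivWithinAt) (fun θ hθ => ?_) A ⟨hA, le_rfl⟩
  · simpa using h
  · have h1 := X.J'_bound hn hv0 hv1 bf bf' (g := g) (Kg := Kf) (fun θ s => by rw [← hb]; exact bb θ s) hg hf hf' hε hε1 θ
    rw [e] at h1
    have h2 := X.B_gron hn hv0 hv1 bb bb' hb hg hbd hb' hθ.1 hθ.2.le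
    refine h1.trans ?_
    change K1 X.κ n * _ ≤ _
    gcongr

end PathData
end

section
lemma spin_sq (b : Bool) : spin b ^ 2 = 1 := by cases b <;> simp [spin]
lemma spin_mul_self (b : Bool) : spin b * spin b = 1 := by cases b <;> simp [spin]
lemma abs_spin (b : Bool) : |spin b| = 1 := by cases b <;> simp [spin]
lemma spin_not (b : Bool) : spin (!b) = - spin b := by cases b <;> simp [spin]

lemma sum_star {N : ℕ} (i : Fin N) (u : Fin N → ℝ) :
    ∑ p : Fin N × Fin N, (if p.1 < p.2 ∧ (p.1 = i ∨ p.2 = i) then u p.1 * u p.2 else 0)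
      = u i * ∑ j ∈ Finset.univ.erase i, u j := by
  have e : ∀ p : Fin N × Fin N, (if p.1 < p.2 ∧ (p.1 = i ∨ p.2 = i) then u p.1 * u p.2 else 0)
      = (if p.1 = i then (if i < p.2 then u i * u p.2 else 0) else 0) + (if p.2 = i then (if p.1 < i then u p.1 * u i else 0) else 0) := by
    rintro ⟨a, b⟩
    by_cases h1 : a = i
    · subst h1
      by_cases h2 : b = a
      · subst h2; simp
      · simp [h2]
    · by_cases h2 : b = i
      · subst h2; simp [h1]
      · simp [h1, h2]
  simp only [e]
  rw [Finset.sum_add_distrib, Fintype.sum_prod_type, Fintype.sum_prod_type_right]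
  simp only [Finset.sum_ite_irrel, Finset.sum_const_zero, Finset.sum_ite_eq', Finset.mem_univ, if_true]
  rw [← Finset.sum_add_distrib, Finset.mul_sum, ← Finset.add_sum_erase _ _ (Finset.mem_univ i)]
  simp only [lt_irrefl, if_false, zero_add]
  refine Finset.sum_congr rfl fun j hj => ?_
  have hj' := Finset.ne_of_mem_erase hj
  rcases lt_or_gt_of_ne hj' with h | h
  · simp [h, h.le, mul_comm]
  · simp [h, h.le]

/-- SK couplings on the upper triangle. -/
def skA {N : ℕ} (β : ℝ) (p : Fin N × Fin N) (s : Fin N → Bool) : ℝ :=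
  if p.1 < p.2 then β * (spin (s p.1) * spin (s p.2)) else if p.1 = p.2 then β / 2 else 0

/-- partial overlap -/
def rest {N : ℕ} (i : Fin N) (y : Fin N → ℝ) : ℝ := ∑ j ∈ Finset.univ.erase i, y j

lemma rest_add {N : ℕ} (i : Fin N) (y : Fin N → ℝ) : rest i y + y i = ∑ j, y j := by
  unfold rest; rw [add_comm, Finset.add_sum_erase _ _ (Finset.mem_univ i)]

lemma abs_rest_le {N : ℕ} (i : Fin N) (y : Fin N → ℝ) {K : ℝ} (hy : ∀ j, |y j| ≤ K) : |rest i y| ≤ ((N : ℝ) - 1) * K := by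
  unfold rest
  refine (Finset.abs_sum_le_sum_abs _ _).trans ?_
  refine (Finset.sum_le_card_nsmul _ _ K fun j _ => hy j).trans (le_of_eq ?_)
  have : 1 ≤ N := by have := i.2; omega
  rw [nsmul_eq_mul, Finset.card_erase_of_mem (Finset.mem_univ i), Finset.card_univ, Fintype.card_fin]
  push_cast [this]; ring

/-- cavity average -/
def cav {N : ℕ} (i : Fin N) (t : ℝ) (y : Fin N → ℝ) : ℝ := (rest i y + t * y i) / N

lemma abs_cav_le {N : ℕ} (i : Fin N) (y : Fin N → ℝ) {K t : ℝ} (hy : ∀ j, |y j| ≤ K) (ht : |t| ≤ 1) : |cav i t y| ≤ K := by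
  have hN : (0:ℝ) < N := by have := i.2; exact_mod_cast (by omega : 0 < N)
  unfold cav
  rw [abs_div, abs_of_pos hN, div_le_iff₀ hN]
  refine (abs_add_le _ _).trans ?_
  have h1 := abs_rest_le i y hy
  have h2 : |t * y i| ≤ K := by
    rw [abs_mul]
    exact (mul_le_of_le_one_left (abs_nonneg _) ht).trans (hy i)
  linarith

lemma cav_one {N : ℕ} (i : Fin N) (y : Fin N → ℝ) : cav i 1 y = (∑ j, y j) / N := by
  unfold cav; rw [one_mul, rest_add]

lemma hasDerivAt_cav {N : ℕ} (i : Fin N) (y : Fin N → ℝ) (θ : ℝ) :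
    HasDerivAt (fun θ => cav i (Real.sin θ) y) (Real.cos θ * y i / N) θ :=
  ((((Real.hasDerivAt_sin θ).mul_const (y i)).const_add _).div_const _)

/-- Cavity path data for the SK model. -/
def skPath {N : ℕ} (β h q : ℝ) (hq0 : 0 ≤ q) (hq1 : q ≤ 1) (i : Fin N) (p0 : Fin N × Fin N) (hp : p0.2 < p0.1) :
    PathData (Fin N → Bool) (Fin N × Fin N) where
  τ p := if p.1 = p.2 then 2 / N else 1 / N
  H0 s := h * ∑ j, spin (s j)
  a p s := if p = p0 then β * Real.sqrt (q * N) * spin (s i) else skA β p s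
  c p θ := if p = p0 then Real.cos θ else if p.1 < p.2 ∧ (p.1 = i ∨ p.2 = i) then Real.sin θ else 1
  c' p θ := if p = p0 then - Real.sin θ else if p.1 < p.2 ∧ (p.1 = i ∨ p.2 = i) then Real.cos θ else 0
  d θ s t := cav i (Real.sin θ) (fun j => spin (s j) * spin (t j)) - q
  d' θ s t := Real.cos θ * (spin (s i) * spin (t i)) / N
  D s t := β ^ 2 * (spin (s i) * spin (t i)) * (rest i (fun j => spin (s j) * spin (t j)) / N - q)
  σ θ := Real.sin θ * Real.cos θ
  r := Real.sqrt N
  κ := β ^ 2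
  D0 := β ^ 2 * (((N : ℝ) - 1) / N - q)
  K := 1 + |β| * Real.sqrt (q * N) + |β|
  hr := by
    have : (1:ℝ) ≤ N := by have := i.2; exact_mod_cast (by omega : 1 ≤ N)
    exact Real.one_le_sqrt.2 this
  hκ := sq_nonneg β
  hc p θ := by
    by_cases h1 : p = p0
    · simpa [h1] using Real.hasDerivAt_cos θ
    · by_cases h2 : p.1 < p.2 ∧ (p.1 = i ∨ p.2 = i)
      · simpa only [h1, h2, if_false, if_true, and_self] using Real.hasDerivAt_sin θ
      · simpa only [h1, h2, if_false] using hasDerivAt_const θ (1:ℝ)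
  hd s t θ := (hasDerivAt_cav i _ θ).sub_const q
  bc' p θ := by
    have h1 : 0 ≤ |β| * Real.sqrt (q * N) := by positivity
    have h2 : 0 ≤ |β| := by positivity
    have h3 := Real.abs_sin_le_one θ
    have h4 := Real.abs_cos_le_one θ
    split_ifs
    · rw [abs_neg]; linarith
    · linarith
    · simp only [abs_zero]; linarith
  ba p s := by
    have h1 : 0 ≤ |β| * Real.sqrt (q * N) := by positivity
    have h2 : 0 ≤ |β| := by positivity
    unfold skA
    split_ifs
    · rw [abs_mul, abs_spin, abs_mul, abs_of_nonneg (Real.sqrt_nonneg _)]; linarith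
    · rw [abs_mul, abs_mul, abs_spin, abs_spin]; linarith
    · rw [abs_div, abs_two]; linarith
    · simp only [abs_zero]; linarith
  bd θ s t := by
    have h1 := abs_cav_le i (fun j => spin (s j) * spin (t j)) (K := 1) (fun j => by rw [abs_mul, abs_spin, abs_spin, one_mul])
      (Real.abs_sin_le_one θ)
    rw [abs_le] at h1 ⊢
    constructor <;> linarith
  bd' θ s t := by
    rw [Real.sq_sqrt (Nat.cast_nonneg N), abs_div, abs_mul, abs_mul, abs_spin, abs_spin, Nat.abs_cast, div_eq_mul_inv]
    have := Real.abs_cos_le_one θ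
    refine mul_le_of_le_one_left (by positivity) (by linarith)
  hσ θ := by
    rw [abs_mul]
    exact mul_le_one₀ (Real.abs_sin_le_one θ) (abs_nonneg _) (Real.abs_cos_le_one θ)
  hcov θ s t := by
    have hN : (0:ℝ) < N := by have := i.2; exact_mod_cast (by omega : 0 < N)
    have e : ∀ p : Fin N × Fin N, (((if p.1 = p.2 then 2 / N else 1 / N : NNReal) : ℝ) *
        ((if p = p0 then Real.cos θ else if p.1 < p.2 ∧ (p.1 = i ∨ p.2 = i) then Real.sin θ else 1) *
          (if p = p0 then - Real.sin θ else if p.1 < p.2 ∧ (p.1 = i ∨ p.2 = i) then Real.cos θ else 0)) *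
        ((if p = p0 then β * Real.sqrt (q * N) * spin (s i) else skA β p s) *
          (if p = p0 then β * Real.sqrt (q * N) * spin (t i) else skA β p t)))
        = (if p = p0 then - (Real.sin θ * Real.cos θ * β ^ 2 * q * (spin (s i) * spin (t i))) else 0)
          + (Real.sin θ * Real.cos θ * β ^ 2 / N) * (if p.1 < p.2 ∧ (p.1 = i ∨ p.2 = i) then
            (spin (s p.1) * spin (t p.1)) * (spin (s p.2) * spin (t p.2)) else 0) := by
      intro p
      by_cases h1 : p = p0
      · subst h1
        have h3 : ¬ p.1 < p.2 := not_lt.2 hp.le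
        have h4 : ¬ p.1 = p.2 := hp.ne'
        have h5 := Real.sq_sqrt (by positivity : 0 ≤ q * N)
        simp only [h3, h4, if_true, if_false, false_and, mul_zero, add_zero]
        push_cast
        calc _ = - (Real.sin θ * Real.cos θ * β ^ 2 * (spin (s i) * spin (t i))) * (Real.sqrt (q * N) ^ 2 / N) := by ring
          _ = _ := by rw [h5]; field_simp
      · by_cases h2 : p.1 < p.2 ∧ (p.1 = i ∨ p.2 = i)
        · have h4 : ¬ p.1 = p.2 := h2.1.ne
          simp only [h1, h2, h4, if_true, if_false, skA, zero_add, and_self]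
          push_cast
          ring
        · simp only [h1, h2, if_false]; ring
    rw [Finset.sum_congr rfl fun p _ => e p, Finset.sum_add_distrib, ← Finset.mul_sum,
      sum_star i (fun j => spin (s j) * spin (t j))]
    simp only [Finset.sum_ite_eq', Finset.mem_univ, if_true]
    unfold rest
    ring
  hD0 s := by
    have hN : 1 ≤ N := by have := i.2; omega
    simp only [spin_mul_self, rest, Finset.sum_const, Finset.card_erase_of_mem (Finset.mem_univ i), Finset.card_univ,
      Fintype.card_fin, nsmul_eq_mul, mul_one]
    push_cast [hN]; ring
  hDs s t := by simp only [mul_comm (spin (s _))]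
  hD θ s t := by
    have hN : (0:ℝ) < N := by have := i.2; exact_mod_cast (by omega : 0 < N)
    rw [Real.sq_sqrt (Nat.cast_nonneg N), abs_mul, abs_mul, abs_mul, abs_spin, abs_spin, abs_of_nonneg (sq_nonneg β)]
    have e : rest i (fun j => spin (s j) * spin (t j)) / N - q
      = (cav i (Real.sin θ) (fun j => spin (s j) * spin (t j)) - q) - Real.sin θ * (spin (s i) * spin (t i)) * (N:ℝ)⁻¹ := by
      unfold cav; field_simp; ring
    rw [mul_one, mul_one]
    gcongr
    rw [e]
    refine (abs_sub _ _).trans ?_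
    gcongr
    rw [abs_mul, abs_mul, abs_mul, abs_spin, abs_spin, abs_of_pos (inv_pos.2 hN)]
    have := Real.abs_sin_le_one θ
    exact mul_le_of_le_one_left (by positivity) (by linarith)
end

section
/-- spin flip at `i` -/
def flp {N : ℕ} (i : Fin N) (s : Fin N → Bool) : Fin N → Bool := Function.update s i (!(s i))

lemma flp_flp {N : ℕ} (i : Fin N) (s : Fin N → Bool) : flp i (flp i s) = s := by
  funext j
  by_cases h : j = i
  · subst h; simp [flp]
  · simp [flp, h]

lemma flp_same {N : ℕ} (i : Fin N) (s : Fin N → Bool) : spin (flp i s i) = - spin (s i) := by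
  simp [flp, spin_not]

lemma flp_ne {N : ℕ} {i j : Fin N} (h : j ≠ i) (s : Fin N → Bool) : flp i s j = s j := by
  simp [flp, h]

lemma sum_flp {N : ℕ} (i : Fin N) (G : (Fin N → Bool) → ℝ) : ∑ s, G s = ∑ s, (G s + G (flp i s)) / 2 := by
  have e : ∑ s, G (flp i s) = ∑ s, G s :=
    Equiv.sum_comp (Function.Involutive.toPerm (flp i) (flp_flp i)) G
  rw [← Finset.sum_div, Finset.sum_add_distrib, e]; ring

lemma spin_exp_add (b : Bool) (c : ℝ) : (Real.exp (c * spin b) + Real.exp (c * - spin b)) / 2 = Real.cosh c := by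
  cases b <;> simp [spin, Real.cosh_eq, add_comm]

lemma spin_exp_sub (b : Bool) (c : ℝ) : (spin b * Real.exp (c * spin b) + - spin b * Real.exp (c * - spin b)) / 2 = Real.sinh c := by
  cases b <;> simp [spin, Real.sinh_eq] <;> ring

lemma flip_sum1 {N : ℕ} (i : Fin N) {L L' : (Fin N → Bool) → ℝ} {c : ℝ} (hL : ∀ s, L s = c * spin (s i) + L' s)
    (hL' : ∀ s, L' (flp i s) = L' s) {F : (Fin N → Bool) → ℝ} (hF : ∀ s, F (flp i s) = F s) :
    ∑ s, F s * Real.exp (L s) = Real.cosh c * ∑ s, F s * Real.exp (L' s) := by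
  rw [sum_flp i, Finset.mul_sum]
  refine Finset.sum_congr rfl fun s _ => ?_
  rw [hF, hL, hL, hL', flp_same, Real.exp_add, Real.exp_add, ← spin_exp_add (s i) c]
  ring

lemma flip_sum2 {N : ℕ} (i : Fin N) {L L' : (Fin N → Bool) → ℝ} {c : ℝ} (hL : ∀ s, L s = c * spin (s i) + L' s)
    (hL' : ∀ s, L' (flp i s) = L' s) {F : (Fin N → Bool) → ℝ} (hF : ∀ s, F (flp i s) = F s) :
    ∑ s, spin (s i) * F s * Real.exp (L s) = Real.sinh c * ∑ s, F s * Real.exp (L' s) := by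
  rw [sum_flp i, Finset.mul_sum]
  refine Finset.sum_congr rfl fun s _ => ?_
  rw [hF, hL, hL, hL', flp_same, Real.exp_add, Real.exp_add, ← spin_exp_sub (s i) c]
  ring

lemma flip_gav1 {N : ℕ} (i : Fin N) {L L' : (Fin N → Bool) → ℝ} {c : ℝ} (hL : ∀ s, L s = c * spin (s i) + L' s)
    (hL' : ∀ s, L' (flp i s) = L' s) {F : (Fin N → Bool) → ℝ} (hF : ∀ s, F (flp i s) = F s) :
    gav L F = gav L' F := by
  unfold gav
  have h1 := flip_sum1 i hL hL' (F := fun _ => 1) (fun _ => rfl)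
  simp only [one_mul] at h1
  rw [flip_sum1 i hL hL' hF, h1, mul_div_mul_left _ _ (Real.cosh_pos c).ne']

lemma flip_gav2 {N : ℕ} (i : Fin N) {L L' : (Fin N → Bool) → ℝ} {c : ℝ} (hL : ∀ s, L s = c * spin (s i) + L' s)
    (hL' : ∀ s, L' (flp i s) = L' s) {F : (Fin N → Bool) → ℝ} (hF : ∀ s, F (flp i s) = F s) (m : ℝ) :
    gav L (fun s => (spin (s i) - m) * F s) = (Real.tanh c - m) * gav L' F := by
  have e : gav L (fun s => spin (s i) * F s) = Real.tanh c * gav L' F := by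
    unfold gav
    have h1 := flip_sum1 i hL hL' (F := fun _ => 1) (fun _ => rfl)
    simp only [one_mul] at h1
    rw [flip_sum2 i hL hL' hF, h1, mul_div_mul_comm, ← Real.tanh_eq_sinh_div_cosh]
  simp only [sub_mul]
  rw [gav_sub, gav_mul_left, e, flip_gav1 i hL hL' hF]

lemma flip_VV {N : ℕ} (i : Fin N) {L L' : (Fin N → Bool) → ℝ} {c : ℝ} (hL : ∀ s, L s = c * spin (s i) + L' s)
    (hL' : ∀ s, L' (flp i s) = L' s) {y : (Fin N → Bool) → (Fin N → Bool) → ℝ} (h1 : ∀ s t, y (flp i s) t = y s t)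
    (h2 : ∀ s t, y s (flp i t) = y s t) :
    VV L y = VV L' y := by
  unfold VV
  have e : ∀ s, gav L (fun t => Real.exp (y s t)) = gav L' (fun t => Real.exp (y s t)) := fun s =>
    flip_gav1 i hL hL' fun t => by rw [h2]
  simp only [e]
  exact flip_gav1 i hL hL' fun s => by simp only [h1]


lemma abs_tanh_le (x : ℝ) : |Real.tanh x| ≤ 1 := (Real.abs_tanh_lt_one x).le

lemma cont_tanh : Continuous Real.tanh := by
  have : Real.tanh = fun x => Real.sinh x / Real.cosh x := by funext x; exact Real.tanh_eq_sinh_div_cosh x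
  rw [this]
  exact Real.continuous_sinh.div Real.continuous_cosh fun x => (Real.cosh_pos x).ne'

lemma integral_tanh_scale (N : ℕ) (hN : 1 ≤ N) (β h q : ℝ) (hq : 0 ≤ q) :
    ∫ r, Real.tanh (β * Real.sqrt (q * N) * r + h) ∂(gaussianReal 0 (1 / N))
      = ∫ g, Real.tanh (β * g * Real.sqrt q + h) ∂stdGaussian := by
  have hN0 : (0:ℝ) < N := by exact_mod_cast hN
  have e : gaussianReal 0 (1 / N) = stdGaussian.map (fun g => (Real.sqrt N)⁻¹ * g) := by
    unfold _root_.stdGaussian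
    rw [gaussianReal_map_const_mul]
    congr 1
    · simp
    · ext
      push_cast
      simp [inv_pow, Real.sq_sqrt hN0.le]
  have cont : Continuous fun r => Real.tanh (β * Real.sqrt (q * N) * r + h) :=
    cont_tanh.comp (by fun_prop)
  rw [e, integral_map (by fun_prop) cont.aestronglyMeasurable]
  congr 1; ext g
  congr 2
  rw [Real.sqrt_mul hq]
  have := Real.sqrt_pos.2 hN0
  field_simp
end

section
/-- decoupled Hamiltonian -/
def skL' {N : ℕ} (β h : ℝ) (i : Fin N) (p0 : Fin N × Fin N) (x : Fin N × Fin N → ℝ) (s : Fin N → Bool) : ℝ :=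
  h * rest i (fun j => spin (s j)) +
    ∑ p, (if p = p0 ∨ (p.1 < p.2 ∧ (p.1 = i ∨ p.2 = i)) then 0 else skA β p s * x p)

lemma rest_congr {N : ℕ} (i : Fin N) {y z : Fin N → ℝ} (h : ∀ j, j ≠ i → y j = z j) : rest i y = rest i z := by
  unfold rest
  exact Finset.sum_congr rfl fun j hj => h j (Finset.ne_of_mem_erase hj)

lemma skL'_flp {N : ℕ} (β h : ℝ) (i : Fin N) (p0 : Fin N × Fin N) (x : Fin N × Fin N → ℝ) (s : Fin N → Bool) :
    skL' β h i p0 x (flp i s) = skL' β h i p0 x s := by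
  unfold skL'
  congr 1
  · rw [rest_congr i fun j hj => by rw [flp_ne hj]]
  · refine Finset.sum_congr rfl fun p _ => ?_
    split_ifs with h1
    · rfl
    · congr 1
      unfold skA
      split_ifs with h2
      · push Not at h1
        have := h1.2 h2
        rw [flp_ne this.1, flp_ne this.2]
      · rfl
      · rfl

lemma skL'_update {N : ℕ} (β h : ℝ) (i : Fin N) (p0 : Fin N × Fin N) (x : Fin N × Fin N → ℝ) (r : ℝ) :
    skL' β h i p0 (Function.update x p0 r) = skL' β h i p0 x := by
  funext s
  unfold skL'
  congr 1
  refine Finset.sum_congr rfl fun p _ => ?_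
  split_ifs with h1
  · rfl
  · push Not at h1
    rw [Function.update_of_ne h1.1]

lemma skPath_ell_zero {N : ℕ} (β h q : ℝ) (hq0 : 0 ≤ q) (hq1 : q ≤ 1) (i : Fin N) (p0 : Fin N × Fin N) (hp : p0.2 < p0.1)
    (x : Fin N × Fin N → ℝ) (s : Fin N → Bool) :
    (skPath β h q hq0 hq1 i p0 hp).ell 0 x s
      = (β * Real.sqrt (q * N) * x p0 + h) * spin (s i) + skL' β h i p0 x s := by
  unfold PathData.ell aff skPath skL'
  simp only [Real.cos_zero, Real.sin_zero]
  have e : ∀ p : Fin N × Fin N, (if p = p0 then (1:ℝ) else if p.1 < p.2 ∧ (p.1 = i ∨ p.2 = i) then 0 else 1) *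
      (if p = p0 then β * Real.sqrt (q * N) * spin (s i) else skA β p s) * x p
      = (if p = p0 then β * Real.sqrt (q * N) * spin (s i) * x p0 else 0)
        + (if p = p0 ∨ (p.1 < p.2 ∧ (p.1 = i ∨ p.2 = i)) then 0 else skA β p s * x p) := by
    intro p
    by_cases h1 : p = p0
    · subst h1; simp
    · by_cases h2 : p.1 < p.2 ∧ (p.1 = i ∨ p.2 = i)
      · simp only [h1, h2, if_false, if_true, and_self, or_true]; simp
      · simp only [h1, h2, if_false, or_self]; ring
  rw [Finset.sum_congr rfl fun p _ => e p, Finset.sum_add_distrib, ← rest_add i fun j => spin (s j)]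
  simp only [Finset.sum_ite_eq', Finset.mem_univ, if_true]
  ring

/-- cavity observable -/
def Sc {N : ℕ} (m : ℝ) (i : Fin N) (θ : ℝ) (s : Fin N → Bool) : ℝ := cav i (Real.sin θ) fun j => spin (s j) - m

/-- the test function -/
def fc {N : ℕ} (n : ℕ) (m : ℝ) (i : Fin N) (θ : ℝ) (s : Fin N → Bool) : ℝ := (spin (s i) - m) * Sc m i θ s ^ (n - 1)

lemma cav_zero_congr {N : ℕ} (i : Fin N) {y z : Fin N → ℝ} (h : ∀ j, j ≠ i → y j = z j) : cav i 0 y = cav i 0 z := by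
  unfold cav; rw [rest_congr i h]; simp

lemma skPath_J_zero {N : ℕ} (β h q : ℝ) (hq0 : 0 ≤ q) (hq1 : q ≤ 1) (i : Fin N) (p0 : Fin N × Fin N) (hp : p0.2 < p0.1)
    (n : ℕ) (v0 : ℝ) (hv0 : 0 ≤ v0) (hv1 : v0 ≤ 1) (m : ℝ)
    (hm : m = ∫ g, Real.tanh (β * g * Real.sqrt q + h) ∂stdGaussian) {Kf : ℝ} (bf : ∀ θ s, |fc n m i θ s| ≤ Kf) :
    (skPath β h q hq0 hq1 i p0 hp).J n v0 (fc n m i) 0 = 0 := by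
  have hN : 1 ≤ N := by have := i.2; omega
  set X := skPath β h q hq0 hq1 i p0 hp with hX
  unfold PathData.J
  have key : ∀ v ∈ Set.uIcc 0 v0, ∫ x, v ^ n * X.rat (fc n m i) 0 v x ∂X.π = 0 := by
    intro v hv
    rw [Set.uIcc_of_le hv0] at hv
    set Q : (Fin N × Fin N → ℝ) → ℝ := fun x =>
      gav (skL' β h i p0 x) (fun s => Sc m i 0 s ^ (n - 1)) / VV (skL' β h i p0 x) (X.yv 0 v) with hQ
    have er : ∀ x, X.rat (fc n m i) 0 v x = (Real.tanh (β * Real.sqrt (q * N) * x p0 + h) - m) * Q x := by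
      intro x
      unfold PathData.rat
      have hL := skPath_ell_zero β h q hq0 hq1 i p0 hp x
      have hL' := skL'_flp β h i p0 x
      have e1 : gav (X.ell 0 x) (fc n m i 0) = _ := flip_gav2 i hL hL' (F := fun s => Sc m i 0 s ^ (n - 1))
        (fun s => by
          unfold Sc; rw [Real.sin_zero]
          rw [cav_zero_congr i fun j hj => by rw [flp_ne hj]]) m
      have e2 : VV (X.ell 0 x) (X.yv 0 v) = VV (skL' β h i p0 x) (X.yv 0 v) := flip_VV i hL hL'
        (fun s t => by
          simp only [PathData.yv, hX, skPath]; rw [Real.sin_zero]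
          rw [cav_zero_congr i fun j hj => by rw [flp_ne hj]])
        (fun s t => by
          simp only [PathData.yv, hX, skPath]; rw [Real.sin_zero]
          rw [cav_zero_congr i fun j hj => by rw [flp_ne hj]])
      rw [e1, e2]
      simp only [hQ]
      ring
    have int : Integrable (fun x => v ^ n * X.rat (fc n m i) 0 v x) X.π :=
      vx_int_G X.π (X.cont_rat (fc n m i) 0 n) (v0 := v0)
        (fun v x h0 h1 => PathData.abs_pow_mul_le n h0 (h1.trans hv1) (X.rat_bd bf 0 v x)) hv.1 hv.2
    have hu := integral_update (fun p => gaussianReal 0 (X.τ p)) p0 _ int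
    rw [show X.π = Measure.pi fun p => gaussianReal 0 (X.τ p) from rfl]
    rw [hu]
    have hτ : X.τ p0 = 1 / N := by
      simp only [hX, skPath]; rw [if_neg hp.ne']
    have hQu : ∀ x r, Q (Function.update x p0 r) = Q x := by
      intro x r; simp only [hQ]; rw [skL'_update]
    have hz : ∀ x, ∫ r, v ^ n * X.rat (fc n m i) 0 v (Function.update x p0 r) ∂(gaussianReal 0 (X.τ p0)) = 0 := by
      intro x
      simp only [er, hQu, Function.update_self]
      rw [hτ, integral_const_mul, integral_mul_const]
      have ct : Continuous fun r => Real.tanh (β * Real.sqrt (q * N) * r + h) := cont_tanh.comp (by fun_prop)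
      have it : Integrable (fun r => Real.tanh (β * Real.sqrt (q * N) * r + h)) (gaussianReal 0 (1 / N)) :=
        Integrable.of_bound ct.aestronglyMeasurable 1 (Filter.Eventually.of_forall fun r => abs_tanh_le _)
      rw [integral_sub it (integrable_const _), integral_tanh_scale N hN β h q hq0, ← hm]
      simp
    simp [hz]
  rw [intervalIntegral.integral_congr key]
  simp
end

section
lemma hasDerivAt_Sc {N : ℕ} (m : ℝ) (i : Fin N) (s : Fin N → Bool) (θ : ℝ) :
    HasDerivAt (fun θ => Sc m i θ s) (Real.cos θ * (spin (s i) - m) / N) θ :=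
  hasDerivAt_cav i (fun j => spin (s j) - m) θ

lemma abs_spin_sub_le {m : ℝ} (hm : |m| ≤ 1) (b : Bool) : |spin b - m| ≤ 2 := by
  refine (abs_sub _ _).trans ?_
  rw [abs_spin]; linarith

lemma abs_Sc_le {N : ℕ} {m : ℝ} (hm : |m| ≤ 1) (i : Fin N) (θ : ℝ) (s : Fin N → Bool) : |Sc m i θ s| ≤ 2 :=
  abs_cav_le i _ (fun j => abs_spin_sub_le hm (s j)) (Real.abs_sin_le_one θ)

lemma sk_main {N : ℕ} (β h q : ℝ) (hq0 : 0 ≤ q) (hq1 : q ≤ 1) (i : Fin N) (p0 : Fin N × Fin N) (hp : p0.2 < p0.1)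
    {n : ℕ} (hn : 2 ≤ n) (hne : Even n) {v0 : ℝ} (hv0 : 0 ≤ v0) (hv1 : v0 ≤ 1) {m : ℝ} (hm1 : |m| ≤ 1)
    (hm : m = ∫ g, Real.tanh (β * g * Real.sqrt q + h) ∂stdGaussian) {ε : ℝ} (hε : 0 < ε) (hε1 : ε ≤ 1)
    {A : ℝ} (hA : 0 ≤ A) :
    |(skPath β h q hq0 hq1 i p0 hp).J n v0 (fc n m i) A| ≤ PathData.K1 (β ^ 2) n *
      (ε * (Real.exp (PathData.Kc (β ^ 2) n * A) * ((skPath β h q hq0 hq1 i p0 hp).J n v0 (fun θ s => Sc m i θ s ^ n) A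
        + ((Real.sqrt N)⁻¹) ^ n)) + (ε⁻¹) ^ (n - 1) * ((Real.sqrt N)⁻¹) ^ n) * A := by
  have hN1 : (1:ℝ) ≤ N := by have := i.2; exact_mod_cast (by omega : 1 ≤ N)
  have hN : (0:ℝ) < N := by linarith
  have hNi : (N:ℝ)⁻¹ ≤ 1 := inv_le_one_of_one_le₀ hN1
  have hn1 : (1:ℝ) ≤ n := by exact_mod_cast (by omega : 1 ≤ n)
  set X := skPath β h q hq0 hq1 i p0 hp with hX
  have hr : (X.r ^ 2)⁻¹ = (N:ℝ)⁻¹ := by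
    change ((Real.sqrt N) ^ 2)⁻¹ = _
    rw [Real.sq_sqrt hN.le]
  have hP : ∀ k ≤ n, ∀ θ s, |Sc m i θ s| ^ k ≤ 2 ^ n := by
    intro k hk θ s
    calc |Sc m i θ s| ^ k ≤ 2 ^ k := by gcongr; exact abs_Sc_le hm1 i θ s
      _ ≤ 2 ^ n := pow_le_pow_right₀ (by norm_num) hk
  have hdS : ∀ (θ : ℝ) (s : Fin N → Bool), |Real.cos θ * (spin (s i) - m) / N| ≤ 2 * (N:ℝ)⁻¹ := by
    intro θ s
    rw [abs_div, abs_mul, Nat.abs_cast, div_eq_mul_inv]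
    have h1 := abs_spin_sub_le hm1 (s i)
    have h2 := Real.abs_cos_le_one θ
    have h3 : |Real.cos θ| * |spin (s i) - m| ≤ 1 * 2 := by gcongr
    rw [one_mul] at h3
    gcongr
  have hb' : ∀ (θ : ℝ) (s : Fin N → Bool), |(n:ℝ) * Sc m i θ s ^ (n - 1) * (Real.cos θ * (spin (s i) - m) / N)|
      ≤ 2 * n * (|Sc m i θ s| ^ (n - 1) * (X.r ^ 2)⁻¹) := by
    intro θ s
    rw [abs_mul, abs_mul, Nat.abs_cast, abs_pow, hr]
    have := hdS θ s
    calc _ ≤ (n:ℝ) * |Sc m i θ s| ^ (n - 1) * (2 * (N:ℝ)⁻¹) := by gcongr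
      _ = _ := by ring
  have hf : ∀ θ s, |fc n m i θ s| ≤ 2 * |Sc m i θ s| ^ (n - 1) := by
    intro θ s
    unfold fc
    rw [abs_mul, abs_pow]
    have h1 := abs_spin_sub_le hm1 (s i)
    gcongr
  have hf' : ∀ (θ : ℝ) (s : Fin N → Bool), |(spin (s i) - m) * (((n - 1 : ℕ) : ℝ) * Sc m i θ s ^ (n - 1 - 1) * (Real.cos θ * (spin (s i) - m) / N))|
      ≤ 4 * n * (|Sc m i θ s| ^ (n - 2) * (X.r ^ 2)⁻¹) := by
    intro θ s
    rw [abs_mul, abs_mul, abs_mul, Nat.abs_cast, abs_pow, hr, show n - 1 - 1 = n - 2 by omega]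
    have h1 := abs_spin_sub_le hm1 (s i)
    have := hdS θ s
    have hn' : ((n - 1 : ℕ) : ℝ) ≤ n := by exact_mod_cast Nat.sub_le n 1
    calc _ ≤ 2 * ((n:ℝ) * |Sc m i θ s| ^ (n - 2) * (2 * (N:ℝ)⁻¹)) := by gcongr
      _ = _ := by ring
  have big : ∀ z : ℝ, z ≤ 2 ^ n → z ≤ 4 * n * 2 ^ n := by
    intro z hz
    have : (0:ℝ) < 2 ^ n := by positivity
    nlinarith
  have bf : ∀ θ s, |fc n m i θ s| ≤ 4 * n * 2 ^ n := by
    intro θ s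
    refine (hf θ s).trans ?_
    have h1 := hP (n - 1) (by omega) θ s
    calc 2 * |Sc m i θ s| ^ (n - 1) ≤ 2 * 2 ^ n := by gcongr
      _ ≤ 4 * n * 2 ^ n := by gcongr; linarith
  have h0 : X.J n v0 (fc n m i) 0 = 0 := skPath_J_zero β h q hq0 hq1 i p0 hp n v0 hv0 hv1 m hm bf
  have main := X.path_main hn hv0 hv1 (g := fun θ s => |Sc m i θ s|) (b := fun θ s => Sc m i θ s ^ n)
    (b' := fun θ s => (n:ℝ) * Sc m i θ s ^ (n - 1) * (Real.cos θ * (spin (s i) - m) / N)) (f := fc n m i)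
    (f' := fun θ s => (spin (s i) - m) * (((n - 1 : ℕ) : ℝ) * Sc m i θ s ^ (n - 1 - 1) * (Real.cos θ * (spin (s i) - m) / N)))
    (Kf := 4 * n * 2 ^ n)
    (fun θ s => big _ (by rw [abs_pow]; exact hP n le_rfl θ s))
    (fun θ s => (hb' θ s).trans (by
      rw [hr]
      have h1 := hP (n - 1) (by omega) θ s
      calc _ ≤ 2 * (n:ℝ) * (2 ^ n * 1) := by gcongr
        _ ≤ _ := by
          have : (0:ℝ) < 2 ^ n := by positivity
          nlinarith))
    (fun θ s => (hne.pow_abs _).symm) (fun θ s => abs_nonneg _)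
    (fun s θ => (hasDerivAt_Sc m i s θ).fun_pow n) hb' bf
    (fun θ s => (hf' θ s).trans (by
      rw [hr]
      have h1 := hP (n - 2) (by omega) θ s
      calc _ ≤ 4 * (n:ℝ) * (2 ^ n * 1) := by gcongr
        _ ≤ _ := by rw [mul_one]))
    (fun s θ => ((hasDerivAt_Sc m i s θ).fun_pow (n - 1)).const_mul _) hf hf' hε hε1 hA
  rw [h0, sub_zero] at main
  exact main

namespace PathData
variable {S P : Type} [Fintype S] [Nonempty S] [Fintype P] [DecidableEq P] (X : PathData S P)

lemma J_sum {ι : Type} (I : Finset ι) (n : ℕ) {v0 : ℝ} (hv0 : 0 ≤ v0) (hv1 : v0 ≤ 1) (F : ι → ℝ → S → ℝ) {Kf : ℝ}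
    (bf : ∀ i θ s, |F i θ s| ≤ Kf) (θ : ℝ) :
    X.J n v0 (fun θ s => ∑ i ∈ I, F i θ s) θ = ∑ i ∈ I, X.J n v0 (F i) θ := by
  have b : ∀ i v x, 0 ≤ v → v ≤ v0 → |v ^ n * X.rat (F i) θ v x| ≤ Kf := fun i v x h0 h1 =>
    abs_pow_mul_le n h0 (h1.trans hv1) (X.rat_bd (bf i) θ v x)
  unfold J
  rw [← intervalIntegral.integral_finsetSum fun i _ => vx_int_v X.π (X.cont_rat (F i) θ n) hv0 (b i)]
  refine intervalIntegral.integral_congr fun v hv => ?_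
  rw [Set.uIcc_of_le hv0] at hv
  rw [← integral_finsetSum _ fun i _ => vx_int_G X.π (X.cont_rat (F i) θ n) (b i) hv.1 hv.2]
  congr 1; ext x
  unfold rat
  rw [gav_sum, Finset.sum_div, Finset.mul_sum]

lemma J_mul (n : ℕ) (v0 : ℝ) (F : ℝ → S → ℝ) (c : ℝ) (θ : ℝ) :
    X.J n v0 (fun θ s => c * F θ s) θ = c * X.J n v0 F θ := by
  unfold J
  rw [← intervalIntegral.integral_const_mul]
  congr 1; ext v
  rw [← integral_const_mul]
  congr 1; ext x
  unfold rat
  rw [gav_mul_left]; ring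

end PathData

/-- SK Hamiltonian as function of upper-triangular disorder -/
def skL {N : ℕ} (β h : ℝ) (x : Fin N × Fin N → ℝ) (s : Fin N → Bool) : ℝ :=
  h * (∑ j, spin (s j)) + ∑ p, skA β p s * x p

/-- overlap tilt -/
def skY {N : ℕ} (q v : ℝ) (s t : Fin N → Bool) : ℝ := (Real.sqrt N * v) ^ 2 * (overlap s t - q) ^ 2

/-- disorder -/
def skPi (N : ℕ) : Measure (Fin N × Fin N → ℝ) :=
  Measure.pi fun p => gaussianReal 0 (if p.1 = p.2 then 2 / N else 1 / N)

instance (N : ℕ) : IsProbabilityMeasure (skPi N) := by unfold skPi; infer_instance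

/-- integrated observable at the SK end of the path -/
def JJ {N : ℕ} (β h q : ℝ) (n : ℕ) (v0 : ℝ) (F : (Fin N → Bool) → ℝ) : ℝ :=
  ∫ v in (0:ℝ)..v0, ∫ x, v ^ n * (gav (skL β h x) F / VV (skL β h x) (skY q v)) ∂(skPi N)

lemma skPath_ell_one {N : ℕ} (β h q : ℝ) (hq0 : 0 ≤ q) (hq1 : q ≤ 1) (i : Fin N) (p0 : Fin N × Fin N) (hp : p0.2 < p0.1)
    (x : Fin N × Fin N → ℝ) :
    (skPath β h q hq0 hq1 i p0 hp).ell (Real.pi / 2) x = skL β h x := by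
  funext s
  unfold PathData.ell aff skPath skL
  simp only [Real.cos_pi_div_two, Real.sin_pi_div_two, ite_self]
  congr 1
  refine Finset.sum_congr rfl fun p _ => ?_
  by_cases h1 : p = p0
  · subst h1
    have h3 : ¬ p.1 < p.2 := not_lt.2 hp.le
    have h4 : ¬ p.1 = p.2 := hp.ne'
    simp [skA, h3, h4]
  · simp [h1]

lemma skPath_yv_one {N : ℕ} (β h q : ℝ) (hq0 : 0 ≤ q) (hq1 : q ≤ 1) (i : Fin N) (p0 : Fin N × Fin N) (hp : p0.2 < p0.1)
    (v : ℝ) :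
    (skPath β h q hq0 hq1 i p0 hp).yv (Real.pi / 2) v = skY q v := by
  funext s t
  unfold PathData.yv skPath skY overlap
  simp only [Real.sin_pi_div_two, cav_one]

lemma skPath_J_one {N : ℕ} (β h q : ℝ) (hq0 : 0 ≤ q) (hq1 : q ≤ 1) (i : Fin N) (p0 : Fin N × Fin N) (hp : p0.2 < p0.1)
    (n : ℕ) (v0 : ℝ) (f : ℝ → (Fin N → Bool) → ℝ) :
    (skPath β h q hq0 hq1 i p0 hp).J n v0 f (Real.pi / 2) = JJ β h q n v0 (f (Real.pi / 2)) := by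
  unfold PathData.J JJ PathData.rat
  simp only [skPath_ell_one, skPath_yv_one]
  rfl

lemma Sc_one {N : ℕ} (hN : 1 ≤ N) (m : ℝ) (i : Fin N) (s : Fin N → Bool) : Sc m i (Real.pi / 2) s = overlap s (onesConf N) - m := by
  have : (0:ℝ) < N := by exact_mod_cast hN
  unfold Sc overlap onesConf
  rw [Real.sin_pi_div_two, cav_one, Finset.sum_sub_distrib]
  simp [spin]
  field_simp
end

section
/-- centred magnetization -/
def Mg {N : ℕ} (m : ℝ) (s : Fin N → Bool) : ℝ := overlap s (onesConf N) - m

lemma Mg_eq {N : ℕ} (hN : 1 ≤ N) (m : ℝ) (s : Fin N → Bool) : Mg m s = (N:ℝ)⁻¹ * ∑ i, (spin (s i) - m) := by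
  have : (0:ℝ) < N := by exact_mod_cast hN
  unfold Mg overlap onesConf
  rw [Finset.sum_sub_distrib]
  simp [spin]
  field_simp

lemma abs_Mg_le {N : ℕ} (hN : 1 ≤ N) {m : ℝ} (hm : |m| ≤ 1) (s : Fin N → Bool) : |Mg m s| ≤ 2 := by
  have := abs_Sc_le hm ⟨0, hN⟩ (Real.pi / 2) s
  rwa [Sc_one hN] at this

lemma JJ_bound (β : ℝ) {n : ℕ} (hn : 2 ≤ n) (hne : Even n) : ∃ K : ℝ, 0 ≤ K ∧ ∀ (N : ℕ) (_ : 2 ≤ N) (h q m v0 : ℝ),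
    0 ≤ q → q ≤ 1 → 0 ≤ v0 → v0 ≤ 1 → |m| ≤ 1 → m = ∫ g, Real.tanh (β * g * Real.sqrt q + h) ∂stdGaussian →
    JJ (N := N) β h q n v0 (fun s => Mg m s ^ n) ≤ K * ((Real.sqrt N)⁻¹) ^ n := by
  have hpi := Real.pi_pos
  set a := PathData.K1 (β ^ 2) n * (Real.pi / 2) with ha
  set e := Real.exp (PathData.Kc (β ^ 2) n * (Real.pi / 2)) with he
  have ha0 : 0 ≤ a := by rw [ha]; unfold PathData.K1; positivity
  have he0 : 0 < e := Real.exp_pos _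
  set ε := (1 + 2 * a * e)⁻¹ with hε
  have hd : 1 ≤ 1 + 2 * a * e := by have := mul_nonneg ha0 he0.le; linarith
  have hε0 : 0 < ε := by rw [hε]; positivity
  have hε1 : ε ≤ 1 := inv_le_one_of_one_le₀ hd
  have hε2 : a * e * ε ≤ 1 / 2 := by
    rw [hε, ← div_eq_mul_inv, div_le_iff₀ (by linarith)]; linarith
  set c := (ε⁻¹) ^ (n - 1) with hc
  have hc0 : 0 ≤ c := by positivity
  refine ⟨1 + 2 * a * c, by positivity, ?_⟩
  intro N hN h q m v0 hq0 hq1 hv0 hv1 hm1 hm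
  have hN1 : 1 ≤ N := by omega
  have hNp : (0:ℝ) < N := by exact_mod_cast hN1
  set ρ := ((Real.sqrt N)⁻¹) ^ n with hρ
  have hρ0 : 0 ≤ ρ := by positivity
  set B := JJ (N := N) β h q n v0 (fun s => Mg m s ^ n) with hB
  let p0 : Fin N × Fin N := (⟨1, by omega⟩, ⟨0, by omega⟩)
  have hp : p0.2 < p0.1 := by simp [p0, Fin.lt_def]
  have hi : ∀ i, JJ (N := N) β h q n v0 (fun s => (spin (s i) - m) * Mg m s ^ (n - 1)) ≤ a * (ε * (e * (B + ρ)) + c * ρ) := by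
    intro i
    have h1 := sk_main β h q hq0 hq1 i p0 hp hn hne hv0 hv1 hm1 hm hε0 hε1 (A := Real.pi / 2) (by positivity)
    rw [skPath_J_one, skPath_J_one] at h1
    simp only [Sc_one hN1] at h1
    have e1 : fc n m i (Real.pi / 2) = fun s => (spin (s i) - m) * Mg m s ^ (n - 1) := by
      funext s; unfold fc; rw [Sc_one hN1]; rfl
    rw [e1] at h1
    refine (le_abs_self _).trans (h1.trans (le_of_eq ?_))
    rw [ha]
    change PathData.K1 (β ^ 2) n * (ε * (e * (B + ρ)) + c * ρ) * (Real.pi / 2) = _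
    ring
  have hS : B = (N:ℝ)⁻¹ * ∑ i, JJ (N := N) β h q n v0 (fun s => (spin (s i) - m) * Mg m s ^ (n - 1)) := by
    let X := skPath β h q hq0 hq1 (⟨0, by omega⟩ : Fin N) p0 hp
    have e1 : ∀ F : (Fin N → Bool) → ℝ, JJ (N := N) β h q n v0 F = X.J n v0 (fun _ => F) (Real.pi / 2) := fun F =>
      (skPath_J_one β h q hq0 hq1 _ p0 hp n v0 (fun _ => F)).symm
    rw [hB]
    simp only [e1]
    rw [← X.J_sum Finset.univ n hv0 hv1 (fun i _ s => (spin (s i) - m) * Mg m s ^ (n - 1)) (Kf := 2 * 2 ^ (n - 1)), ← X.J_mul]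
    · congr 1
      funext _ s
      rw [← Finset.sum_mul, ← mul_assoc, ← Mg_eq hN1, ← pow_succ', show n - 1 + 1 = n by omega]
    · intro i _ s
      rw [abs_mul, abs_pow]
      have h1 := abs_spin_sub_le hm1 (s i)
      have h2 := abs_Mg_le hN1 hm1 s
      gcongr
  have hB1 : B ≤ a * (ε * (e * (B + ρ)) + c * ρ) := by
    calc B ≤ (N:ℝ)⁻¹ * ∑ i : Fin N, a * (ε * (e * (B + ρ)) + c * ρ) := by
          rw [hS]
          gcongr with i
          rw [← hS]
          exact hi i
      _ = _ := by
          simp only [Finset.sum_const, Finset.card_univ, Fintype.card_fin, nsmul_eq_mul]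
          field_simp
  have hB0 : 0 ≤ B := by
    unfold JJ at hB
    rw [hB]
    refine intervalIntegral.integral_nonneg hv0 fun v hv => integral_nonneg fun x => ?_
    exact mul_nonneg (pow_nonneg hv.1 n) (div_nonneg (gav_nonneg _ fun s => hne.pow_nonneg _) (VV_pos _ _).le)
  have h3 : a * (ε * (e * (B + ρ))) ≤ 1 / 2 * (B + ρ) := by
    calc a * (ε * (e * (B + ρ))) = (a * e * ε) * (B + ρ) := by ring
      _ ≤ _ := by gcongr
  nlinarith

lemma qOverlap_nonneg (β h : ℝ) : 0 ≤ qOverlap β h := by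
  unfold qOverlap
  split_ifs
  · rfl
  · exact Real.sSup_nonneg fun q hq => hq.1.1.le

lemma qOverlap_le_one (β h : ℝ) : qOverlap β h ≤ 1 := by
  unfold qOverlap
  split_ifs
  · norm_num
  · exact Real.sSup_le (fun q hq => hq.1.2) zero_le_one

lemma abs_q1_le (β h : ℝ) : |q1 β h| ≤ 1 := by
  unfold q1 _root_.stdGaussian
  have := norm_integral_le_of_norm_le_const (μ := gaussianReal 0 1) (C := 1)
    (f := fun g => Real.tanh (β * g * Real.sqrt (qOverlap β h) + h)) (Filter.Eventually.of_forall fun g => abs_tanh_le _)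
  simpa using this

/-- log weight -/
def wL {N : ℕ} (β h : ℝ) (W : Matrix (Fin N) (Fin N) ℝ) (s : Fin N → Bool) : ℝ :=
  β / 2 * (∑ i, ∑ j, W i j * spin (s i) * spin (s j)) + h * ∑ i, spin (s i)

lemma integral_skGibbs {N : ℕ} (β h : ℝ) (W : Matrix (Fin N) (Fin N) ℝ) (f : (Fin N → Bool) → ℝ) :
    ∫ s, f s ∂(skGibbs W β h) = gav (wL β h W) f := by
  have hZ : 0 < skZ W β h := Finset.sum_pos (fun s _ => Real.exp_pos _) Finset.univ_nonempty
  have hd : ∀ s, 0 ≤ skDensity W β h s := fun s => div_nonneg (Real.exp_pos _).le hZ.le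
  unfold skGibbs
  rw [integral_finsetSum_measure]
  · simp only [integral_smul_measure, integral_dirac, ENNReal.toReal_ofReal (hd _), smul_eq_mul]
    unfold gav
    rw [Finset.sum_div]
    refine Finset.sum_congr rfl fun s _ => ?_
    unfold skDensity skWeight skZ skWeight wL
    ring
  · intro s _
    exact (integrable_dirac (by simp)).smul_measure ENNReal.ofReal_ne_top

/-- the symmetrization map -/
def symT {N : ℕ} (W : Fin N × Fin N → ℝ) : Matrix (Fin N) (Fin N) ℝ :=
  Matrix.of fun i j => if i ≤ j then W (i, j) else W (j, i)

lemma GOE_eq (N : ℕ) : GOE N = (skPi N).map symT := by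
  unfold GOE skPi symT
  congr 1
  congr 1
  funext p
  split_ifs <;> rfl

lemma measurable_symT {N : ℕ} : Measurable (symT (N := N)) := by
  refine measurable_pi_iff.2 fun i => measurable_pi_iff.2 fun j => ?_
  unfold symT
  simp only [Matrix.of_apply]
  split_ifs
  · exact measurable_pi_apply _
  · exact measurable_pi_apply _

lemma measurable_wL {N : ℕ} (β h : ℝ) : Measurable (wL (N := N) β h) := by
  refine measurable_pi_iff.2 fun s => ?_
  unfold wL
  have : ∀ i j, Measurable fun W : Matrix (Fin N) (Fin N) ℝ => W i j := fun i j =>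
    (measurable_pi_apply j).comp (measurable_pi_apply i)
  refine Measurable.add_const (Measurable.const_mul (Finset.measurable_fun_sum _ fun i _ => Finset.measurable_fun_sum _ fun j _ => ?_) _) _
  exact ((this i j).mul_const _).mul_const _

lemma wL_symT {N : ℕ} (β h : ℝ) (x : Fin N × Fin N → ℝ) : wL β h (symT x) = skL β h x := by
  funext s
  unfold wL skL
  rw [add_comm]
  congr 1
  rw [← Fintype.sum_prod_type' (f := fun i j => symT x i j * spin (s i) * spin (s j))]
  have e : ∀ p : Fin N × Fin N, symT x p.1 p.2 * spin (s p.1) * spin (s p.2)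
      = (if p.1 < p.2 then spin (s p.1) * spin (s p.2) * x p else if p.1 = p.2 then x p else 0)
        + (if p.2 < p.1 then spin (s p.2) * spin (s p.1) * x p.swap else 0) := by
    rintro ⟨i, j⟩
    unfold symT
    rcases lt_trichotomy i j with h1 | h1 | h1
    · simp [h1, h1.le, h1.le.not_gt]; ring
    · subst h1
      simp [mul_assoc, spin_mul_self]
    · simp [h1, h1.ne', h1.not_ge, h1.le.not_gt]; ring
  rw [Finset.sum_congr rfl fun p _ => e p, Finset.sum_add_distrib]
  have e2 : ∑ p : Fin N × Fin N, (if p.2 < p.1 then spin (s p.2) * spin (s p.1) * x p.swap else 0)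
      = ∑ p : Fin N × Fin N, (if p.1 < p.2 then spin (s p.1) * spin (s p.2) * x p else 0) :=
    Equiv.sum_comp (Equiv.prodComm (Fin N) (Fin N))
      (fun p => if p.1 < p.2 then spin (s p.1) * spin (s p.2) * x p else 0)
  rw [e2, ← Finset.sum_add_distrib, Finset.mul_sum]
  refine Finset.sum_congr rfl fun p _ => ?_
  unfold skA
  split_ifs <;> ring
end

section
instance instProbGOE (N : ℕ) : IsProbabilityMeasure (GOE N) := by
  rw [GOE_eq]; exact Measure.isProbabilityMeasure_map measurable_symT.aemeasurable

/-- integrated ratio as a function of log weights -/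
def FF {N : ℕ} (q m : ℝ) (n : ℕ) (v0 : ℝ) (ℓ : (Fin N → Bool) → ℝ) : ℝ :=
  ∫ v in (0:ℝ)..v0, v ^ n * (gav ℓ (fun s => Mg m s ^ n) / VV ℓ (skY q v))

lemma skY_nonneg {N : ℕ} (q v : ℝ) (s t : Fin N → Bool) : 0 ≤ skY q v s t := by unfold skY; positivity

lemma cont_ratio {N : ℕ} (q m : ℝ) (n : ℕ) {X : Type} [TopologicalSpace X] {ℓ : X → (Fin N → Bool) → ℝ} {w : X → ℝ}
    (hℓ : ∀ s, Continuous fun x => ℓ x s) (hw : Continuous w) :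
    Continuous fun x => w x ^ n * (gav (ℓ x) (fun s => Mg m s ^ n) / VV (ℓ x) (skY q (w x))) := by
  have h1 : Continuous fun x => gav (ℓ x) (fun s => Mg m s ^ n) := continuous_gav hℓ fun s => continuous_const
  have h2 : Continuous fun x => VV (ℓ x) (skY q (w x)) := continuous_VV hℓ fun s t => by
    unfold skY; fun_prop
  exact (hw.pow n).mul (h1.div h2 fun x => (VV_pos _ _).ne')

lemma cont_FF {N : ℕ} (q m : ℝ) (n : ℕ) (v0 : ℝ) : Continuous (FF (N := N) q m n v0) := by
  unfold FF
  refine intervalIntegral.continuous_parametric_intervalIntegral_of_continuous' ?_ _ _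
  exact cont_ratio q m n (X := ((Fin N → Bool) → ℝ) × ℝ) (ℓ := fun w => w.1) (w := fun w => w.2)
    (fun s => (continuous_apply s).comp continuous_fst) continuous_snd

lemma ratio_le {N : ℕ} (hN : 1 ≤ N) (q : ℝ) {m : ℝ} (hm : |m| ≤ 1) (n : ℕ) {v : ℝ} (h0 : 0 ≤ v) (h1 : v ≤ 1) (ℓ : (Fin N → Bool) → ℝ) :
    |v ^ n * (gav ℓ (fun s => Mg m s ^ n) / VV ℓ (skY q v))| ≤ 2 ^ n := by
  refine PathData.abs_pow_mul_le n h0 h1 ?_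
  rw [abs_div, abs_of_pos (VV_pos _ _), div_le_iff₀ (VV_pos _ _)]
  have h2 : |gav ℓ (fun s => Mg m s ^ n)| ≤ 2 ^ n := abs_gav_le_const _ fun s => by
    rw [abs_pow]; have := abs_Mg_le hN hm s; gcongr
  have h3 := one_le_VV ℓ (skY q v) (skY_nonneg q v)
  have h4 : (0:ℝ) ≤ 2 ^ n := by positivity
  nlinarith

lemma abs_FF_le {N : ℕ} (hN : 1 ≤ N) (q : ℝ) {m : ℝ} (hm : |m| ≤ 1) (n : ℕ) {v0 : ℝ} (h0 : 0 ≤ v0) (h1 : v0 ≤ 1) (ℓ : (Fin N → Bool) → ℝ) :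
    |FF q m n v0 ℓ| ≤ 2 ^ n * |v0 - 0| := by
  unfold FF
  rw [← Real.norm_eq_abs]
  refine intervalIntegral.norm_integral_le_of_norm_le_const fun v hv => ?_
  rw [Set.uIoc_of_le h0] at hv
  exact ratio_le hN q hm n hv.1.le (hv.2.trans h1) ℓ

lemma integral_FF {N : ℕ} (hN : 1 ≤ N) (β h q : ℝ) {m : ℝ} (hm : |m| ≤ 1) (n : ℕ) {v0 : ℝ} (h0 : 0 ≤ v0) (h1 : v0 ≤ 1) :
    ∫ W, FF q m n v0 (wL β h W) ∂(GOE N) = JJ (N := N) β h q n v0 (fun s => Mg m s ^ n) := by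
  rw [GOE_eq, integral_map measurable_symT.aemeasurable]
  · simp only [wL_symT]
    unfold FF JJ
    refine (vx_swap (skPi N) (G := fun v x => v ^ n * (gav (skL β h x) (fun s => Mg m s ^ n) / VV (skL β h x) (skY q v))) ?_ h0
      (B := 2 ^ n) ?_).symm
    · refine cont_ratio q m n (X := ℝ × (Fin N × Fin N → ℝ)) (ℓ := fun w => skL β h w.2) (w := fun w => w.1) ?_ continuous_fst
      intro s
      unfold skL
      fun_prop
    · intro v x hv hv'
      exact ratio_le hN q hm n hv (hv'.trans h1) _
  · exact ((cont_FF q m n v0).measurable.comp (measurable_wL β h)).aestronglyMeasurable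

lemma FF_lower {N : ℕ} (q : ℝ) {C : ℝ} {m : ℝ} {n : ℕ} (hne : Even n) {v0 : ℝ} (h0 : 0 ≤ v0)
    (hv0 : v0 ^ 2 ≤ 1 / C) (ℓ : (Fin N → Bool) → ℝ)
    (hV : VV ℓ (fun s t => (N:ℝ) * (overlap s t - q) ^ 2 / C) ≤ 2) :
    gav ℓ (fun s => Mg m s ^ n) * (v0 ^ (n + 1) / (n + 1)) / 2 ≤ FF q m n v0 ℓ := by
  have hT : 0 ≤ gav ℓ (fun s => Mg m s ^ n) := gav_nonneg _ fun s => hne.pow_nonneg _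
  have e : ∫ v in (0:ℝ)..v0, v ^ n * (gav ℓ (fun s => Mg m s ^ n) / 2) = gav ℓ (fun s => Mg m s ^ n) * (v0 ^ (n + 1) / (n + 1)) / 2 := by
    rw [intervalIntegral.integral_mul_const, integral_pow]
    simp; ring
  rw [← e]
  unfold FF
  have c2 : Continuous fun v : ℝ => v ^ n * (gav ℓ (fun s => Mg m s ^ n) / VV ℓ (skY q v)) :=
    cont_ratio q m n (X := ℝ) (ℓ := fun _ => ℓ) (w := fun v => v) (fun s => continuous_const) continuous_id
  refine intervalIntegral.integral_mono_on h0 (Continuous.intervalIntegrable (by fun_prop) _ _) (c2.intervalIntegrable _ _) ?_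
  intro v hv
  have hvn : 0 ≤ v ^ n := pow_nonneg hv.1 n
  have hle : VV ℓ (skY q v) ≤ 2 := by
    refine le_trans ?_ hV
    unfold VV
    refine gav_mono _ fun s => gav_mono _ fun t => Real.exp_le_exp.2 ?_
    unfold skY
    rw [mul_pow, Real.sq_sqrt (Nat.cast_nonneg N)]
    have : v ^ 2 ≤ 1 / C := le_trans (by have := hv.1; have := hv.2; gcongr) hv0
    calc (N:ℝ) * v ^ 2 * (overlap s t - q) ^ 2 ≤ (N:ℝ) * (1 / C) * (overlap s t - q) ^ 2 := by gcongr
      _ = _ := by ring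
  have := VV_pos ℓ (skY q v)
  gcongr

lemma indicator_nonneg' {N : ℕ} (β h m : ℝ) (k : ℕ) (E : Set (Matrix (Fin N) (Fin N) ℝ)) (W : Matrix (Fin N) (Fin N) ℝ) :
    0 ≤ Set.indicator E (fun W' => ∫ σ, (overlap σ (onesConf N) - m) ^ (2 * k) ∂skGibbs W' β h) W := by
  refine Set.indicator_nonneg (fun W' _ => integral_nonneg fun s => ?_) W
  exact (even_two_mul k).pow_nonneg _

lemma trivial_bound {N : ℕ} (hN : 1 ≤ N) (β h : ℝ) {m : ℝ} (hm : |m| ≤ 1) (k : ℕ) (E : Set (Matrix (Fin N) (Fin N) ℝ)) :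
    ∫ W, Set.indicator E (fun W' => ∫ σ, (overlap σ (onesConf N) - m) ^ (2 * k) ∂skGibbs W' β h) W ∂GOE N ≤ 2 ^ (2 * k) := by
  have : ∫ W, Set.indicator E (fun W' => ∫ σ, (overlap σ (onesConf N) - m) ^ (2 * k) ∂skGibbs W' β h) W ∂GOE N
      ≤ ∫ W : Matrix (Fin N) (Fin N) ℝ, (2:ℝ) ^ (2 * k) ∂GOE N := by
    refine integral_mono_of_nonneg (Filter.Eventually.of_forall fun W => indicator_nonneg' β h m k E W) (integrable_const _)
      (Filter.Eventually.of_forall fun W => ?_)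
    refine Set.indicator_apply_le' (fun _ => ?_) (fun _ => by positivity)
    rw [integral_skGibbs]
    refine (le_abs_self _).trans (abs_gav_le_const _ fun s => ?_)
    rw [abs_pow]
    have := abs_Mg_le hN hm s
    unfold Mg at this
    exact pow_le_pow_left₀ (abs_nonneg _) this _
  simpa using this
end

/-- Magnetization moments on the overlap-concentration event: for
`β, h ≥ 0`, `C > 0` and any `k`, there is a constant `C_k` such that for all `N ≥ 1`,
`E[(R(σ,𝟏) − q₁(β,h))^{2k} · 1_{E_N}] ≤ C_k N^{−k}`, where the expectation is over
`W ~ GOE(N)` and a Gibbs sample `σ ~ μ_{βW,h𝟏}`, and `E_N` is the event that `μ_{βW,h𝟏}`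
satisfies exponential overlap concentration with constant `C`. -/
theorem stmt6 (β h C : ℝ) (hβ : 0 ≤ β) (hh : 0 ≤ h) (hC : 0 < C) (k : ℕ) :
    ∃ Ck : ℝ, 0 < Ck ∧ ∀ N : ℕ, 1 ≤ N →
      (∫ W, Set.indicator {W' : Matrix (Fin N) (Fin N) ℝ | overlapConc W' β h C}
          (fun W' => ∫ σ, (overlap σ (onesConf N) - q1 β h) ^ (2 * k) ∂skGibbs W' β h) W
        ∂GOE N) ≤ Ck / (N : ℝ) ^ k := by
  have hm := abs_q1_le β h
  rcases Nat.eq_zero_or_pos k with hk | hk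
  · refine ⟨2 ^ (2 * k), by positivity, fun N hN => ?_⟩
    refine (trivial_bound hN β h hm k _).trans ?_
    subst hk; simp
  obtain ⟨K, hK, hJ⟩ := JJ_bound β (n := 2 * k) (by omega) (even_two_mul k)
  set v0 : ℝ := min 1 (Real.sqrt (1 / C)) with hv0
  have hv0p : 0 < v0 := lt_min one_pos (Real.sqrt_pos.2 (by positivity))
  have hv1 : v0 ≤ 1 := min_le_left _ _
  have hvC : v0 ^ 2 ≤ 1 / C := by
    calc v0 ^ 2 ≤ (Real.sqrt (1 / C)) ^ 2 := by gcongr; exact min_le_right _ _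
      _ = 1 / C := Real.sq_sqrt (by positivity)
  set c0 : ℝ := v0 ^ (2 * k + 1) / ((2 * k : ℕ) + 1) with hc0
  have hc0p : 0 < c0 := by positivity
  refine ⟨2 ^ (2 * k) + 2 / c0 * K, by positivity, fun N hN => ?_⟩
  have hNp : (0:ℝ) < N := by exact_mod_cast hN
  rcases Nat.lt_or_ge N 2 with h2 | h2
  · refine (trivial_bound hN β h hm k _).trans ?_
    have : N = 1 := by omega
    subst this
    have : 0 ≤ 2 / c0 * K := by positivity
    simp only [Nat.cast_one, one_pow, div_one]
    linarith
  · have hb : ∫ W, Set.indicator {W' : Matrix (Fin N) (Fin N) ℝ | overlapConc W' β h C}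
          (fun W' => ∫ σ, (overlap σ (onesConf N) - q1 β h) ^ (2 * k) ∂skGibbs W' β h) W ∂GOE N
        ≤ ∫ W, 2 / c0 * FF (qOverlap β h) (q1 β h) (2 * k) v0 (wL β h W) ∂(GOE N) := by
      refine integral_mono_of_nonneg (Filter.Eventually.of_forall fun W => indicator_nonneg' β h _ k _ W) ?_
        (Filter.Eventually.of_forall fun W => ?_)
      · refine Integrable.const_mul ?_ _
        refine Integrable.of_bound ((cont_FF _ _ _ v0).measurable.comp (measurable_wL β h)).aestronglyMeasurable
          (2 ^ (2 * k) * |v0 - 0|) (Filter.Eventually.of_forall fun W => ?_)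
        exact abs_FF_le hN _ hm _ hv0p.le hv1 _
      · refine Set.indicator_apply_le' (fun hW => ?_) (fun _ => ?_)
        · rw [integral_skGibbs]
          have hW' : overlapConc W β h C := hW
          unfold overlapConc at hW'
          simp only [integral_skGibbs] at hW'
          have := FF_lower (m := q1 β h) (qOverlap β h) (even_two_mul k) hv0p.le hvC (wL β h W) hW'
          rw [← hc0] at this
          change gav (wL β h W) (fun s => Mg (q1 β h) s ^ (2 * k)) ≤ 2 / c0 * FF (qOverlap β h) (q1 β h) (2 * k) v0 (wL β h W)
          rw [div_mul_eq_mul_div, le_div_iff₀ hc0p]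
          linarith
        · refine mul_nonneg (by positivity) ?_
          unfold FF
          refine intervalIntegral.integral_nonneg hv0p.le fun v hv => ?_
          exact mul_nonneg (pow_nonneg hv.1 _) (div_nonneg (gav_nonneg _ fun s => (even_two_mul k).pow_nonneg _) (VV_pos _ _).le)
    refine hb.trans ?_
    rw [integral_const_mul, integral_FF hN β h _ hm _ hv0p.le hv1]
    have h3 := hJ N h2 h (qOverlap β h) (q1 β h) v0 (qOverlap_nonneg β h) (qOverlap_le_one β h) hv0p.le hv1 hm rfl
    have e : ((Real.sqrt N)⁻¹) ^ (2 * k) = 1 / (N:ℝ) ^ k := by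
      rw [pow_mul, inv_pow, Real.sq_sqrt hNp.le, inv_pow, one_div]
    rw [e] at h3
    calc _ ≤ 2 / c0 * (K * (1 / (N:ℝ) ^ k)) := by gcongr
      _ = 0 / (N:ℝ) ^ k + (2 / c0 * K) / (N:ℝ) ^ k := by ring
      _ ≤ _ := by
          rw [← add_div]
          have : (0:ℝ) ≤ 2 ^ (2 * k) := by positivity
          gcongr
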